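/- There exists a model of NFU ∪ {AxCount_≥} (NFU being NFU^{-AC} plus the Axiom of Choice) in which the internal set NCI of infinite cardinals is finite, i.e. which satisfies the L_NFU-sentence asserting that the cardinal of the set {κ : κ is a cardinal and κ ∉ ℕ} belongs to ℕ. -/

import Mathlib

open FirstOrder Language

namespace NFUweak

/-! ## The language L_NFU -/

/-- Function symbols of `L_NFU`: a single binary (type-level) pairing function. -/
inductive NFUFunc : ℕ → Type
  | pair : NFUFunc 2

/-- Relation symbols of `L_NFU`: binary membership `∈` and unary sethood `S`. -/
inductive NFURel : ℕ → Type
  | mem : NFURel 2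
  | isSet : NFURel 1

/-- The language `L_NFU`. -/
def LNFU : Language := ⟨NFUFunc, NFURel⟩

/-- The membership relation symbol. -/
def memR : LNFU.Relations 2 := NFURel.mem

/-- The sethood relation symbol. -/
def setR : LNFU.Relations 1 := NFURel.isSet

/-- The pairing function symbol. -/
def pairF : LNFU.Functions 2 := NFUFunc.pair

/-! ## Stratification -/

/-- `termLevel σ t k` says that, relative to the assignment `σ` of levels (types)
to variables, the term `t` (and all of its subterms) receives level `k`. -/
def termLevel {α : Type} (σ : α → ℕ) : LNFU.Term α → ℕ → Prop
  | Term.var v, k => σ v = k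
  | Term.func _ ts, k => ∀ i, termLevel σ (ts i) k

/-- The stratification condition on an atomic formula `R(ts)`:
for `s ∈ t` the level of `t` is one more than that of `s`; `S(t)` imposes only
that `t` has a well-defined level. -/
def atomOK {α : Type} (σ : α → ℕ) : ∀ {l : ℕ}, LNFU.Relations l → (Fin l → LNFU.Term α) → Prop
  | _, NFURel.mem, ts => ∃ k, termLevel σ (ts 0) k ∧ termLevel σ (ts 1) (k + 1)
  | _, NFURel.isSet, ts => ∃ k, termLevel σ (ts 0) k

/-- `stratifiedFrom σ φ` : the formula `φ` is stratified, where the free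
variables receive the levels given by `σ` (each quantified variable may receive
any level). -/
def stratifiedFrom : ∀ {n : ℕ}, ((Empty ⊕ Fin n) → ℕ) → LNFU.BoundedFormula Empty n → Prop
  | _, _, BoundedFormula.falsum => True
  | _, σ, BoundedFormula.equal t s => ∃ k, termLevel σ t k ∧ termLevel σ s k
  | _, σ, BoundedFormula.rel R ts => atomOK σ R ts
  | _, σ, BoundedFormula.imp f g => stratifiedFrom σ f ∧ stratifiedFrom σ g
  | _, σ, BoundedFormula.all f =>
      ∃ k, stratifiedFrom
        (Sum.elim (fun e => σ (Sum.inl e)) (Fin.snoc (fun i => σ (Sum.inr i)) k)) f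

/-- A formula of `L_NFU` is stratified if some assignment of levels to its
variables witnesses the stratification conditions. -/
def IsStratified {n : ℕ} (φ : LNFU.BoundedFormula Empty n) : Prop :=
  ∃ σ, stratifiedFrom σ φ

/-! ## The axioms of NFU⁻ᴬᶜ -/

/-- Weak extensionality: sets with the same members are equal. -/
def weakExtAx : LNFU.Sentence :=
  ∀' ∀' ((setR.boundedFormula₁ &0 ⊓
          setR.boundedFormula₁ &1) ⟹
    (Term.bdEqual &0 &1 ⇔
      ∀' (memR.boundedFormula₂ &2 &0 ⇔
          memR.boundedFormula₂ &2 &1)))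

/-- The pairing axiom: `⟨x,y⟩ = ⟨w,z⟩ → x = w ∧ y = z`. -/
def pairingAx : LNFU.Sentence :=
  ∀' ∀' ∀' ∀' (Term.bdEqual
      (pairF.apply₂ &0 &1)
      (pairF.apply₂ &2 &3) ⟹
    (Term.bdEqual &0 &2 ⊓ Term.bdEqual &1 &3))

/-- The comprehension axiom for a formula `φ(x, z₀, …, z_{m-1})`, where the
variable `x` is (de Bruijn) variable `m` of `φ` and `z₀, …, z_{m-1}` are the
parameters: `∀ z⃗ ∃ y (S(y) ∧ ∀ x (x ∈ y ↔ φ(x, z⃗)))`. -/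
def comprehensionAx (m : ℕ) (φ : LNFU.BoundedFormula Empty (m + 1)) : LNFU.Sentence :=
  BoundedFormula.alls (∃'
    (setR.boundedFormula₁ (Term.var (Sum.inr ⟨m, by omega⟩)) ⊓
      ∀' (memR.boundedFormula₂
            (Term.var (Sum.inr ⟨m + 1, by omega⟩)) (Term.var (Sum.inr ⟨m, by omega⟩)) ⇔
          φ.liftAt 1 m)))

/-- The theory NFU⁻ᴬᶜ : weak extensionality, pairing and stratified comprehension. -/
def NFUmAC : LNFU.Theory :=
  {weakExtAx, pairingAx} ∪
    {s | ∃ (m : ℕ) (φ : LNFU.BoundedFormula Empty (m + 1)),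
      IsStratified φ ∧ s = comprehensionAx m φ}

/-- The axiom `∀x S(x)` ("everything is a set"), turning NFU⁻ᴬᶜ into NF. -/
def allSetAx : LNFU.Sentence :=
  ∀' (setR.boundedFormula₁ &0)

/-- The theory NF. -/
def NF : LNFU.Theory := NFUmAC ∪ {allSetAx}

end NFUweak
namespace NFUweak

/-! ## Semantic notions inside a model of NFU⁻ᴬᶜ -/

section Semantics

variable {M : Type} [LNFU.Structure M]

/-- The membership relation of the model. -/
def smem (x y : M) : Prop := Structure.RelMap memR ![x, y]

/-- The sethood predicate of the model. -/
def sset (x : M) : Prop := Structure.RelMap setR ![x]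

/-- The (type-level) pairing function of the model. -/
def spair (x y : M) : M := Structure.funMap pairF ![x, y]

/-- `s` is the singleton `{x}`. -/
def isSingletonOf (s x : M) : Prop := sset s ∧ ∀ z, smem z s ↔ z = x

/-- `e` is the empty set. -/
def isEmptySet (e : M) : Prop := sset e ∧ ∀ z, ¬ smem z e

/-- `v` is the universal set `V`. -/
def isUniverseOf (v : M) : Prop := sset v ∧ ∀ x, smem x v

/-- `f` is an internal function from (the members of) `X` to `Y`, coded as a set of
type-level ordered pairs `⟨a, b⟩`. -/
def isFunc (f X Y : M) : Prop :=
  sset f ∧ (∀ p, smem p f → ∃ a b, p = spair a b ∧ smem a X ∧ smem b Y) ∧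
    (∀ a, smem a X → ∃ b, smem (spair a b) f) ∧
    (∀ a b b', smem (spair a b) f → smem (spair a b') f → b = b')

/-- `f` is an internal injection from `X` into `Y`. -/
def isInjFunc (f X Y : M) : Prop :=
  isFunc f X Y ∧ ∀ a a' b, smem (spair a b) f → smem (spair a' b) f → a = a'

/-- `f` is an internal bijection between `X` and `Y`. -/
def isBijFunc (f X Y : M) : Prop :=
  isInjFunc f X Y ∧ ∀ b, smem b Y → ∃ a, smem (spair a b) f

/-- `X` and `Y` are equipollent (internally). -/
def equipollent (X Y : M) : Prop := ∃ f, isBijFunc f X Y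

/-- `c` is the cardinal `|X|`, i.e. the equivalence class of `X` under equipollence. -/
def isCardOf (c X : M) : Prop := sset c ∧ ∀ y, smem y c ↔ equipollent y X

/-- `c` is a cardinal. -/
def isCardinal (c : M) : Prop := ∃ X, sset X ∧ isCardOf c X

/-- `κ ≤ μ` for cardinals: some member of `κ` injects into some member of `μ`. -/
def cardLe (κ μ : M) : Prop := ∃ X Y f, smem X κ ∧ smem Y μ ∧ isInjFunc f X Y

/-- `Y = ι``X` is the set of singletons of members of `X`. -/
def isIotaImageOf (Y X : M) : Prop :=
  sset Y ∧ ∀ z, smem z Y ↔ ∃ x, smem x X ∧ isSingletonOf z x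

/-- `t = T(c)` for a cardinal `c`:  `T(|X|) = |ι``X|`. -/
def isTOf (t c : M) : Prop :=
  ∃ X Y, smem X c ∧ isIotaImageOf Y X ∧ isCardOf t Y

/-- `t = T⁴(c)`. -/
def isT4Of (t c : M) : Prop :=
  ∃ t₁ t₂ t₃, isTOf t₁ c ∧ isTOf t₂ t₁ ∧ isTOf t₃ t₂ ∧ isTOf t t₃

/-- `z` is the cardinal `0`, the set of all objects with no members. -/
def isZeroCard (z : M) : Prop := sset z ∧ ∀ y, smem y z ↔ ∀ w, ¬ smem w y

/-- `s = S(x)` is the cardinal successor:  `S(x) = {y : (∃z∈y)(y∖{z} ∈ x)}`. -/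
def isSuccOf (s x : M) : Prop :=
  sset s ∧ ∀ y, smem y s ↔
    ∃ z, smem z y ∧ ∃ d, sset d ∧ (∀ w, smem w d ↔ (smem w y ∧ w ≠ z)) ∧ smem d x

/-- `o` is the cardinal `1 = S(0)`. -/
def isOneCard (o : M) : Prop := ∃ z, isZeroCard z ∧ isSuccOf o z

/-- `I` is an inductive set: it contains `0` and is closed under `S`. -/
def isInductiveSet (I : M) : Prop :=
  sset I ∧ (∀ z, isZeroCard z → smem z I) ∧ ∀ a b, smem a I → isSuccOf b a → smem b I

/-- `n` is an internal natural number: it belongs to every inductive set. -/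
def isNat (n : M) : Prop := ∀ I, isInductiveSet I → smem n I

/-- `N` is the set `ℕ` of internal natural numbers. -/
def isNatSet (N : M) : Prop := sset N ∧ ∀ y, smem y N ↔ isNat y

/-- `m + k = n` on cardinals, via disjoint unions. -/
def cardAdd (m k n : M) : Prop :=
  ∃ x y u, smem x m ∧ smem y k ∧ (∀ w, ¬ (smem w x ∧ smem w y)) ∧
    sset u ∧ (∀ w, smem w u ↔ (smem w x ∨ smem w y)) ∧ smem u n

/-- `P` is the cartesian product `x × y` (with type-level pairs). -/
def isProdOf (P x y : M) : Prop :=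
  sset P ∧ ∀ p, smem p P ↔ ∃ a b, smem a x ∧ smem b y ∧ p = spair a b

/-- `k · m = n` on cardinals, via cartesian products. -/
def cardMul (k m n : M) : Prop :=
  ∃ x y P, smem x k ∧ smem y m ∧ isProdOf P x y ∧ smem P n

/-- `m ≤ n` on internal natural numbers: `∃k∈ℕ, m + k = n`. -/
def natLe (m n : M) : Prop := ∃ k, isNat k ∧ cardAdd m k n

/-- The model satisfies `AxCount₍≥₎ : (∀n∈ℕ)(T(n) ≤ n)`. -/
def axCountGeqHolds (M : Type) [LNFU.Structure M] : Prop :=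
  ∀ n : M, isNat n → ∀ t, isTOf t n → natLe t n

/-- The model satisfies `AxCount₍≤₎ : (∀n∈ℕ)(n ≤ T(n))`. -/
def axCountLeqHolds (M : Type) [LNFU.Structure M] : Prop :=
  ∀ n : M, isNat n → ∀ t, isTOf t n → natLe n t

/-- The model satisfies `AxCount : (∀n∈ℕ)(T(n) = n)`. -/
def axCountHolds (M : Type) [LNFU.Structure M] : Prop :=
  ∀ n : M, isNat n → ∀ t, isTOf t n → t = n

/-- The model satisfies the Axiom of Choice: every set of pairwise disjoint
nonempty sets has a transversal. -/
def acHolds (M : Type) [LNFU.Structure M] : Prop :=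
  ∀ X : M, sset X →
    (∀ y, smem y X → sset y ∧ ∃ z, smem z y) →
    (∀ y y', smem y X → smem y' X → y ≠ y' → ∀ z, ¬ (smem z y ∧ smem z y')) →
    ∃ t, sset t ∧ ∀ y, smem y X → ∃! z, smem z y ∧ smem z t

/-- `2^κ` is defined (i.e. `2^κ ≠ ∅`): there is a set `X` with `|ι``X| = κ`. -/
def twoPowDefined (κ : M) : Prop := ∃ X Y, isIotaImageOf Y X ∧ isCardOf κ Y

/-- `P` is the power set of `X`. -/
def isPowerSetOf (P X : M) : Prop :=
  sset P ∧ ∀ z, smem z P ↔ (sset z ∧ ∀ w, smem w z → smem w X)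

/-- `μ = 2^κ` (in the nonempty case): `μ = |P(X)|` for some `X` with `|ι``X| = κ`. -/
def isTwoPowOf (μ κ : M) : Prop :=
  ∃ X Y P, isIotaImageOf Y X ∧ isCardOf κ Y ∧ isPowerSetOf P X ∧ isCardOf μ P

/-- `f` is the internal function `beth : ℕ → NC ∪ {∅}` with `beth(0) = ℵ₀` and
`beth(n+1) = 2^{beth(n)}` (with value `∅` once undefined). -/
def isBethFun (f : M) : Prop :=
  sset f ∧
    (∀ p, smem p f → ∃ n y, isNat n ∧ p = spair n y) ∧
    (∀ n, isNat n → ∃ y, smem (spair n y) f) ∧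
    (∀ n y y', smem (spair n y) f → smem (spair n y') f → y = y') ∧
    (∀ z y, isZeroCard z → smem (spair z y) f → ∃ N, isNatSet N ∧ isCardOf y N) ∧
    (∀ n n' y y', isNat n → isSuccOf n' n →
      smem (spair n y) f → smem (spair n' y') f →
        ((isEmptySet y ∧ isEmptySet y') ∨
          (¬ isEmptySet y ∧
            (isTwoPowOf y' y ∨ (isEmptySet y' ∧ ¬ twoPowDefined y)))))

end Semantics

end NFUweak
namespace NFUweak

/-! ## BFEXTs and the structure ⟨BF, E⟩ inside a model of NFU⁻ᴬᶜ -/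

section BF

variable {M : Type} [LNFU.Structure M]

/-- `R` is an internal binary relation: a set of (type-level) ordered pairs. -/
def isRel (R : M) : Prop := sset R ∧ ∀ p, smem p R → ∃ x y, p = spair x y

/-- `x` belongs to the field `Dom(R) = dom(R) ∪ rng(R)` of the relation `R`. -/
def inField (x R : M) : Prop := ∃ y, smem (spair x y) R ∨ smem (spair y x) R

/-- `D` is the field `Dom(R)` of `R`, as a set. -/
def isFieldSetOf (D R : M) : Prop := sset D ∧ ∀ x, smem x D ↔ inField x R

/-- `R` is a BFEXT: a binary relation that is well-founded (every nonempty
subset of its field has an `R`-minimal element) and extensional. -/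
def isBFEXT (R : M) : Prop :=
  isRel R ∧
    (∀ B, sset B → (∃ b, smem b B) → (∀ b, smem b B → inField b R) →
      ∃ b, smem b B ∧ ∀ c, smem c B → ¬ smem (spair c b) R) ∧
    (∀ a b, inField a R → inField b R →
      (∀ c, smem (spair c a) R ↔ smem (spair c b) R) → a = b)

/-- `x` belongs to the smallest subset of `Dom(R)` containing `a` and closed
under `R`-predecessors. -/
def inSeg (x R a : M) : Prop :=
  ∀ B, sset B → (∀ b, smem b B → inField b R) → smem a B →
    (∀ b c, smem b B → smem (spair c b) R → smem c B) → smem x B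

/-- `s = seg_R(a)`: the restriction of `R` to the smallest subset of `Dom(R)`
containing `a` and closed under `R`-predecessors. -/
def isSegOf (s R a : M) : Prop :=
  sset s ∧ ∀ p, smem p s ↔
    (smem p R ∧ ∃ x y, p = spair x y ∧ inSeg x R a ∧ inSeg y R a)

/-- `R ∈ Ω`: `R` is a BFEXT with `R = seg_R(a)` for some `a ∈ Dom(R)`. -/
def inOmega (R : M) : Prop := isBFEXT R ∧ ∃ a, inField a R ∧ isSegOf R R a

/-- `a = 1_R` is the (unique) top of `R ∈ Ω`. -/
def isTopOf (a R : M) : Prop := inField a R ∧ isSegOf R R a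

/-- `f` is an internal isomorphism between the relations `R` and `S`. -/
def isIsoRel (f R S : M) : Prop :=
  sset f ∧
    (∀ p, smem p f → ∃ x y, p = spair x y ∧ inField x R ∧ inField y S) ∧
    (∀ x, inField x R → ∃ y, smem (spair x y) f) ∧
    (∀ x y y', smem (spair x y) f → smem (spair x y') f → y = y') ∧
    (∀ x x' y, smem (spair x y) f → smem (spair x' y) f → x = x') ∧
    (∀ y, inField y S → ∃ x, smem (spair x y) f) ∧
    (∀ x y x' y', smem (spair x x') f → smem (spair y y') f →
      (smem (spair x y) R ↔ smem (spair x' y') S))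

/-- `R` and `S` are isomorphic relations. -/
def relIso (R S : M) : Prop := ∃ f, isIsoRel f R S

/-- `t = [R]` is the set of all relations isomorphic to `R`. -/
def isTypeOf (t R : M) : Prop := sset t ∧ ∀ S, smem S t ↔ relIso S R

/-- `a ∈ BF`: `a = [R]` for some `R ∈ Ω`. -/
def inBF (a : M) : Prop := ∃ R, inOmega R ∧ isTypeOf a R

/-- `a E b` for `a, b ∈ BF`: for `R ∈ a`, `S ∈ b` there is `x ∈ Dom(S)` with
`⟨x, 1_S⟩ ∈ S` and `R ≅ seg_S(x)`. -/
def erel (a b : M) : Prop :=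
  ∃ R S, smem R a ∧ smem S b ∧
    ∃ x oneS, isTopOf oneS S ∧ smem (spair x oneS) S ∧
      ∃ sg, isSegOf sg S x ∧ relIso R sg

/-- `e` is the set `E ⊆ BF × BF`. -/
def isESet (e : M) : Prop :=
  sset e ∧ ∀ p, smem p e ↔ ∃ a b, p = spair a b ∧ inBF a ∧ inBF b ∧ erel a b

/-- `R' = T(R)`: the relation `{⟨{x},{y}⟩ : ⟨x,y⟩ ∈ R}`. -/
def isTRelOf (R' R : M) : Prop :=
  sset R' ∧ ∀ p, smem p R' ↔
    ∃ x y sx sy, smem (spair x y) R ∧ isSingletonOf sx x ∧ isSingletonOf sy y ∧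
      p = spair sx sy

/-- `t' = T(t)` for (isomorphism) types `t` of well-founded relations:
`T([R]) = [{⟨{x},{y}⟩ : ⟨x,y⟩ ∈ R}]`. -/
def isTTypeOf (t' t : M) : Prop :=
  ∃ R R', smem R t ∧ isTRelOf R' R ∧ isTypeOf t' R'

/-- `y = M₀ = E^ω`, the set of types of BFEXTs with finite domain. -/
def isM0Set (y : M) : Prop :=
  sset y ∧ ∀ a, smem a y ↔
    (inBF a ∧ ∃ R D c, smem R a ∧ isFieldSetOf D R ∧ isCardOf c D ∧ isNat c)

/-- `g` is the internal function `n ↦ M_n = E^{ω+n}` on the internal naturals: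
`M_0 = E^ω` and `M_{n+1} = {a ∈ BF : every E-predecessor of a lies in M_n}`. -/
def isMFun (g : M) : Prop :=
  sset g ∧
    (∀ p, smem p g → ∃ n y, isNat n ∧ p = spair n y) ∧
    (∀ n, isNat n → ∃ y, smem (spair n y) g) ∧
    (∀ n y y', smem (spair n y) g → smem (spair n y') g → y = y') ∧
    (∀ z y, isZeroCard z → smem (spair z y) g → isM0Set y) ∧
    (∀ n n' y y', isNat n → isSuccOf n' n →
      smem (spair n y) g → smem (spair n' y') g →
        (sset y' ∧ ∀ a, smem a y' ↔ (inBF a ∧ ∀ b, inBF b → erel b a → smem b y)))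

end BF

end NFUweak
namespace NFUweak

/-! ## The Simple Theory of Types with Infinity (TSTI) -/

/-- Formulae of the many-sorted language `L_TST`, with named variables:
`mem n i j` is `x^n_i ∈_n x^{n+1}_j`, `eq n i j` is `x^n_i = x^n_j`, and
`all n i φ` is `∀ x^n_i, φ`. -/
inductive TSTFormula : Type
  | mem (n i j : ℕ)
  | eq (n i j : ℕ)
  | fal
  | imp (φ ψ : TSTFormula)
  | all (n i : ℕ) (φ : TSTFormula)

/-- Update a many-sorted valuation at variable `x^n_i`. -/
def tstUpd {M : ℕ → Type} (v : ∀ n, ℕ → M n) (n i : ℕ) (a : M n) : ∀ m, ℕ → M m :=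
  fun m j => if h : m = n ∧ j = i then (congrArg M h.1).symm ▸ a else v m j

/-- Satisfaction of an `L_TST`-formula in the many-sorted structure `⟨M, E⟩`
under the valuation `v`. -/
def TSTFormula.Realize {M : ℕ → Type} (E : ∀ n, M n → M (n + 1) → Prop) :
    TSTFormula → (∀ n, ℕ → M n) → Prop
  | .mem n i j, v => E n (v n i) (v (n + 1) j)
  | .eq n i j, v => v n i = v n j
  | .fal, _ => False
  | .imp φ ψ, v => φ.Realize E v → ψ.Realize E v
  | .all n i φ, v => ∀ a : M n, φ.Realize E (tstUpd v n i a)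

/-- All sorts mentioned in the formula are `< k` (so it is an `L_k`-formula). -/
def TSTFormula.sortsLT : TSTFormula → ℕ → Prop
  | .mem n _ _, k => n + 1 < k
  | .eq n _ _, k => n < k
  | .fal, _ => True
  | .imp φ ψ, k => φ.sortsLT k ∧ ψ.sortsLT k
  | .all n _ φ, k => n < k ∧ φ.sortsLT k

/-- `p : M 2` is the Kuratowski ordered pair `⟨a, b⟩ = {{a},{a,b}}`. -/
def isKPair {M : ℕ → Type} (E : ∀ n, M n → M (n + 1) → Prop)
    (p : M 2) (a b : M 0) : Prop :=
  ∀ s : M 1, E 1 s p ↔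
    ((∀ z, E 0 z s ↔ z = a) ∨ (∀ z, E 0 z s ↔ (z = a ∨ z = b)))

/-- The axiom of Infinity: there are `x¹` and `f³` such that `f³` codes an
injective, non-surjective function from `x¹` to `x¹` (with Kuratowski pairs). -/
def TSTInfinity {M : ℕ → Type} (E : ∀ n, M n → M (n + 1) → Prop) : Prop :=
  ∃ (X : M 1) (f : M 3),
    (∀ p : M 2, E 2 p f → ∃ a b, E 0 a X ∧ E 0 b X ∧ isKPair E p a b) ∧
    (∀ a, E 0 a X → ∃ b p, E 0 b X ∧ E 2 p f ∧ isKPair E p a b) ∧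
    (∀ a b b' p p', E 2 p f → E 2 p' f → isKPair E p a b → isKPair E p' a b' → b = b') ∧
    (∀ a a' b p p', E 2 p f → E 2 p' f → isKPair E p a b → isKPair E p' a' b → a = a') ∧
    (∃ b, E 0 b X ∧ ∀ a p, E 2 p f → ¬ isKPair E p a b)

/-- `⟨M, E⟩` is a model of TSTI: all sorts are nonempty and Extensionality,
Comprehension (for every `L_TST`-formula) and Infinity hold. -/
def IsTSTIModel (M : ℕ → Type) (E : ∀ n, M n → M (n + 1) → Prop) : Prop :=
  (∀ n, Nonempty (M n)) ∧
    (∀ n, ∀ x y : M (n + 1), (∀ z, E n z x ↔ E n z y) → x = y) ∧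
    (∀ (φ : TSTFormula) (n i : ℕ) (v : ∀ m, ℕ → M m),
      ∃ y : M (n + 1), ∀ x : M n, E n x y ↔ φ.Realize E (tstUpd v n i x)) ∧
    TSTInfinity E

/-- `⟨M, E⟩` is a model of the fragment TSTI_k, which only refers to the sorts
`< k` (so `k ≥ 4` is needed for the axiom of Infinity to be expressible). -/
def IsTSTIModelBelow (k : ℕ) (M : ℕ → Type) (E : ∀ n, M n → M (n + 1) → Prop) : Prop :=
  (∀ n, n < k → Nonempty (M n)) ∧
    (∀ n, n + 1 < k → ∀ x y : M (n + 1), (∀ z, E n z x ↔ E n z y) → x = y) ∧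
    (∀ (φ : TSTFormula), φ.sortsLT k → ∀ (n i : ℕ), n + 1 < k →
      ∀ v : ∀ m, ℕ → M m,
        ∃ y : M (n + 1), ∀ x : M n, E n x y ↔ φ.Realize E (tstUpd v n i x)) ∧
    TSTInfinity E

/-! ## The language of arithmetic and the internal arithmetic of a model -/

/-- Function symbols of `L_PA`: `0`, `1`, `+` and `·`. -/
inductive PAFunc : ℕ → Type
  | zero : PAFunc 0
  | one : PAFunc 0
  | add : PAFunc 2
  | mul : PAFunc 2

/-- The language `L_PA` of arithmetic. -/
def LPA : Language := ⟨PAFunc, fun _ => Empty⟩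

/-- The type of internal natural numbers of a model of NFU⁻ᴬᶜ. -/
def NatSub (M : Type) [LNFU.Structure M] : Type := {n : M // isNat n}

/-- An `L_PA`-structure on the internal natural numbers of `M` is the internal
arithmetic if its operations are given by the internal graphs of `0`, `1`,
cardinal addition and cardinal multiplication. -/
def InternalArithOn (M : Type) [LNFU.Structure M] (A : LPA.Structure (NatSub M)) : Prop :=
  isZeroCard (A.funMap PAFunc.zero ![]).val ∧
    isOneCard (A.funMap PAFunc.one ![]).val ∧
    (∀ a b : NatSub M, cardAdd a.val b.val (A.funMap PAFunc.add ![a, b]).val) ∧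
    (∀ a b : NatSub M, cardMul a.val b.val (A.funMap PAFunc.mul ![a, b]).val)

/-- `φ^ℕ` holds in `M`: the sentence `φ` of `L_PA` is true in the internal
arithmetic `⟨ℕ, +, ·, 0, 1⟩` of `M`. -/
def internalPASat (M : Type) [LNFU.Structure M] (φ : LPA.Sentence) : Prop :=
  ∀ A : LPA.Structure (NatSub M), InternalArithOn M A →
    @Sentence.Realize LPA (NatSub M) A φ

end NFUweak
namespace NFUweak

/-- The internal set NCI of infinite cardinals is finite. -/
def NCIFinite (M : Type) [LNFU.Structure M] : Prop :=
  ∃ X c : M, sset X ∧ (∀ y, smem y X ↔ (isCardinal y ∧ ¬ isNat y)) ∧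
    isCardOf c X ∧ isNat c

end NFUweak

namespace NFUweak
namespace Base

/-! ## Trees over a well-order -/

/-- Finite binary trees with leaves in `W`. -/
inductive Tree (W : Type) : Type
  | leaf (a : W) : Tree W
  | node (l r : Tree W) : Tree W

namespace Tree

variable {W : Type}

/-- left component -/
def fst : Tree W → Tree W
  | leaf a => leaf a
  | node l _ => l

/-- right component -/
def snd : Tree W → Tree W
  | leaf a => leaf a
  | node _ r => r

/-- number of leaves minus one -/
def size : Tree W → ℕ
  | leaf _ => 0
  | node l r => l.size + r.size + 1

/-- relabelling of leaves -/
def map (f : W → W) : Tree W → Tree W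
  | leaf a => leaf (f a)
  | node l r => node (l.map f) (r.map f)

/-- Polish form -/
def enc : Tree W → List (WithBot W)
  | leaf a => [(a : WithBot W)]
  | node l r => ⊥ :: (enc l ++ enc r)

theorem enc_append_inj : ∀ (s t : Tree W) (l m : List (WithBot W)),
    enc s ++ l = enc t ++ m → s = t ∧ l = m
  | leaf a, leaf b, l, m, h => by
      simp [enc] at h; exact ⟨by rw [h.1], h.2⟩
  | leaf a, node b c, l, m, h => by simp [enc] at h
  | node b c, leaf a, l, m, h => by simp [enc] at h
  | node a b, node c d, l, m, h => by
      simp only [enc, List.cons_append, List.append_assoc, List.cons.injEq, true_and] at h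
      obtain ⟨h1, h2⟩ := enc_append_inj a c _ _ h
      obtain ⟨h3, h4⟩ := enc_append_inj b d _ _ h2
      exact ⟨by rw [h1, h3], h4⟩

theorem enc_inj {s t : Tree W} (h : enc s = enc t) : s = t :=
  (enc_append_inj s t [] [] (by simpa using h)).1

theorem enc_length_pos (s : Tree W) : 0 < (enc s).length := by
  cases s <;> simp [enc]

theorem size_map (f : W → W) (t : Tree W) : (t.map f).size = t.size := by
  induction t with
  | leaf a => rfl
  | node l r h1 h2 => simp [map, size, h1, h2]

theorem enc_map (f : W → W) (t : Tree W) : (t.map f).enc = t.enc.map (WithBot.map f) := by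
  induction t with
  | leaf a => rfl
  | node l r h1 h2 => simp [map, enc, h1, h2]

theorem fst_map (f : W → W) (t : Tree W) : (t.map f).fst = t.fst.map f := by
  cases t <;> rfl

theorem snd_map (f : W → W) (t : Tree W) : (t.map f).snd = t.snd.map f := by
  cases t <;> rfl

variable [LinearOrder W]

/-- maximal leaf -/
def rank : Tree W → W
  | leaf a => a
  | node l r => max l.rank r.rank

theorem rank_fst (t : Tree W) : t.fst.rank ≤ t.rank := by
  cases t <;> simp [fst, rank]

theorem rank_snd (t : Tree W) : t.snd.rank ≤ t.rank := by
  cases t <;> simp [snd, rank]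

theorem rank_node_lt {l r : Tree W} {γ : W} :
    (node l r).rank < γ ↔ l.rank < γ ∧ r.rank < γ := by simp [rank]

/-- sorting key -/
def key (t : Tree W) : W × List (WithBot W) := (t.rank, t.enc)

/-- the canonical order on trees -/
def tlt (s t : Tree W) : Prop := Prod.Lex (· < ·) (List.Shortlex (· < ·)) s.key t.key

theorem tlt_def {s t : Tree W} :
    tlt s t ↔ s.rank < t.rank ∨ (s.rank = t.rank ∧ List.Shortlex (· < ·) s.enc t.enc) := by
  simp [tlt, Prod.lex_def, key]

instance : IsTrans (List (WithBot W)) (List.Shortlex (· < ·)) := by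
  constructor
  intro a b c h1 h2
  rw [List.shortlex_def] at *
  rcases h1 with h1 | ⟨h1, h1'⟩ <;> rcases h2 with h2 | ⟨h2, h2'⟩
  · left; omega
  · left; omega
  · left; omega
  · right; exact ⟨h1.trans h2, lt_trans (α := List (WithBot W)) h1' h2'⟩

theorem tlt_trans {a b c : Tree W} (h1 : tlt a b) (h2 : tlt b c) : tlt a c := by
  rw [tlt_def] at *
  rcases h1 with h1 | ⟨h1, h1'⟩ <;> rcases h2 with h2 | ⟨h2, h2'⟩
  · left; exact h1.trans h2
  · left; exact h2 ▸ h1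
  · left; exact h1 ▸ h2
  · right; exact ⟨h1.trans h2, _root_.trans h1' h2'⟩

theorem tlt_irrefl (a : Tree W) : ¬ tlt a a := by
  rw [tlt_def]
  rintro (h | ⟨_, h⟩)
  · exact lt_irrefl _ h
  · exact (Std.Asymm.asymm _ _ h h)

theorem tlt_tri (a b : Tree W) : tlt a b ∨ a = b ∨ tlt b a := by
  simp only [tlt_def]
  rcases lt_trichotomy a.rank b.rank with h | h | h
  · exact Or.inl (Or.inl h)
  · rcases trichotomous_of (List.Shortlex (· < ·)) a.enc b.enc with h' | h' | h'
    · exact Or.inl (Or.inr ⟨h, h'⟩)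
    · exact Or.inr (Or.inl (enc_inj h'))
    · exact Or.inr (Or.inr (Or.inr ⟨h.symm, h'⟩))
  · exact Or.inr (Or.inr (Or.inl h))

open Classical in
noncomputable instance : LinearOrder (Tree W) where
  lt := tlt
  le a b := a = b ∨ tlt a b
  le_refl a := Or.inl rfl
  le_trans a b c := by
    rintro (rfl | h1) (rfl | h2)
    · exact Or.inl rfl
    · exact Or.inr h2
    · exact Or.inr h1
    · exact Or.inr (tlt_trans h1 h2)
  lt_iff_le_not_ge a b := by
    constructor
    · intro h
      refine ⟨Or.inr h, ?_⟩
      rintro (rfl | h')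
      · exact tlt_irrefl _ h
      · exact tlt_irrefl _ (tlt_trans h h')
    · rintro ⟨rfl | h, h'⟩
      · exact absurd (Or.inl rfl) h'
      · exact h
  le_antisymm a b := by
    rintro (rfl | h1) (h | h2)
    · rfl
    · rfl
    · exact h.symm
    · exact absurd (tlt_trans h1 h2) (tlt_irrefl _)
  le_total a b := by
    rcases tlt_tri a b with h | h | h
    · exact Or.inl (Or.inr h)
    · exact Or.inl (Or.inl h)
    · exact Or.inr (Or.inr h)
  toDecidableLE := fun _ _ => Classical.propDecidable _

theorem lt_def {s t : Tree W} :
    s < t ↔ s.rank < t.rank ∨ (s.rank = t.rank ∧ List.Shortlex (· < ·) s.enc t.enc) := tlt_def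

theorem rank_le_of_lt {s t : Tree W} (h : s < t) : s.rank ≤ t.rank := by
  rcases lt_def.1 h with h | h
  · exact h.le
  · exact h.1.le

theorem lt_leaf {s : Tree W} {a : W} : s < leaf a ↔ s.rank < a := by
  rw [lt_def]
  constructor
  · rintro (h | ⟨h, h'⟩)
    · exact h
    · exfalso
      cases s with
      | leaf b =>
        simp only [rank] at h
        subst h
        exact (Std.Asymm.asymm _ _ h' h')
      | node l r =>
        have h1 := enc_length_pos l
        rw [List.shortlex_def] at h'
        simp [enc] at h'
        rw [h'.1.1] at h1
        simp at h1
  · intro h; exact Or.inl h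

instance [WellFoundedLT W] : WellFoundedLT (Tree W) := by
  constructor
  have h1 : WellFounded (Prod.Lex ((· < ·) : W → W → Prop)
      (List.Shortlex ((· < ·) : WithBot W → WithBot W → Prop))) :=
    WellFounded.prod_lex wellFounded_lt (List.Shortlex.wf wellFounded_lt)
  exact InvImage.wf key h1

theorem rank_map {f : W → W} {δ : W} (hf : StrictMonoOn f (Set.Iio δ)) :
    ∀ {t : Tree W}, t.rank < δ → (t.map f).rank = f t.rank
  | leaf a, _ => rfl
  | node l r, h => by
    obtain ⟨h1, h2⟩ := rank_node_lt.1 h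
    simp only [map, rank, rank_map hf h1, rank_map hf h2]
    exact ((hf.monotoneOn).map_max h1 h2).symm

theorem mem_enc_lt {δ : W} : ∀ {t : Tree W}, t.rank < δ → ∀ a ∈ t.enc, a < (δ : WithBot W)
  | leaf a, h, b, hb => by
    simp [enc] at hb; subst hb; exact_mod_cast h
  | node l r, h, b, hb => by
    obtain ⟨h1, h2⟩ := rank_node_lt.1 h
    simp only [enc, List.mem_cons, List.mem_append] at hb
    rcases hb with rfl | hb | hb
    · exact WithBot.bot_lt_coe _
    · exact mem_enc_lt h1 b hb
    · exact mem_enc_lt h2 b hb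

theorem lex_map {f : W → W} {δ : W} (hf : StrictMonoOn f (Set.Iio δ)) :
    ∀ {l m : List (WithBot W)}, (∀ a ∈ l, a < (δ : WithBot W)) → (∀ a ∈ m, a < (δ : WithBot W)) →
      List.Lex (· < ·) l m → List.Lex (· < ·) (l.map (WithBot.map f)) (m.map (WithBot.map f)) := by
  intro l m hl hm h
  induction h with
  | nil => exact List.Lex.nil
  | cons h ih =>
    simp only [List.map_cons]
    exact List.Lex.cons (ih (fun a ha => hl a (List.mem_cons_of_mem _ ha))
      (fun a ha => hm a (List.mem_cons_of_mem _ ha)))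
  | @rel a _ b _ h =>
    simp only [List.map_cons]
    apply List.Lex.rel
    have h1 := hl _ List.mem_cons_self
    have h2 := hm _ List.mem_cons_self
    induction a using WithBot.recBotCoe with
    | bot =>
      induction b using WithBot.recBotCoe with
      | bot => exact absurd h (lt_irrefl _)
      | coe b => exact WithBot.bot_lt_coe _
    | coe a =>
      induction b using WithBot.recBotCoe with
      | bot => exact absurd h not_lt_bot
      | coe b =>
        simp only [WithBot.map_coe, WithBot.coe_lt_coe] at *
        exact hf h1 h2 h

theorem map_lt {f : W → W} {δ : W} (hf : StrictMonoOn f (Set.Iio δ)) {s t : Tree W}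
    (hs : s.rank < δ) (ht : t.rank < δ) (h : s < t) : s.map f < t.map f := by
  rw [lt_def] at *
  rw [rank_map hf hs, rank_map hf ht]
  rcases h with h | ⟨h, h'⟩
  · exact Or.inl (hf hs ht h)
  · refine Or.inr ⟨by rw [h], ?_⟩
    rw [enc_map, enc_map]
    rw [List.shortlex_def] at *
    rcases h' with h' | ⟨h1, h2⟩
    · left; simpa using h'
    · right; exact ⟨by simpa using h1, lex_map hf (mem_enc_lt hs) (mem_enc_lt ht) h2⟩

theorem map_lt_iff {f : W → W} {δ : W} (hf : StrictMonoOn f (Set.Iio δ)) {s t : Tree W}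
    (hs : s.rank < δ) (ht : t.rank < δ) : s.map f < t.map f ↔ s < t := by
  refine ⟨fun h => ?_, map_lt hf hs ht⟩
  rcases lt_trichotomy s t with h' | h' | h'
  · exact h'
  · subst h'; exact absurd h (lt_irrefl _)
  · exact absurd (h.trans (map_lt hf ht hs h')) (lt_irrefl _)

theorem map_inj {f : W → W} {δ : W} (hf : StrictMonoOn f (Set.Iio δ)) {s t : Tree W}
    (hs : s.rank < δ) (ht : t.rank < δ) : s.map f = t.map f ↔ s = t := by
  refine ⟨fun h => ?_, fun h => by rw [h]⟩
  rcases lt_trichotomy s t with h' | h' | h'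
  · exact absurd h (map_lt hf hs ht h').ne
  · exact h'
  · exact absurd h (map_lt hf ht hs h').ne'

end Tree

/-- Collapsing a subset of a well-order onto an initial segment. -/
theorem exists_collapse {α : Type} [LinearOrder α] [WellFoundedLT α] (O : Set α) :
    ∃ g : α → α, (∀ a ∈ O, ∀ b ∈ O, a < b → g a < g b) ∧ (∀ a ∈ O, g a ≤ a) ∧
      (∀ a ∈ O, ∀ c, c < g a → ∃ b ∈ O, b < a ∧ g b = c) := by
  classical
  let i : (Subrel (· < ·) (· ∈ O)) ↪r ((· < ·) : α → α → Prop) := Subrel.relEmbedding _ _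
  let g := i.collapse
  have hm : ∀ a b : O, a < b → g a < g b := fun a b h => g.map_rel_iff.2 h
  have hlow : ∀ (a : O) c, c < g a → ∃ b, g b = c := fun a c h => g.mem_range_of_rel h
  have hle : ∀ a : O, g a ≤ (a : α) := by
    intro a
    induction a using (IsWellFounded.wf (r := ((· < ·) : O → O → Prop))).induction with
    | _ a ih =>
      by_contra hlt
      push Not at hlt
      obtain ⟨b, hb⟩ := hlow a _ hlt
      have hba : b < a := by
        rcases lt_trichotomy b a with h | h | h
        · exact h
        · subst h; rw [hb] at hlt; exact absurd hlt (lt_irrefl _)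
        · have := hm _ _ h; rw [hb] at this; exact absurd (this.trans hlt) (lt_irrefl _)
      have := ih b hba
      rw [hb] at this
      exact absurd hba (not_lt.2 this)
  refine ⟨fun a => if h : a ∈ O then g ⟨a, h⟩ else a, ?_, ?_, ?_⟩
  · intro a ha b hb hab
    simp only [ha, hb, dif_pos]
    exact hm _ _ hab
  · intro a ha
    simp only [ha, dif_pos]
    exact hle ⟨a, ha⟩
  · intro a ha c hc
    simp only [ha, dif_pos] at hc
    obtain ⟨b, hb⟩ := hlow _ _ hc
    refine ⟨b, b.2, ?_, by simp [hb]⟩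
    rw [← hb] at hc
    exact g.map_rel_iff.1 hc

end Base
end NFUweak

namespace NFUweak
namespace Base

/-! ## Terms, formulas and satisfaction -/

/-- terms describing a component of the environment tree -/
inductive Tm : Type
  | env : Tm
  | fst (t : Tm) : Tm
  | snd (t : Tm) : Tm
  | node (s t : Tm) : Tm

/-- formulas -/
inductive Fm : Type
  | mem (s t : Tm) : Fm
  | lt (s t : Tm) : Fm
  | eq (s t : Tm) : Fm
  | fal : Fm
  | imp (f g : Fm) : Fm
  | all (f : Fm) : Fm

/-- a numbering of terms -/
def Tm.code : Tm → ℕ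
  | env => Nat.pair 0 0
  | fst t => Nat.pair 1 t.code
  | snd t => Nat.pair 2 t.code
  | node s t => Nat.pair 3 (Nat.pair s.code t.code)

theorem Tm.code_inj : ∀ {s t : Tm}, s.code = t.code → s = t := by
  intro s
  induction s with
  | env => intro t h; cases t <;> simp [Tm.code] at h ⊢
  | fst s ih => intro t h; cases t <;> simp [Tm.code] at h ⊢; exact ih h
  | snd s ih => intro t h; cases t <;> simp [Tm.code] at h ⊢; exact ih h
  | node s s' ih ih' =>
    intro t h; cases t <;> simp [Tm.code] at h ⊢; exact ⟨ih h.1, ih' h.2⟩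

/-- a numbering of formulas -/
def Fm.code : Fm → ℕ
  | mem s t => Nat.pair 0 (Nat.pair s.code t.code)
  | lt s t => Nat.pair 1 (Nat.pair s.code t.code)
  | eq s t => Nat.pair 2 (Nat.pair s.code t.code)
  | fal => Nat.pair 3 0
  | imp f g => Nat.pair 4 (Nat.pair f.code g.code)
  | all f => Nat.pair 5 f.code

theorem Fm.code_inj : ∀ {s t : Fm}, s.code = t.code → s = t := by
  intro s
  induction s with
  | mem s s' =>
    intro t h; cases t <;> simp [Fm.code] at h ⊢; exact ⟨Tm.code_inj h.1, Tm.code_inj h.2⟩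
  | lt s s' =>
    intro t h; cases t <;> simp [Fm.code] at h ⊢; exact ⟨Tm.code_inj h.1, Tm.code_inj h.2⟩
  | eq s s' =>
    intro t h; cases t <;> simp [Fm.code] at h ⊢; exact ⟨Tm.code_inj h.1, Tm.code_inj h.2⟩
  | fal => intro t h; cases t <;> simp [Fm.code] at h ⊢
  | imp s s' ih ih' =>
    intro t h; cases t <;> simp [Fm.code] at h ⊢; exact ⟨ih h.1, ih' h.2⟩
  | all s ih => intro t h; cases t <;> simp [Fm.code] at h ⊢; exact ih h

/-- enumeration of formulas -/
noncomputable def enumF : ℕ → Fm :=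
  have : Nonempty Fm := ⟨Fm.fal⟩
  Function.invFun Fm.code

theorem enumF_code (f : Fm) : enumF f.code = f := by
  have : Nonempty Fm := ⟨Fm.fal⟩
  exact Function.leftInverse_invFun (fun _ _ h => Fm.code_inj h) f

section
variable {W : Type}
open Tree

/-- evaluation of terms -/
def Tm.eval (e : Tree W) : Tm → Tree W
  | env => e
  | fst t => (t.eval e).fst
  | snd t => (t.eval e).snd
  | node s t => .node (s.eval e) (t.eval e)

/-- substitution in terms -/
def Tm.subst : Tm → Tm → Tm
  | env, u => u
  | fst t, u => .fst (t.subst u)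
  | snd t, u => .snd (t.subst u)
  | node s t, u => .node (s.subst u) (t.subst u)

theorem Tm.eval_subst (e : Tree W) (u t : Tm) : (t.subst u).eval e = t.eval (u.eval e) := by
  induction t with
  | env => rfl
  | fst t ih => simp [Tm.subst, Tm.eval, ih]
  | snd t ih => simp [Tm.subst, Tm.eval, ih]
  | node s t ih ih' => simp [Tm.subst, Tm.eval, ih, ih']

theorem Tm.eval_map (f : W → W) (e : Tree W) (t : Tm) : t.eval (e.map f) = (t.eval e).map f := by
  induction t with
  | env => rfl
  | fst t ih => simp [Tm.eval, ih, fst_map]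
  | snd t ih => simp [Tm.eval, ih, snd_map]
  | node s t ih ih' => simp [Tm.eval, ih, ih', Tree.map]

/-- substitution in formulas -/
def Fm.subst : Tm → Fm → Fm
  | u, .mem s t => .mem (s.subst u) (t.subst u)
  | u, .lt s t => .lt (s.subst u) (t.subst u)
  | u, .eq s t => .eq (s.subst u) (t.subst u)
  | _, .fal => .fal
  | u, .imp f g => .imp (f.subst u) (g.subst u)
  | u, .all f => .all (f.subst (.node (.fst .env) (u.subst (.snd .env))))

/-- tree with `n` inner nodes, all leaves `a` -/
def comb (a : W) : ℕ → Tree W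
  | 0 => leaf a
  | n + 1 => node (leaf a) (comb a n)

theorem size_comb (a : W) (n : ℕ) : (comb a n).size = n := by
  induction n with
  | zero => rfl
  | succ n ih => simp [comb, size, ih]

variable [LinearOrder W]

theorem rank_comb (a : W) (n : ℕ) : (comb a n).rank = a := by
  induction n with
  | zero => rfl
  | succ n ih => simp [comb, rank, ih]

theorem Tm.rank_eval (e : Tree W) (t : Tm) : (t.eval e).rank ≤ e.rank := by
  induction t with
  | env => exact le_rfl
  | fst t ih => exact (rank_fst _).trans ih
  | snd t ih => exact (rank_snd _).trans ih
  | node s t ih ih' => simp [Tm.eval, rank, ih, ih']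

/-- satisfaction relative to a membership relation -/
def SatR (E : Tree W → Tree W → Prop) (γ : W) : Fm → Tree W → Prop
  | .mem s t, e => E (s.eval e) (t.eval e)
  | .lt s t, e => s.eval e < t.eval e
  | .eq s t, e => s.eval e = t.eval e
  | .fal, _ => False
  | .imp f g, e => SatR E γ f e → SatR E γ g e
  | .all f, e => ∀ y : Tree W, y.rank < γ → SatR E γ f (node y e)

theorem SatR_subst (E : Tree W → Tree W → Prop) (γ : W) (f : Fm) :
    ∀ (u : Tm) (e : Tree W), SatR E γ (f.subst u) e ↔ SatR E γ f (u.eval e) := by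
  induction f with
  | mem s t => intro u e; simp [Fm.subst, SatR, Tm.eval_subst]
  | lt s t => intro u e; simp [Fm.subst, SatR, Tm.eval_subst]
  | eq s t => intro u e; simp [Fm.subst, SatR, Tm.eval_subst]
  | fal => intro u e; simp [Fm.subst, SatR]
  | imp f g ih ih' => intro u e; simp [Fm.subst, SatR, ih, ih']
  | all f ih => intro u e; simp [Fm.subst, SatR, ih, Tm.eval, Tm.eval_subst, Tree.fst, Tree.snd]

/-- level of a code -/
def lev (d : Tree W) : W := d.fst.rank

/-- parameter of a code -/
def par (d : Tree W) : Tree W := d.snd.snd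

/-- formula of a code -/
noncomputable def fm (d : Tree W) : Fm := enumF d.snd.fst.size

variable [WellFoundedLT W]

/-- satisfaction at level `γ` -/
noncomputable def Sat : W → Fm → Tree W → Prop :=
  (wellFounded_lt (α := W)).fix (fun γ ih => SatR (fun x d => ∃ h : lev d < γ,
    x.rank < lev d ∧ (par d).rank < lev d ∧ ih (lev d) h (fm d) (node x (par d))) γ)

/-- membership in (the set coded by) a tree -/
def Mem (x d : Tree W) : Prop :=
  x.rank < lev d ∧ (par d).rank < lev d ∧ Sat (lev d) (fm d) (node x (par d))

theorem Sat_eq (γ : W) : Sat γ = SatR (fun x d : Tree W => lev d < γ ∧ Mem x d) γ := by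
  unfold Sat
  rw [WellFounded.fix_eq]
  congr 1
  funext x d
  simp only [Mem, Sat]
  exact propext ⟨fun ⟨h, h'⟩ => ⟨h, h'⟩, fun ⟨h, h'⟩ => ⟨h, h'⟩⟩

theorem lev_le (d : Tree W) : lev d ≤ d.rank := rank_fst d

theorem Mem.rank_lt {x d : Tree W} (h : Mem x d) : x.rank < d.rank := h.1.trans_le (lev_le d)

variable {γ : W} {e : Tree W}

theorem Sat_mem {s t : Tm} (he : e.rank < γ) : Sat γ (.mem s t) e ↔ Mem (s.eval e) (t.eval e) := by
  rw [Sat_eq]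
  simp only [SatR, and_iff_right_iff_imp]
  intro _
  exact ((lev_le _).trans (Tm.rank_eval e t)).trans_lt he

theorem Sat_lt {s t : Tm} : Sat γ (.lt s t) e ↔ s.eval e < t.eval e := by
  rw [Sat_eq]; rfl

theorem Sat_eq' {s t : Tm} : Sat γ (.eq s t) e ↔ s.eval e = t.eval e := by
  rw [Sat_eq]; rfl

theorem Sat_fal : Sat γ .fal e ↔ False := by
  rw [Sat_eq]; rfl

theorem Sat_imp {f g : Fm} : Sat γ (.imp f g) e ↔ (Sat γ f e → Sat γ g e) := by
  rw [Sat_eq]; rfl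

theorem Sat_all {f : Fm} : Sat γ (.all f) e ↔ ∀ y : Tree W, y.rank < γ → Sat γ f (node y e) := by
  rw [Sat_eq]; rfl

theorem Sat_subst {f : Fm} {u : Tm} : Sat γ (f.subst u) e ↔ Sat γ f (u.eval e) := by
  rw [Sat_eq]; exact SatR_subst _ _ _ _ _

/-- the code with given data -/
def mkCode (α : W) (f : Fm) (p : Tree W) : Tree W := node (leaf α) (node (comb p.rank f.code) p)

theorem Mem_mkCode {α : W} {f : Fm} {p : Tree W} (hp : p.rank < α) {x : Tree W} :
    Mem x (mkCode α f p) ↔ x.rank < α ∧ Sat α f (node x p) := by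
  simp only [Mem, mkCode, lev, par, fm, Tree.fst, Tree.snd, rank, size_comb, enumF_code]
  simp [hp]

theorem rank_mkCode {α : W} {f : Fm} {p : Tree W} (hp : p.rank < α) :
    (mkCode α f p).rank = α := by
  simp [mkCode, rank, rank_comb, hp.le]

/-! ## Condensation -/

/-- Tarski–Vaught condition -/
def TV (f : W → W) (δ β : W) : Prop :=
  ∀ (φ : Fm) (p : Tree W), p.rank < δ →
    (∃ y : Tree W, y.rank < β ∧ Sat β φ (node y (p.map f))) →
    ∃ y : Tree W, y.rank < δ ∧ Sat β φ (node (y.map f) (p.map f))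

theorem mem_map_of {f : W → W} {δ : W} (hf : StrictMonoOn f (Set.Iio δ))
    (x d : Tree W) (hx : x.rank < δ) (hd : d.rank < δ)
    (ih : ∀ φ e, Tree.rank e < lev d → (Sat (lev d) φ e ↔ Sat (f (lev d)) φ (e.map f))) :
    Mem x d ↔ Mem (x.map f) (d.map f) := by
  have h1 : lev (d.map f) = f (lev d) := by
    unfold lev
    rw [fst_map, rank_map hf]
    exact (rank_fst d).trans_lt hd
  have h2 : par (d.map f) = (par d).map f := by
    simp [par, snd_map]
  have h3 : fm (d.map f) = fm d := by
    simp [fm, snd_map, fst_map, size_map]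
  have hp : (par d).rank < δ := ((rank_snd _).trans (rank_snd _)).trans_lt hd
  have hl : lev d < δ := (lev_le d).trans_lt hd
  unfold Mem
  rw [h1, h2, h3, rank_map hf hx, rank_map hf hp, hf.lt_iff_lt hx hl, hf.lt_iff_lt hp hl]
  refine and_congr_right fun a1 => and_congr_right fun a2 => ?_
  rw [ih _ _ (rank_node_lt.2 ⟨a1, a2⟩)]
  rfl

theorem condense_step {f : W → W} {δ : W} (hf : StrictMonoOn f (Set.Iio δ)) {γ γ' : W}
    (hγ : γ ≤ δ) (hγ' : ∀ α < γ, f α < γ')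
    (ih : ∀ α < γ, ∀ φ e, Tree.rank e < α → (Sat α φ e ↔ Sat (f α) φ (e.map f)))
    (tv : ∀ (φ : Fm) (p : Tree W), p.rank < γ →
      (∃ y : Tree W, y.rank < γ' ∧ Sat γ' φ (node y (p.map f))) →
      ∃ y : Tree W, y.rank < γ ∧ Sat γ' φ (node (y.map f) (p.map f))) (φ : Fm) :
    ∀ e : Tree W, e.rank < γ → (Sat γ φ e ↔ Sat γ' φ (e.map f)) := by
  have hr : ∀ e : Tree W, e.rank < γ → (e.map f).rank < γ' := fun e he => by
    rw [rank_map hf (he.trans_le hγ)]; exact hγ' _ he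
  induction φ with
  | mem s t =>
    intro e he
    rw [Sat_mem he, Sat_mem (hr e he), Tm.eval_map, Tm.eval_map]
    have hs := (Tm.rank_eval e s).trans_lt he
    have ht := (Tm.rank_eval e t).trans_lt he
    exact mem_map_of hf _ _ (hs.trans_le hγ) (ht.trans_le hγ) (ih _ ((lev_le _).trans_lt ht))
  | lt s t =>
    intro e he
    have hs := (Tm.rank_eval e s).trans_lt he
    have ht := (Tm.rank_eval e t).trans_lt he
    rw [Sat_lt, Sat_lt, Tm.eval_map, Tm.eval_map, map_lt_iff hf (hs.trans_le hγ) (ht.trans_le hγ)]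
  | eq s t =>
    intro e he
    have hs := (Tm.rank_eval e s).trans_lt he
    have ht := (Tm.rank_eval e t).trans_lt he
    rw [Sat_eq', Sat_eq', Tm.eval_map, Tm.eval_map, map_inj hf (hs.trans_le hγ) (ht.trans_le hγ)]
  | fal => intro e he; rw [Sat_fal, Sat_fal]
  | imp φ ψ h1 h2 => intro e he; rw [Sat_imp, Sat_imp, h1 e he, h2 e he]
  | all φ h =>
    intro e he
    rw [Sat_all, Sat_all]
    constructor
    · intro h'
      by_contra hcon
      push Not at hcon
      obtain ⟨y, hy, hy'⟩ := hcon
      obtain ⟨z, hz, hz'⟩ := tv (.imp φ .fal) e he ⟨y, hy, by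
        rw [Sat_imp, Sat_fal]; exact hy'⟩
      rw [Sat_imp, Sat_fal] at hz'
      exact hz' ((h (node z e) (rank_node_lt.2 ⟨hz, he⟩)).1 (h' z hz))
    · intro h' y hy
      exact (h (node y e) (rank_node_lt.2 ⟨hy, he⟩)).2 (h' _ (hr y hy))

theorem condense_lower {f : W → W} {δ β : W} (hf : StrictMonoOn f (Set.Iio δ))
    (hβ : ∀ α < δ, f α < β) (tv : TV f δ β) :
    ∀ α, α < δ → ∀ φ e, Tree.rank e < α → (Sat α φ e ↔ Sat (f α) φ (e.map f)) := by
  intro α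
  induction α using (wellFounded_lt (α := W)).induction with
  | _ α ih =>
    intro hα φ e he
    refine condense_step hf hα.le (fun a ha => hf (ha.trans hα) hα ha)
      (fun a ha => ih a ha (ha.trans hα)) ?_ φ e he
    intro φ p hp ⟨y, hy, hy'⟩
    have hq : (mkCode α φ p).rank < δ := by rw [rank_mkCode hp]; exact hα
    have hq' : (mkCode α φ p).map f = mkCode (f α) φ (p.map f) := by
      have : ∀ n (a : W), (comb a n).map f = comb (f a) n := by
        intro n a
        induction n with
        | zero => rfl
        | succ n ih => simp [comb, Tree.map, ih]
      simp [mkCode, Tree.map, this, rank_map hf (hp.trans hα)]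
    have hp' : (p.map f).rank < f α := by
      rw [rank_map hf (hp.trans hα)]; exact hf (hp.trans hα) hα hp
    have hM : Mem y ((mkCode α φ p).map f) := by
      rw [hq', Mem_mkCode hp']
      exact ⟨hy, hy'⟩
    have hqβ : ((mkCode α φ p).map f).rank < β := by
      rw [rank_map hf hq]; exact hβ _ hq
    obtain ⟨z, hz, hz'⟩ := tv (.mem (.fst .env) (.snd .env)) _ hq ⟨y, hM.rank_lt.trans hqβ, by
      rw [Sat_mem (rank_node_lt.2 ⟨hM.rank_lt.trans hqβ, hqβ⟩)]; exact hM⟩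
    have hzβ : (z.map f).rank < β := by rw [rank_map hf hz]; exact hβ _ hz
    rw [Sat_mem (rank_node_lt.2 ⟨hzβ, hqβ⟩)] at hz'
    simp only [Tm.eval, Tree.fst, Tree.snd] at hz'
    rw [hq', Mem_mkCode hp'] at hz'
    refine ⟨z, ?_, hz'.2⟩
    have := hz'.1
    rw [rank_map hf hz] at this
    exact (hf.lt_iff_lt hz hα).1 this

theorem condense_mem {f : W → W} {δ β : W} (hf : StrictMonoOn f (Set.Iio δ))
    (hβ : ∀ α < δ, f α < β) (tv : TV f δ β) {x d : Tree W} (hx : x.rank < δ) (hd : d.rank < δ) :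
    Mem x d ↔ Mem (x.map f) (d.map f) :=
  mem_map_of hf x d hx hd (condense_lower hf hβ tv _ ((lev_le d).trans_lt hd))

theorem condense_top {f : W → W} {δ β : W} (hf : StrictMonoOn f (Set.Iio δ))
    (hβ : ∀ α < δ, f α < β) (tv : TV f δ β) (φ : Fm) (e : Tree W) (he : e.rank < δ) :
    Sat δ φ e ↔ Sat β φ (e.map f) :=
  condense_step hf le_rfl hβ (condense_lower hf hβ tv) tv φ e he

end
end Base
end NFUweak

namespace NFUweak
namespace Base
section
variable {W : Type} [LinearOrder W] [WellFoundedLT W]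
open Tree

/-! ## Definability -/

/-- term functions -/
class IsTm (g : Tree W → Tree W) : Prop where
  out : ∃ t : Tm, ∀ e, g e = t.eval e

/-- definability over level `γ` -/
class Dfn (γ : W) (P : Tree W → Prop) : Prop where
  out : ∃ f : Fm, ∀ e : Tree W, e.rank < γ → (Sat γ f e ↔ P e)

instance : IsTm (fun e : Tree W => e) := ⟨.env, fun _ => rfl⟩
instance IsTm.fst {g : Tree W → Tree W} [h : IsTm g] : IsTm (fun e => (g e).fst) := by
  obtain ⟨t, ht⟩ := h.out
  exact ⟨.fst t, fun e => by simp [Tm.eval, ht]⟩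
instance IsTm.snd {g : Tree W → Tree W} [h : IsTm g] : IsTm (fun e => (g e).snd) := by
  obtain ⟨t, ht⟩ := h.out
  exact ⟨.snd t, fun e => by simp [Tm.eval, ht]⟩
instance IsTm.fst0 : IsTm (Tree.fst : Tree W → Tree W) := ⟨.fst .env, fun _ => rfl⟩
instance IsTm.snd0 : IsTm (Tree.snd : Tree W → Tree W) := ⟨.snd .env, fun _ => rfl⟩
instance IsTm.node {g g' : Tree W → Tree W} [h : IsTm g] [h' : IsTm g'] :
    IsTm (fun e => .node (g e) (g' e)) := by
  obtain ⟨t, ht⟩ := h.out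
  obtain ⟨t', ht'⟩ := h'.out
  exact ⟨.node t t', fun e => by simp [Tm.eval, ht, ht']⟩

theorem IsTm.rank_le {g : Tree W → Tree W} (h : IsTm g) (e : Tree W) : (g e).rank ≤ e.rank := by
  obtain ⟨t, ht⟩ := h.out
  rw [ht]; exact Tm.rank_eval e t

/-- bounded universal quantifier -/
def AllT (γ : W) (P : Tree W → Prop) : Prop := ∀ y : Tree W, y.rank < γ → P y

/-- bounded existential quantifier -/
def ExT (γ : W) (P : Tree W → Prop) : Prop := ∃ y : Tree W, y.rank < γ ∧ P y

/-- `y` is least with `P` -/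
def LeastT (γ : W) (P : Tree W → Prop) (y : Tree W) : Prop :=
  P y ∧ AllT γ (fun z => z < y → ¬ P z)

variable {γ : W}

theorem Dfn.congr {P Q : Tree W → Prop} (h : Dfn γ P) (hPQ : ∀ e, e.rank < γ → (P e ↔ Q e)) :
    Dfn γ Q := by
  obtain ⟨f, hf⟩ := h.out
  exact ⟨f, fun e he => (hf e he).trans (hPQ e he)⟩

instance Dfn.sat (f : Fm) : Dfn γ (fun e => Sat γ f e) := ⟨f, fun _ _ => Iff.rfl⟩

theorem Dfn.comp {P : Tree W → Prop} (h : Dfn γ P) (g : Tree W → Tree W) [hg : IsTm g] :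
    Dfn γ (fun e => P (g e)) := by
  obtain ⟨f, hf⟩ := h.out
  obtain ⟨t, ht⟩ := hg.out
  refine ⟨f.subst t, fun e he => ?_⟩
  rw [Sat_subst, ht]
  exact hf _ ((Tm.rank_eval e t).trans_lt he)

instance Dfn.satc (f : Fm) (g : Tree W → Tree W) [hg : IsTm g] : Dfn γ (fun e => Sat γ f (g e)) :=
  (Dfn.sat f).comp g

instance Dfn.mem {g g' : Tree W → Tree W} [h : IsTm g] [h' : IsTm g'] :
    Dfn γ (fun e => Mem (g e) (g' e)) := by
  obtain ⟨t, ht⟩ := h.out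
  obtain ⟨t', ht'⟩ := h'.out
  exact ⟨.mem t t', fun e he => by rw [Sat_mem he, ht, ht']⟩

instance Dfn.lt {g g' : Tree W → Tree W} [h : IsTm g] [h' : IsTm g'] :
    Dfn γ (fun e => g e < g' e) := by
  obtain ⟨t, ht⟩ := h.out
  obtain ⟨t', ht'⟩ := h'.out
  exact ⟨.lt t t', fun e he => by rw [Sat_lt, ht, ht']⟩

instance Dfn.eq {g g' : Tree W → Tree W} [h : IsTm g] [h' : IsTm g'] :
    Dfn γ (fun e => g e = g' e) := by
  obtain ⟨t, ht⟩ := h.out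
  obtain ⟨t', ht'⟩ := h'.out
  exact ⟨.eq t t', fun e he => by rw [Sat_eq', ht, ht']⟩

instance Dfn.fal : Dfn γ (fun _ => False) := ⟨.fal, fun _ _ => Sat_fal⟩

instance (priority := low) Dfn.imp {P Q : Tree W → Prop} [h : Dfn γ P] [h' : Dfn γ Q] :
    Dfn γ (fun e => P e → Q e) := by
  obtain ⟨t, ht⟩ := h.out
  obtain ⟨t', ht'⟩ := h'.out
  exact ⟨.imp t t', fun e he => by rw [Sat_imp, ht e he, ht' e he]⟩

instance Dfn.all {P : Tree W → Tree W → Prop} [h : Dfn γ (fun e => P e.snd e.fst)] :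
    Dfn γ (fun e => AllT γ (P e)) := by
  obtain ⟨t, ht⟩ := h.out
  exact ⟨.all t, fun e he => by
    rw [Sat_all]
    exact forall₂_congr fun y hy => ht _ (rank_node_lt.2 ⟨hy, he⟩)⟩

instance Dfn.not {P : Tree W → Prop} [h : Dfn γ P] : Dfn γ (fun e => ¬ P e) :=
  Dfn.imp (h := h) (h' := Dfn.fal)

instance Dfn.tru : Dfn γ (fun _ : Tree W => True) :=
  (Dfn.not (h := Dfn.fal)).congr (by simp)

instance Dfn.and {P Q : Tree W → Prop} [h : Dfn γ P] [h' : Dfn γ Q] :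
    Dfn γ (fun e => P e ∧ Q e) :=
  (inferInstance : Dfn γ (fun e => ¬ (P e → ¬ Q e))).congr (by intros; tauto)

instance Dfn.or {P Q : Tree W → Prop} [h : Dfn γ P] [h' : Dfn γ Q] :
    Dfn γ (fun e => P e ∨ Q e) :=
  (inferInstance : Dfn γ (fun e => ¬ P e → Q e)).congr (by intros; tauto)

instance Dfn.iff {P Q : Tree W → Prop} [h : Dfn γ P] [h' : Dfn γ Q] :
    Dfn γ (fun e => P e ↔ Q e) :=
  (inferInstance : Dfn γ (fun e => (P e → Q e) ∧ (Q e → P e))).congr (by intros; tauto)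

instance Dfn.le {g g' : Tree W → Tree W} [h : IsTm g] [h' : IsTm g'] :
    Dfn γ (fun e => g e ≤ g' e) :=
  (inferInstance : Dfn γ (fun e => ¬ (g' e < g e))).congr (by intros; simp)

instance Dfn.ex {P : Tree W → Tree W → Prop} [h : Dfn γ (fun e => P e.snd e.fst)] :
    Dfn γ (fun e => ExT γ (P e)) :=
  (inferInstance : Dfn γ (fun e => ¬ AllT γ (fun y => ¬ P e y))).congr (by
    intros; simp [AllT, ExT])

instance Dfn.least {P : Tree W → Tree W → Prop} {g : Tree W → Tree W} [hg : IsTm g]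
    [h : Dfn γ (fun e => P e.snd e.fst)] : Dfn γ (fun e => LeastT γ (P e) (g e)) := by
  have h1 : Dfn γ (fun e => P e (g e)) := h.comp (fun e => .node (g e) e)
  obtain ⟨t, ht⟩ := hg.out
  have : IsTm (fun e : Tree W => g e.snd) := ⟨t.subst (.snd .env), fun e => by
    rw [ht, Tm.eval_subst]; rfl⟩
  exact (inferInstance :
    Dfn γ (fun e => P e (g e) ∧ AllT γ (fun z => z < g e → ¬ P e z)))

theorem exists_least (P : Tree W → Prop) (h : ExT γ P) :
    ∃ y : Tree W, y.rank < γ ∧ LeastT γ P y := by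
  obtain ⟨y, hy⟩ := (wellFounded_lt (α := Tree W)).has_min {y | y.rank < γ ∧ P y} h
  exact ⟨y, hy.1.1, hy.1.2, fun z hz hzy hP => hy.2 z ⟨hz, hP⟩ hzy⟩

theorem LeastT.unique {P : Tree W → Prop} {y y' : Tree W} (h : LeastT γ P y) (h' : LeastT γ P y')
    (hy : y.rank < γ) (hy' : y'.rank < γ) : y = y' := by
  rcases lt_trichotomy y y' with h1 | h1 | h1
  · exact absurd h.1 (h'.2 y hy h1)
  · exact h1
  · exact absurd h'.1 (h.2 y' hy' h1)

/-- coding of definable sets -/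
theorem exists_code (P : Tree W → Prop) [h : Dfn γ P] (p : Tree W) (hp : p.rank < γ) :
    ∃ d : Tree W, d.rank = γ ∧ ∀ x, Mem x d ↔ x.rank < γ ∧ P (node x p) := by
  obtain ⟨f, hf⟩ := h.out
  refine ⟨mkCode γ f p, rank_mkCode hp, fun x => ?_⟩
  rw [Mem_mkCode hp]
  exact and_congr_right fun hx => hf _ (rank_node_lt.2 ⟨hx, hp⟩)

/-! ## Cardinals of the hierarchy -/

/-- the code `c` is a partial function -/
def Fnl (c : Tree W) : Prop := ∀ x y y' : Tree W, Mem (node x y) c → Mem (node x y') c → y = y'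

/-- `c` maps `Tr κ` onto the trees of rank `≤ β` -/
def Onto (c : Tree W) (κ β : W) : Prop :=
  Fnl c ∧ ∀ t : Tree W, t.rank ≤ β → ∃ x : Tree W, x.rank < κ ∧ Mem (node x t) c

/-- `κ'` is the cardinal successor of `κ` -/
def IsNext (κ κ' : W) : Prop := (∀ c, ¬ Onto c κ κ') ∧ ∀ β < κ', ∃ c, Onto c κ β

theorem IsNext.le [NoMaxOrder W] {κ κ' : W} (h : IsNext κ κ') : κ ≤ κ' := by
  by_contra hlt
  push Not at hlt
  obtain ⟨d, -, hd⟩ := exists_code (γ := κ) (fun e => e.fst.fst = e.fst.snd ∧ e.fst ≠ e.fst.fst)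
    (leaf κ') hlt
  simp only [Tree.fst, Tree.snd] at hd
  refine h.1 d ⟨?_, ?_⟩
  · intro x y y' h1 h2
    have h1 := ((hd _).1 h1).2.1
    have h2 := ((hd _).1 h2).2.1
    exact h1.symm.trans h2
  · intro t ht
    refine ⟨t, ht.trans_lt hlt, (hd _).2 ⟨rank_node_lt.2 ⟨ht.trans_lt hlt, ht.trans_lt hlt⟩, rfl, ?_⟩⟩
    intro h
    have := congrArg size h
    simp [Tree.fst, size] at this
    omega

theorem map_map_id {f g : W → W} : ∀ {t : Tree W} {P : Tree W → Prop},
    (∀ l r, P (node l r) → P l ∧ P r) → (∀ a, P (leaf a) → f (g a) = a) → P t →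
      (t.map g).map f = t
  | leaf a, P, h, h', hP => by simp [Tree.map, h' a hP]
  | node l r, P, h, h', hP => by
    simp [Tree.map, map_map_id h h' (h l r hP).1, map_map_id h h' (h l r hP).2]

theorem map_id_of {f : W → W} {κ : W} (h : ∀ a < κ, f a = a) : ∀ {t : Tree W}, t.rank < κ →
    t.map f = t
  | leaf a, ht => by simp [Tree.map, h a ht]
  | node l r, ht => by
    obtain ⟨h1, h2⟩ := rank_node_lt.1 ht
    simp [Tree.map, map_id_of h h1, map_id_of h h2]

/-- the Skolem hull -/
def Hull (β κ : W) (a : Tree W) (y : Tree W) : Prop :=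
  y.rank < β ∧ ∃ (φ : Fm) (q : Tree W), q.rank < κ ∧ LeastT β (fun z => Sat β φ (node z (node q a))) y

theorem Hull.closed {β κ : W} {a : Tree W} (ha : a.rank < β) (hκ : κ ≤ β) {z1 z2 y : Tree W}
    (h1 : Hull β κ a z1) (h2 : Hull β κ a z2) (hy : y.rank < β) (P : Tree W → Prop) [hP : Dfn β P]
    (hyP : LeastT β (fun z => P (node z (node z1 z2))) y) : Hull β κ a y := by
  obtain ⟨hz1, φ1, q1, hq1, hl1⟩ := h1
  obtain ⟨hz2, φ2, q2, hq2, hl2⟩ := h2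
  have := hP.comp (fun e => .node e.snd.snd.fst (.node e.snd.fst e.fst))
  have hD : Dfn β (fun e => ExT β (fun w1 => ExT β (fun w2 =>
      LeastT β (fun z => Sat β φ1 (.node z (.node e.snd.fst.fst e.snd.snd))) w1 ∧
      LeastT β (fun z => Sat β φ2 (.node z (.node e.snd.fst.snd e.snd.snd))) w2 ∧
      P (.node e.fst (.node w1 w2))))) := inferInstance
  obtain ⟨ψ, hψ⟩ := hD.out
  refine ⟨hy, ψ, node q1 q2, rank_node_lt.2 ⟨hq1, hq2⟩, ?_⟩
  have key : ∀ z : Tree W, z.rank < β →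
      (Sat β ψ (node z (node (node q1 q2) a)) ↔ P (node z (node z1 z2))) := by
    intro z hz
    rw [hψ]
    · simp only [Tree.fst, Tree.snd]
      constructor
      · rintro ⟨w1, hw1, w2, hw2, a1, a2, a3⟩
        rwa [a1.unique hl1 hw1 hz1, a2.unique hl2 hw2 hz2] at a3
      · intro h
        exact ⟨z1, hz1, z2, hz2, hl1, hl2, h⟩
    · simp [rank, hz, ha, hq1.trans_le hκ, hq2.trans_le hκ]
  refine ⟨(key y hy).2 hyP.1, fun z hz hzy hs => hyP.2 z hz hzy ((key z hz).1 hs)⟩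

theorem Hull.term {β κ : W} {a : Tree W} (ha : a.rank < β) (hκ : κ ≤ β) {z1 z2 : Tree W}
    (h1 : Hull β κ a z1) (h2 : Hull β κ a z2) (g : Tree W → Tree W) [hg : IsTm g] :
    Hull β κ a (g (node z1 z2)) := by
  have hr : (g (node z1 z2)).rank < β :=
    (hg.rank_le _).trans_lt (rank_node_lt.2 ⟨h1.1, h2.1⟩)
  obtain ⟨t, ht⟩ := hg.out
  have : IsTm (fun e : Tree W => g e.snd) := ⟨t.subst (.snd .env), fun e => by
    rw [ht, Tm.eval_subst]; rfl⟩
  refine Hull.closed ha hκ h1 h2 hr (fun e => e.fst = g e.snd) ⟨rfl, ?_⟩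
  intro z hz hlt h
  simp only [Tree.fst, Tree.snd] at h
  exact absurd h hlt.ne

theorem exists_code_next [NoMaxOrder W] {κ κ' : W} (hκ : IsNext κ κ') (a0 : W) (ha0 : a0 < κ)
    (c : Tree W) (hc : ∀ x, Mem x c → x.rank < κ) :
    ∃ c' : Tree W, c'.rank < κ' ∧ ∀ x, Mem x c' ↔ Mem x c := by
  obtain ⟨β, hβ⟩ := exists_gt (max c.rank κ)
  obtain ⟨hβc, hβκ⟩ := max_lt_iff.1 hβ
  set a : Tree W := c with ha
  have har : a.rank < β := hβc
  let H := Hull β κ a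
  have Hq : ∀ q : Tree W, q.rank < κ → H q := by
    intro q hq
    have hD : Dfn β (fun e => e.fst = e.snd.fst) := inferInstance
    obtain ⟨φ, hφ⟩ := hD.out
    refine ⟨hq.trans hβκ, φ, q, hq, ?_, ?_⟩
    · show Sat β φ _; rw [hφ _ (by simp [rank, har, hq.trans hβκ])]; rfl
    · intro z hz hlt
      show ¬ Sat β φ _; rw [hφ _ (by simp [rank, har, hq.trans hβκ, hz])]; exact hlt.ne
  have Hc : H c := by
    have hD : Dfn β (fun e => e.fst = e.snd.snd) := inferInstance
    obtain ⟨φ, hφ⟩ := hD.out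
    refine ⟨har, φ, leaf a0, ha0, ?_, ?_⟩
    · show Sat β φ _; rw [hφ _ (by simp [rank, show c.rank < β from har, har, ha0.trans hβκ])]; rfl
    · intro z hz hlt
      show ¬ Sat β φ _; rw [hφ _ (by simp [rank, har, ha0.trans hβκ, hz])]; exact hlt.ne
  have Hn : ∀ l r, H (node l r) → H l ∧ H r := by
    intro l r h
    exact ⟨Hull.term har hβκ.le h h (fun e => e.fst.fst), Hull.term har hβκ.le h h (fun e => e.fst.snd)⟩
  have Hn' : ∀ l r, H l → H r → H (node l r) := fun l r h h' =>
    Hull.term har hβκ.le h h' (fun e => e)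
  let O : Set W := {α | H (leaf α)}
  have Oβ : ∀ α ∈ O, α < β := fun α h => h.1
  have Oκ : ∀ α < κ, α ∈ O := fun α h => Hq (leaf α) h
  obtain ⟨g, g1, g2, g3⟩ := exists_collapse O
  obtain ⟨δ, hδ, hδmin⟩ := (wellFounded_lt (α := W)).has_min {δ | δ ∉ g '' O}
    ⟨β, by rintro ⟨b, hb, rfl⟩; exact absurd (Oβ b hb) (not_lt.2 (g2 b hb))⟩
  have gδ : ∀ α ∈ O, g α < δ := by
    intro α hα
    rcases lt_trichotomy (g α) δ with h | h | h
    · exact h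
    · exact absurd ⟨α, hα, h⟩ hδ
    · obtain ⟨b, hb, -, hb'⟩ := g3 α hα _ h
      exact absurd ⟨b, hb, hb'⟩ hδ
  have hex : ∀ α : W, ∃ b, α < δ → b ∈ O ∧ g b = α := by
    intro α
    by_cases h : α < δ
    · have : α ∈ g '' O := by
        by_contra h'
        exact hδmin α h' h
      obtain ⟨b, hb, hb'⟩ := this
      exact ⟨b, fun _ => ⟨hb, hb'⟩⟩
    · exact ⟨α, fun h' => absurd h' h⟩
  choose f hf using hex
  have hfO : ∀ α < δ, f α ∈ O := fun α h => (hf α h).1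
  have hgf : ∀ α < δ, g (f α) = α := fun α h => (hf α h).2
  have ginj : ∀ α ∈ O, ∀ b ∈ O, g α = g b → α = b := by
    intro α hα b hb h
    rcases lt_trichotomy α b with h' | h' | h'
    · exact absurd h (g1 α hα b hb h').ne
    · exact h'
    · exact absurd h (g1 b hb α hα h').ne'
  have hfg : ∀ α ∈ O, f (g α) = α := fun α h =>
    ginj _ (hfO _ (gδ α h)) _ h (hgf _ (gδ α h))
  have hfm : StrictMonoOn f (Set.Iio δ) := by
    intro α hα b hb h
    rcases lt_trichotomy (f α) (f b) with h' | h' | h'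
    · exact h'
    · have := congrArg g h'
      rw [hgf α hα, hgf b hb] at this
      exact absurd this h.ne
    · have := g1 _ (hfO b hb) _ (hfO α hα) h'
      rw [hgf α hα, hgf b hb] at this
      exact absurd (this.trans h) (lt_irrefl _)
  have hfβ : ∀ α < δ, f α < β := fun α h => Oβ _ (hfO α h)
  have gκ : ∀ α < κ, g α = α := by
    intro α
    induction α using (wellFounded_lt (α := W)).induction with
    | _ α ih =>
      intro hα
      rcases (g2 α (Oκ α hα)).lt_or_eq with h | h
      · have h1 := g1 _ (Oκ _ (h.trans hα)) _ (Oκ _ hα) h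
        rw [ih _ h (h.trans hα)] at h1
        exact absurd h1 (lt_irrefl _)
      · exact h
  have fκ : ∀ α < κ, f α = α := by
    intro α hα
    have := hfg α (Oκ α hα)
    rwa [gκ α hα] at this
  have κδ : ∀ α < κ, α < δ := fun α h => by
    have := gδ α (Oκ α h); rwa [gκ α h] at this
  have FG : ∀ t, H t → (t.map g).map f = t := fun t ht =>
    map_map_id (P := H) Hn (fun α h => hfg α h) ht
  have Gδ : ∀ t, H t → (t.map g).rank < δ := by
    intro t
    induction t with
    | leaf α => intro h; exact gδ α h
    | node l r h1 h2 =>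
      intro h
      exact rank_node_lt.2 ⟨h1 (Hn _ _ h).1, h2 (Hn _ _ h).2⟩
  have FH : ∀ t : Tree W, t.rank < δ → H (t.map f) := by
    intro t
    induction t with
    | leaf α => intro h; exact hfO α h
    | node l r h1 h2 =>
      intro h
      exact Hn' _ _ (h1 (rank_node_lt.1 h).1) (h2 (rank_node_lt.1 h).2)
  have tv : TV f δ β := by
    intro φ p hp hy
    obtain ⟨y, hy, hl⟩ := exists_least (γ := β) (fun y => Sat β φ (node y (p.map f))) hy
    have hyH : H y := Hull.closed har hβκ.le (FH p hp) (FH p hp) hy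
      (fun e => Sat β φ (.node e.fst e.snd.fst)) hl
    exact ⟨y.map g, Gδ y hyH, by rw [FG y hyH]; exact hl.1⟩
  have Fκ : ∀ {t : Tree W}, t.rank < κ → t.map f = t := fun h => map_id_of fκ h
  have hc'δ : (c.map g).rank < δ := Gδ c Hc
  refine ⟨c.map g, ?_, ?_⟩
  · by_contra hcon
    push Not at hcon
    have hκδ : κ' < δ := hcon.trans_lt hc'δ
    obtain ⟨ε, hε⟩ := exists_gt δ
    obtain ⟨d, -, hd⟩ := exists_code (γ := ε) (fun e =>
      LeastT ε (fun z => Mem z (.node e.snd.fst (.node e.fst.fst.fst (.node e.fst.fst.snd e.snd.snd))))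
        e.fst.snd) (node (leaf δ) (c.map g)) (rank_node_lt.2 ⟨hε, hc'δ.trans hε⟩)
    simp only [Tree.fst, Tree.snd] at hd
    refine hκ.1 d ⟨?_, ?_⟩
    · intro x y y' h1 h2
      obtain ⟨r1, h1⟩ := (hd _).1 h1
      obtain ⟨r2, h2⟩ := (hd _).1 h2
      exact h1.unique h2 (rank_node_lt.1 r1).2 (rank_node_lt.1 r2).2
    · intro t ht
      have htδ := ht.trans_lt hκδ
      obtain ⟨-, φ, q, hq, hl⟩ := FH t htδ
      have hqδ := κδ _ hq
      have hxκ : (node (comb q.rank φ.code) q).rank < κ := by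
        simp [rank, rank_comb, hq]
      have hM : ∀ z : Tree W, z.rank < δ →
        (Mem z (node (leaf δ) (node (comb q.rank φ.code) (node q (c.map g)))) ↔
          Sat β φ (node (z.map f) (node q a))) := by
        intro z hz
        have : Mem z (node (leaf δ) (node (comb q.rank φ.code) (node q (c.map g)))) ↔
          Sat δ φ (node z (node q (c.map g))) := by
          simp [Mem, lev, par, fm, Tree.fst, Tree.snd, rank, size_comb, enumF_code, hz, hqδ, hc'δ]
        rw [this, condense_top hfm hfβ tv _ _ (by simp [rank, hz, hqδ, hc'δ])]
        simp only [Tree.map, FG c Hc, Fκ hq]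
        rfl
      refine ⟨_, hxκ, (hd _).2 ⟨rank_node_lt.2 ⟨(κδ _ hxκ).trans hε, htδ.trans hε⟩, ?_⟩⟩
      refine ⟨(hM t htδ).2 hl.1, ?_⟩
      intro z hz hzt hzM
      have hzδ : z.rank < δ := (rank_le_of_lt hzt).trans_lt htδ
      refine hl.2 (z.map f) ?_ (map_lt hfm hzδ htδ hzt) ((hM z hzδ).1 hzM)
      rw [rank_map hfm hzδ]; exact hfβ _ hzδ
  · intro x
    constructor
    · intro h
      have hx : x.rank < δ := h.rank_lt.trans hc'δ
      have h' := h
      rw [condense_mem hfm hfβ tv hx hc'δ, FG c Hc] at h'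
      have hk := hc _ h'
      have : x.map f = x := by
        rw [← map_inj hfm (κδ _ hk) hx]
        exact Fκ hk
      rwa [this] at h'
    · intro h
      have hk := hc _ h
      rw [condense_mem hfm hfβ tv (κδ _ hk) hc'δ, FG c Hc, Fκ hk]
      exact h

end
end Base
end NFUweak

namespace NFUweak
namespace Base
open Tree

/-- The hierarchy together with its first infinitely many cardinals. -/
structure Setup (W : Type) [LinearOrder W] [WellFoundedLT W] where
  nomax : NoMaxOrder W
  bot : W
  kap : ℕ → W
  lam : W
  kap0 : ∀ a, a < kap 0 ↔ a = bot
  next : ∀ n, IsNext (kap n) (kap (n + 1))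
  lt_lam : ∀ n, kap n < lam

open Cardinal in
theorem card_Tr {W : Type} [LinearOrder W] [WellFoundedLT W] (κ : W) (c : Cardinal.{0})
    (hc : ℵ₀ ≤ c) (h : #(Set.Iio κ) ≤ c) : #{t : Tree W | t.rank < κ} ≤ c := by
  let S : Set (WithBot W) := {x | x < (κ : WithBot W)}
  have hS : #S ≤ c := by
    have : S ⊆ insert ⊥ ((fun a : W => (a : WithBot W)) '' Set.Iio κ) := by
      intro x hx
      induction x using WithBot.recBotCoe with
      | bot => exact Or.inl rfl
      | coe a => exact Or.inr ⟨a, by simpa [S] using hx, rfl⟩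
    refine (mk_le_mk_of_subset this).trans ((mk_insert_le).trans ?_)
    exact add_le_of_le hc (mk_image_le.trans h) (one_le_aleph0.trans hc)
  have h1 : #(List S) ≤ c := (mk_list_le_max S).trans (max_le hc hS)
  refine le_trans ?_ h1
  have : ∀ t : {t : Tree W | t.rank < κ}, ∃ l : List S, l.map Subtype.val = t.1.enc := by
    intro t
    have : t.1.enc ∈ Set.range (List.map (Subtype.val : S → WithBot W)) := by
      rw [Set.range_list_map_coe]
      exact fun a ha => mem_enc_lt t.2 a ha
    exact this
  choose F hF using this
  refine mk_le_of_injective (f := F) ?_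
  intro s t h
  apply Subtype.ext
  apply enc_inj
  rw [← hF, ← hF, h]

open Cardinal Ordinal in
theorem exists_setup : ∃ (W : Type) (_ : LinearOrder W) (_ : WellFoundedLT W), Nonempty (Setup W) := by
  let o : Ordinal.{0} := (aleph (ω + 1)).ord
  let W := o.ToType
  have ho : ∀ a : Ordinal.{0}, a < ω + 1 → (aleph a).ord < o := fun a ha => by
    simp only [o, ord_lt_ord, aleph_lt_aleph]; exact ha
  have hω : (ω : Ordinal.{0}) < ω + 1 := lt_add_one _
  have hn : ∀ n : ℕ, (n : Ordinal.{0}) < ω + 1 := fun n => (nat_lt_omega0 n).trans hω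
  let p : ℕ → W := fun n => ToType.mk ⟨(aleph n).ord, ho n (hn n)⟩
  let lam : W := ToType.mk ⟨(aleph ω).ord, ho ω hω⟩
  have hplam : ∀ n, p n < lam := by
    intro n
    simp only [p, lam, OrderIso.lt_iff_lt]
    show (aleph n).ord < (aleph ω).ord
    rw [ord_lt_ord, aleph_lt_aleph]
    exact nat_lt_omega0 n
  have hcard : ∀ n, #(Set.Iio (p n)) = aleph n := by
    intro n
    have h1 := card_typein (r := ((· < ·) : W → W → Prop)) (p n)
    have h2 : typein (α := W) (· < ·) (p n) = (aleph n).ord := by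
      simp only [p]
      exact congrArg Subtype.val (ToType.mk.symm_apply_apply (⟨(aleph n).ord, ho n (hn n)⟩ : Set.Iio o))
    rw [h2, card_ord] at h1
    exact h1.symm
  have hlim : Order.IsSuccLimit o := isSuccLimit_ord (aleph0_le_aleph _)
  have nm : NoMaxOrder W := noMaxOrder (aleph0_le_aleph _)
  have hpos : (0 : Ordinal.{0}) < o := hlim.bot_lt
  have h1o : (1 : Ordinal.{0}) < o := by
    have := hlim.succ_lt hpos; simpa using this
  let bot : W := ToType.mk ⟨0, hpos⟩
  let k0 : W := ToType.mk ⟨1, h1o⟩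
  have hk0 : ∀ a, a < k0 ↔ a = bot := by
    intro a
    rw [← OrderIso.lt_iff_lt ToType.mk.symm, OrderIso.symm_apply_apply, ← Subtype.coe_lt_coe,
      Ordinal.lt_one_iff_zero, ← ToType.mk.symm.apply_eq_iff_eq, OrderIso.symm_apply_apply]
    exact ⟨fun h => Subtype.ext h, fun h => congrArg Subtype.val h⟩
  have hk0p : k0 ≤ p 0 := by
    simp only [k0, p, OrderIso.le_iff_le, Subtype.mk_le_mk]
    show (1 : Ordinal.{0}) ≤ (aleph ((0 : ℕ) : Ordinal.{0})).ord
    rw [Order.one_le_iff_pos]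
    have := (isSuccLimit_ord (aleph0_le_aleph ((0:ℕ) : Ordinal.{0}))).bot_lt
    exact this
  have hstep : ∀ n, ∀ κ : W, κ ≤ p n → ∃ κ' : W, κ' ≤ p (n + 1) ∧ IsNext κ κ' := by
    intro n κ hκ
    have hT : #{t : Tree W | t.rank < κ} ≤ aleph n :=
      card_Tr κ _ (aleph0_le_aleph _) ((mk_le_mk_of_subset (Set.Iio_subset_Iio hκ)).trans (hcard n).le)
    have hno : ∀ c, ¬ Onto c κ (p (n + 1)) := by
      rintro c ⟨hf, hs⟩
      have : ∀ a : Set.Iio (p (n + 1)), ∃ x : {t : Tree W | t.rank < κ}, Mem (node x.1 (leaf a.1)) c := by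
        intro a
        obtain ⟨x, hx, hx'⟩ := hs (leaf a.1) (le_of_lt a.2)
        exact ⟨⟨x, hx⟩, hx'⟩
      choose F hF using this
      have hinj : Function.Injective F := by
        intro a b h
        have h1 := hF a
        rw [h] at h1
        have := hf _ _ _ h1 (hF b)
        simp only [leaf.injEq] at this
        exact Subtype.ext this
      have h1 := (mk_le_of_injective hinj).trans hT
      rw [hcard, aleph_le_aleph] at h1
      exact absurd h1 (by simp)
    obtain ⟨κ', h1, h2⟩ := (wellFounded_lt (α := W)).has_min {β | ∀ c, ¬ Onto c κ β} ⟨_, hno⟩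
    refine ⟨κ', ?_, h1, ?_⟩
    · exact not_lt.1 (h2 _ hno)
    · intro β hβ
      by_contra hcon
      push Not at hcon
      exact h2 β hcon hβ
  have hstep' : ∀ n, ∀ κ : W, ∃ κ' : W, κ ≤ p n → κ' ≤ p (n + 1) ∧ IsNext κ κ' := by
    intro n κ
    by_cases h : κ ≤ p n
    · obtain ⟨κ', h'⟩ := hstep n κ h
      exact ⟨κ', fun _ => h'⟩
    · exact ⟨κ, fun h' => absurd h' h⟩
  choose F hF using hstep'
  let kap : ℕ → W := fun n => Nat.rec k0 (fun n κ => F n κ) n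
  have hkap : ∀ n, kap n ≤ p n := by
    intro n
    induction n with
    | zero => exact hk0p
    | succ n ih => exact (hF n _ ih).1
  exact ⟨W, inferInstance, inferInstance, ⟨{
    nomax := nm
    bot := bot
    kap := kap
    lam := lam
    kap0 := hk0
    next := fun n => (hF n _ (hkap n)).2
    lt_lam := fun n => (hkap n).trans_lt (hplam n) }⟩⟩

end Base
end NFUweak

namespace NFUweak
namespace Base
open Tree

variable {W : Type} [LinearOrder W] [WellFoundedLT W]

/-- coded sets of trees -/
def Coded (A : Set (Tree W)) : Prop := ∃ c : Tree W, ∀ x, Mem x c ↔ x ∈ A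

/-- canonical codes -/
def Canon (y : Tree W) : Prop := ∀ z, z < y → ¬ ∀ x, Mem x z ↔ Mem x y

/-- graph of a function -/
def graph (g : Tree W → Tree W) (A : Set (Tree W)) : Set (Tree W) := {t | ∃ a ∈ A, t = node a (g a)}

/-- coded bijection -/
def CBij (A B : Set (Tree W)) : Prop :=
  ∃ g : Tree W → Tree W, Set.BijOn g A B ∧ Coded (graph g A)

/-- `d` is an isomorphism from the part of `c` below `x` onto the part of the trees below `w` -/
def IsoC (lam : W) (c x w d : Tree W) : Prop :=
  AllT lam (fun u => Mem u c → u < x → ExT lam (fun v => v < w ∧ Mem (node u v) d)) ∧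
  AllT lam (fun v => v < w → ExT lam (fun u => Mem u c ∧ u < x ∧ Mem (node u v) d)) ∧
  AllT lam (fun u => AllT lam (fun v => Mem (node u v) d → Mem u c ∧ u < x ∧ v < w)) ∧
  AllT lam (fun u => AllT lam (fun v => AllT lam (fun u' => AllT lam (fun v' =>
    Mem (node u v) d → Mem (node u' v') d → (u < u' ↔ v < v')))))

theorem fst_node (a b : Tree W) : (node a b).fst = a := rfl
theorem snd_node (a b : Tree W) : (node a b).snd = b := rfl

theorem dfn_isoC (lam : W) : Dfn lam (fun e => IsoC lam e.fst e.snd.fst e.snd.snd.fst e.snd.snd.snd) := by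
  have h1 : Dfn lam (fun e => AllT lam (fun u => Mem u e.fst → u < e.snd.fst → ExT lam (fun v => v < e.snd.snd.fst ∧ Mem (.node u v) e.snd.snd.snd))) := inferInstance
  have h2 : Dfn lam (fun e => AllT lam (fun v => v < e.snd.snd.fst → ExT lam (fun u => Mem u e.fst ∧ u < e.snd.fst ∧ Mem (.node u v) e.snd.snd.snd))) := inferInstance
  have h3 : Dfn lam (fun e => AllT lam (fun u => AllT lam (fun v => Mem (.node u v) e.snd.snd.snd → Mem u e.fst ∧ u < e.snd.fst ∧ v < e.snd.snd.fst))) := inferInstance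
  have h4 : Dfn lam (fun e => AllT lam (fun u => AllT lam (fun v => AllT lam (fun u' => AllT lam (fun v' =>
    Mem (.node u v) e.snd.snd.snd → Mem (.node u' v') e.snd.snd.snd → (u < u' ↔ v < v')))))) := inferInstance
  exact Dfn.and (h := h1) (h' := Dfn.and (h := h2) (h' := Dfn.and (h := h3) (h' := h4)))

namespace Setup
variable (U : Setup W)

/-- the `n`-th level -/
def T (n : ℕ) : Set (Tree W) := {t | t.rank < U.kap n}

theorem kap_mono : Monotone U.kap := by
  haveI := U.nomax
  exact monotone_nat_of_le_succ fun n => (U.next n).le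

theorem bot_lt (n : ℕ) : U.bot < U.kap n :=
  ((U.kap0 _).2 rfl).trans_le (U.kap_mono (Nat.zero_le n))

theorem T_mono {m n : ℕ} (h : m ≤ n) : U.T m ⊆ U.T n := fun t ht => lt_of_lt_of_le ht (U.kap_mono h)

theorem node_mem {n : ℕ} {l r : Tree W} : node l r ∈ U.T n ↔ l ∈ U.T n ∧ r ∈ U.T n := rank_node_lt

theorem leaf_bot_mem (n : ℕ) : leaf U.bot ∈ U.T n := U.bot_lt n

theorem rank_lam {n : ℕ} {t : Tree W} (h : t ∈ U.T n) : t.rank < U.lam := lt_trans h (U.lt_lam n)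

theorem mem_T_iff {n : ℕ} {t : Tree W} : t ∈ U.T n ↔ t < leaf (U.kap n) := lt_leaf.symm

theorem lt_mem {n : ℕ} {s t : Tree W} (h : s < t) (ht : t ∈ U.T n) : s ∈ U.T n :=
  (rank_le_of_lt h).trans_lt ht

theorem coded_sub {n : ℕ} {A : Set (Tree W)} (hA : A ⊆ U.T n) (P : Tree W → Prop) [hP : Dfn U.lam P]
    (p : Tree W) (hp : p.rank < U.lam) (h : ∀ x ∈ U.T n, (x ∈ A ↔ P (node x p))) : Coded A := by
  have := hP.comp (fun e => .node e.fst e.snd.fst)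
  obtain ⟨c, -, hc⟩ := exists_code (γ := U.lam) (fun e => e.fst < e.snd.snd ∧ P (.node e.fst e.snd.fst))
    (node p (leaf (U.kap n))) (rank_node_lt.2 ⟨hp, U.lt_lam n⟩)
  refine ⟨c, fun x => ?_⟩
  rw [hc]
  simp only [fst_node, snd_node]
  rw [← mem_T_iff]
  constructor
  · rintro ⟨-, h1, h2⟩
    exact (h x h1).2 h2
  · intro hx
    exact ⟨U.rank_lam (hA hx), hA hx, (h x (hA hx)).1 hx⟩

theorem _root_.NFUweak.Base.Coded.code {U : Setup W} {n : ℕ} {A : Set (Tree W)} (h : Coded A)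
    (hA : A ⊆ U.T n) : ∃ c, Canon c ∧ c ∈ U.T (n + 1) ∧ ∀ x, Mem x c ↔ x ∈ A := by
  haveI := U.nomax
  obtain ⟨c, hc⟩ := h
  obtain ⟨c', h1, h2⟩ := exists_code_next (U.next n) U.bot (U.bot_lt n) c
    (fun x hx => hA ((hc x).1 hx))
  obtain ⟨y, hy, hy'⟩ := (wellFounded_lt (α := Tree W)).has_min {y | ∀ x, Mem x y ↔ x ∈ A} ⟨c, hc⟩
  refine ⟨y, ?_, ?_, hy⟩
  · intro z hz h
    exact hy' z (fun x => (h x).trans (hy x)) hz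
  · have : ¬ c' < y := hy' c' (fun x => (h2 x).trans (hc x))
    rcases not_lt.1 this |>.lt_or_eq with h | h
    · exact U.lt_mem h h1
    · exact h ▸ h1

theorem _root_.NFUweak.Base.Canon.unique {y z : Tree W} (hy : Canon y) (hz : Canon z)
    (h : ∀ x, Mem x y ↔ Mem x z) : y = z := by
  rcases lt_trichotomy y z with h' | h' | h'
  · exact absurd h (hz y h')
  · exact h'
  · exact absurd (fun x => (h x).symm) (hy z h')

theorem canon_mem {n : ℕ} {y : Tree W} (hy : Canon y) (h : ∀ x, Mem x y → x ∈ U.T n) :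
    y ∈ U.T (n + 1) := by
  have : Coded {x | Mem x y} := ⟨y, fun x => Iff.rfl⟩
  obtain ⟨c, h1, h2, h3⟩ := this.code (U := U) (n := n) h
  rwa [hy.unique h1 (fun x => (h3 x).symm)]

instance dfn_canon : Dfn U.lam (fun e => Canon e) :=
  (inferInstance : Dfn U.lam (fun e => AllT U.lam (fun z => z < e →
    ¬ AllT U.lam (fun x => Mem x z ↔ Mem x e)))).congr (by
    intro e he
    unfold Canon AllT
    constructor
    · intro h z hz h'
      exact h z ((rank_le_of_lt hz).trans_lt he) hz (fun x _ => h' x)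
    · intro h z hz hze h'
      refine h z hze (fun x => ?_)
      by_cases hx : x.rank < U.lam
      · exact h' x hx
      · exact ⟨fun h => absurd (h.rank_lt.trans hz) hx, fun h => absurd (h.rank_lt.trans he) hx⟩)

theorem coded_finite {n : ℕ} {A : Set (Tree W)} (hA : A ⊆ U.T n) (hf : A.Finite) : Coded A := by
  induction A, hf using Set.Finite.induction_on with
  | empty => exact U.coded_sub (n := n) hA (fun _ => False) (leaf U.bot) (U.rank_lam (U.leaf_bot_mem 0)) (by simp)
  | @insert a s ha hs ih =>
    have h1 : s ⊆ U.T n := (Set.subset_insert _ _).trans hA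
    obtain ⟨c, -, hc, hc'⟩ := (ih h1).code h1
    refine U.coded_sub hA (fun e => e.fst = e.snd.fst ∨ Mem e.fst e.snd.snd) (node a c)
      (rank_node_lt.2 ⟨U.rank_lam (hA (Set.mem_insert _ _)), U.rank_lam hc⟩) ?_
    intro x _
    simp [fst_node, snd_node, hc']

theorem coded_T (n : ℕ) : Coded (U.T n) :=
  U.coded_sub (n := n) le_rfl (fun _ => True) (leaf U.bot) (U.rank_lam (U.leaf_bot_mem 0)) (by simp)

theorem exists_nomax {n : ℕ} {A : Set (Tree W)} (hA : A ⊆ U.T n) (hc : Coded A) (hi : A.Infinite) :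
    ∃ B ⊆ A, B.Nonempty ∧ Coded B ∧ ∀ b ∈ B, ∃ b' ∈ B, b < b' := by
  by_cases h : ∀ b ∈ A, ∃ b' ∈ A, b < b'
  · exact ⟨A, le_rfl, hi.nonempty, hc, h⟩
  push Not at h
  obtain ⟨b, hb, hbm⟩ := h
  obtain ⟨z, ⟨hzA, hzi⟩, hz⟩ := (wellFounded_lt (α := Tree W)).has_min
    {z | z ∈ A ∧ (A ∩ Set.Iio z).Infinite} ⟨b, hb, by
      intro hfin
      apply hi
      refine (hfin.insert b).subset ?_
      intro x hx
      rcases (hbm x hx).lt_or_eq with h | h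
      · exact Or.inr ⟨hx, h⟩
      · exact Or.inl h⟩
  have hsub : A ∩ Set.Iio z ⊆ U.T n := Set.inter_subset_left.trans hA
  refine ⟨A ∩ Set.Iio z, Set.inter_subset_left, hzi.nonempty, ?_, ?_⟩
  · obtain ⟨c, -, hc, hc'⟩ := hc.code hA
    refine U.coded_sub hsub (fun e => Mem e.fst e.snd.fst ∧ e.fst < e.snd.snd) (node c z)
      (rank_node_lt.2 ⟨U.rank_lam hc, U.rank_lam (hA hzA)⟩) ?_
    intro x _
    simp [fst_node, snd_node, hc']
  · intro b hb
    by_contra hcon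
    push Not at hcon
    have hbf : (A ∩ Set.Iio b).Finite := by
      by_contra h'
      exact hz b ⟨hb.1, h'⟩ hb.2
    apply hzi
    refine (hbf.insert b).subset ?_
    intro x hx
    rcases (hcon x hx).lt_or_eq with h | h
    · exact Or.inr ⟨hx.1, h⟩
    · exact Or.inl h

theorem IsoC_iff {n : ℕ} {A : Set (Tree W)} (hA : A ⊆ U.T n) {h : Tree W → Tree W}
    (g1 : ∀ a ∈ A, ∀ b ∈ A, a < b → h a < h b) (g2 : ∀ a ∈ A, h a ≤ a)
    (g3 : ∀ a ∈ A, ∀ c, c < h a → ∃ b ∈ A, b < a ∧ h b = c) {c : Tree W}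
    (hc : ∀ x, Mem x c ↔ x ∈ A) {x w d : Tree W} (hx : x ∈ A) (hw : w ∈ U.T n)
    (hd : IsoC U.lam c x w d) : w = h x := by
  obtain ⟨d1, d2, d3, d4⟩ := hd
  simp only [AllT, ExT, hc] at d1 d2 d3 d4
  have L : ∀ {t : Tree W}, t ∈ U.T n → t.rank < U.lam := fun h => U.rank_lam h
  have key : ∀ u : Tree W, ∀ v, u ∈ A → u < x → v < w → Mem (node u v) d → v = h u := by
    intro u
    induction u using (wellFounded_lt (α := Tree W)).induction with
    | _ u ih =>
      intro v hu hux hvw huv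
      have hvT := U.lt_mem hvw hw
      apply le_antisymm
      · by_contra hcon
        push Not at hcon
        have hT := U.lt_mem hcon hvT
        obtain ⟨u', hu'l, hu'A, hu'x, hu'd⟩ := d2 (h u) (L hT) (hcon.trans hvw)
        have h1 := (d4 u' hu'l _ (L hT) u (L (hA hu)) v (L hvT) hu'd huv).2 hcon
        have h2 := ih u' h1 (h u) hu'A hu'x (hcon.trans hvw) hu'd
        exact absurd h2 (g1 _ hu'A _ hu h1).ne'
      · by_contra hcon
        push Not at hcon
        obtain ⟨u', hu'A, hu'u, hu'⟩ := g3 u hu v hcon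
        obtain ⟨v', hv'l, hv'w, hv'd⟩ := d1 u' (L (hA hu'A)) hu'A (hu'u.trans hux)
        have h1 := (d4 u' (L (hA hu'A)) v' hv'l u (L (hA hu)) v (L hvT) hv'd huv).1 hu'u
        have h2 := ih u' hu'u v' hu'A (hu'u.trans hux) hv'w hv'd
        rw [hu'] at h2
        exact absurd h2 h1.ne
  have hhx : h x ∈ U.T n := by
    rcases (g2 x hx).lt_or_eq with h' | h'
    · exact U.lt_mem h' (hA hx)
    · rw [h']; exact hA hx
  apply le_antisymm
  · by_contra hcon
    push Not at hcon
    obtain ⟨u, hul, huA, hux, hud⟩ := d2 (h x) (L hhx) hcon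
    have := key u _ huA hux hcon hud
    exact absurd this (g1 _ huA _ hx hux).ne'
  · by_contra hcon
    push Not at hcon
    obtain ⟨u, huA, hux, hu⟩ := g3 x hx w hcon
    obtain ⟨v, hvl, hvw, hvd⟩ := d1 u (L (hA huA)) huA hux
    have := key u v huA hux hvw hvd
    rw [this, hu] at hvw
    exact lt_irrefl _ hvw

theorem coded_collapse {n : ℕ} {A : Set (Tree W)} (hA : A ⊆ U.T n) (hAc : Coded A) {h : Tree W → Tree W}
    (g1 : ∀ a ∈ A, ∀ b ∈ A, a < b → h a < h b) (g2 : ∀ a ∈ A, h a ≤ a)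
    (g3 : ∀ a ∈ A, ∀ c, c < h a → ∃ b ∈ A, b < a ∧ h b = c) : Coded (graph h A) := by
  obtain ⟨c, -, hcT, hc⟩ := hAc.code hA
  have hT : ∀ a ∈ A, h a ∈ U.T n := by
    intro x hx
    rcases (g2 x hx).lt_or_eq with h' | h'
    · exact U.lt_mem h' (hA hx)
    · rw [h']; exact hA hx
  have L : ∀ {t : Tree W}, t ∈ U.T n → t.rank < U.lam := fun h => U.rank_lam h
  have ginj : ∀ a ∈ A, ∀ b ∈ A, h a < h b → a < b := by
    intro a ha b hb hab
    rcases lt_trichotomy a b with h' | h' | h'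
    · exact h'
    · subst h'; exact absurd hab (lt_irrefl _)
    · exact absurd (hab.trans (g1 b hb a ha h')) (lt_irrefl _)
  have hgT : ∀ B ⊆ A, graph h B ⊆ U.T n := by
    rintro B hB _ ⟨a, ha, rfl⟩
    exact U.node_mem.2 ⟨hA (hB ha), hT a (hB ha)⟩
  have step : ∀ B ⊆ A, Coded B → (∀ x ∈ B, Coded (graph h (A ∩ Set.Iio x))) → Coded (graph h B) := by
    intro B hBA hB hx
    obtain ⟨b, -, hbT, hb⟩ := hB.code (hBA.trans hA)
    have hD : Dfn U.lam (fun e => Mem e.fst.fst e.snd.fst ∧ e.fst = .node e.fst.fst e.fst.snd ∧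
      ExT U.lam (fun d => IsoC U.lam e.snd.snd e.fst.fst e.fst.snd d)) := by
      have h0 := (dfn_isoC U.lam).comp (fun e => .node e.snd.snd.snd (.node e.snd.fst.fst (.node e.snd.fst.snd e.fst)))
      simp only [fst_node, snd_node] at h0
      have h1 : Dfn U.lam (fun e => ExT U.lam (fun d => IsoC U.lam e.snd.snd e.fst.fst e.fst.snd d)) :=
        Dfn.ex (h := h0)
      infer_instance
    refine U.coded_sub (hgT B hBA) _ (hP := hD) (node b c) (rank_node_lt.2 ⟨U.rank_lam hbT, U.rank_lam hcT⟩) ?_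
    intro x hxT
    simp only [fst_node, snd_node, hb]
    constructor
    · rintro ⟨a, ha, rfl⟩
      refine ⟨ha, rfl, ?_⟩
      have haA := hBA ha
      obtain ⟨d, -, hdT, hd⟩ := (hx a ha).code (hgT _ Set.inter_subset_left)
      refine ⟨d, U.rank_lam hdT, ?_⟩
      simp only [fst_node, snd_node]
      have hd' : ∀ u v, Mem (node u v) d ↔ u ∈ A ∧ u < a ∧ v = h u := by
        intro u v
        rw [hd]
        constructor
        · rintro ⟨z, hz, hz'⟩
          simp only [node.injEq] at hz'
          obtain ⟨rfl, rfl⟩ := hz'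
          exact ⟨hz.1, hz.2, rfl⟩
        · rintro ⟨h1, h2, rfl⟩
          exact ⟨u, ⟨h1, h2⟩, rfl⟩
      simp only [IsoC, hd', hc]
      refine ⟨?_, ?_, ?_, ?_⟩
      · intro u _ hu hua
        exact ⟨h u, L (hT u hu), g1 u hu a haA hua, hu, hua, rfl⟩
      · intro v _ hv
        obtain ⟨u, hu, hua, huv⟩ := g3 a haA v hv
        exact ⟨u, L (hA hu), hu, hua, hu, hua, huv.symm⟩
      · rintro u _ v _ ⟨hu, hua, rfl⟩
        exact ⟨hu, hua, g1 u hu a haA hua⟩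
      · rintro u _ v _ u' _ v' _ ⟨hu, hua, rfl⟩ ⟨hu', hua', rfl⟩
        exact ⟨g1 u hu u' hu', ginj u hu u' hu'⟩
    · rintro ⟨h1, h2, d, hd, hiso⟩
      have hxs : x.snd ∈ U.T n := (rank_snd x).trans_lt hxT
      refine ⟨x.fst, h1, ?_⟩
      rw [← U.IsoC_iff hA g1 g2 g3 hc (hBA h1) hxs hiso]
      exact h2
  refine step A le_rfl hAc ?_
  intro x
  induction x using (wellFounded_lt (α := Tree W)).induction with
  | _ x ih =>
    intro hx
    refine step _ Set.inter_subset_left ?_ (fun y hy => ih y hy.2 hy.1)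
    refine U.coded_sub (Set.inter_subset_left.trans hA) (fun e => Mem e.fst e.snd.fst ∧ e.fst < e.snd.snd) (node c x)
      (rank_node_lt.2 ⟨U.rank_lam hcT, U.rank_lam (hA hx)⟩) ?_
    intro z _
    simp [fst_node, snd_node, hc]

theorem enc_length (t : Tree W) : t.enc.length = 2 * t.size + 1 := by
  induction t with
  | leaf a => rfl
  | node l r h1 h2 => simp [enc, size, h1, h2]; omega

theorem finite_size (n : ℕ) : {t | t ∈ U.T 0 ∧ t.size ≤ n}.Finite := by
  induction n with
  | zero =>
    refine (Set.finite_singleton (leaf U.bot)).subset ?_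
    rintro t ⟨h1, h2⟩
    cases t with
    | leaf a =>
      have : a = U.bot := (U.kap0 a).1 h1
      rw [this]; rfl
    | node l r => simp [size] at h2
  | succ n ih =>
    refine ((Set.finite_singleton (leaf U.bot)).union (Set.Finite.image2 node ih ih)).subset ?_
    rintro t ⟨h1, h2⟩
    cases t with
    | leaf a =>
      have : a = U.bot := (U.kap0 a).1 h1
      rw [this]; exact Or.inl rfl
    | node l r =>
      right
      simp only [size] at h2
      obtain ⟨a1, a2⟩ := U.node_mem.1 h1
      exact ⟨l, ⟨a1, by omega⟩, r, ⟨a2, by omega⟩, rfl⟩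

theorem finite_below {t : Tree W} (ht : t ∈ U.T 0) : (Set.Iio t).Finite := by
  refine (U.finite_size t.size).subset ?_
  intro s hs
  refine ⟨U.lt_mem hs ht, ?_⟩
  have hr : ∀ t ∈ U.T 0, t.rank = U.bot := fun t ht => (U.kap0 _).1 ht
  rcases lt_def.1 hs with h | ⟨_, h⟩
  · rw [hr _ ht, hr _ (U.lt_mem hs ht)] at h
    exact absurd h (lt_irrefl _)
  · rw [List.shortlex_def, enc_length, enc_length] at h
    omega

theorem coded_image {n m : ℕ} {A : Set (Tree W)} {g : Tree W → Tree W} (hA : A ⊆ U.T n)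
    (hg : Set.MapsTo g A (U.T m)) (h : Coded (graph g A)) : Coded (g '' A) := by
  have hsub : graph g A ⊆ U.T (max n m) := by
    rintro _ ⟨a, ha, rfl⟩
    exact U.node_mem.2 ⟨U.T_mono (le_max_left _ _) (hA ha), U.T_mono (le_max_right _ _) (hg ha)⟩
  obtain ⟨c, -, hcT, hc⟩ := h.code hsub
  refine U.coded_sub (n := m) (by rintro _ ⟨a, ha, rfl⟩; exact hg ha)
    (fun e => ExT U.lam (fun a => Mem (.node a e.fst) e.snd)) c (U.rank_lam hcT) ?_
  intro x _
  simp only [fst_node, snd_node, ExT, hc]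
  constructor
  · rintro ⟨a, ha, rfl⟩
    exact ⟨a, U.rank_lam (hA ha), a, ha, rfl⟩
  · rintro ⟨a, -, b, hb, h⟩
    simp only [node.injEq] at h
    obtain ⟨rfl, rfl⟩ := h
    exact ⟨a, hb, rfl⟩

theorem coded_comp {n m k : ℕ} {A B : Set (Tree W)} {g g' : Tree W → Tree W} (hA : A ⊆ U.T n)
    (hB : B ⊆ U.T m) (hg : Set.MapsTo g A B) (hg' : Set.MapsTo g' B (U.T k))
    (h : Coded (graph g A)) (h' : Coded (graph g' B)) : Coded (graph (g' ∘ g) A) := by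
  obtain ⟨N, hn, hm, hk⟩ : ∃ N, n ≤ N ∧ m ≤ N ∧ k ≤ N := ⟨n + m + k, by omega, by omega, by omega⟩
  have hsub : graph g A ⊆ U.T N := by
    rintro _ ⟨a, ha, rfl⟩
    exact U.node_mem.2 ⟨U.T_mono hn (hA ha), U.T_mono hm (hB (hg ha))⟩
  have hsub' : graph g' B ⊆ U.T N := by
    rintro _ ⟨a, ha, rfl⟩
    exact U.node_mem.2 ⟨U.T_mono hm (hB ha), U.T_mono hk (hg' ha)⟩
  obtain ⟨c, -, hcT, hc⟩ := h.code hsub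
  obtain ⟨c', -, hcT', hc'⟩ := h'.code hsub'
  refine U.coded_sub (n := N) ?_
    (fun e => e.fst = .node e.fst.fst e.fst.snd ∧
      ExT U.lam (fun b => Mem (.node e.fst.fst b) e.snd.fst ∧ Mem (.node b e.fst.snd) e.snd.snd))
    (node c c') (rank_node_lt.2 ⟨U.rank_lam hcT, U.rank_lam hcT'⟩) ?_
  · rintro _ ⟨a, ha, rfl⟩
    exact U.node_mem.2 ⟨U.T_mono hn (hA ha), U.T_mono hk (hg' (hg ha))⟩
  intro x _
  simp only [fst_node, snd_node, ExT, hc, hc']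
  constructor
  · rintro ⟨a, ha, rfl⟩
    exact ⟨rfl, g a, U.rank_lam (hB (hg ha)), ⟨a, ha, rfl⟩, ⟨g a, hg ha, rfl⟩⟩
  · rintro ⟨hx, b, -, ⟨a, ha, h1⟩, ⟨b', hb', h2⟩⟩
    simp only [node.injEq] at h1 h2
    obtain ⟨h1, rfl⟩ := h1
    obtain ⟨rfl, h2⟩ := h2
    refine ⟨a, ha, ?_⟩
    rw [hx, h1, h2]; rfl

theorem exists_cbij {n : ℕ} {A : Set (Tree W)} (hA : A ⊆ U.T n) (hAc : Coded A) (hi : A.Infinite) :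
    ∃ m ≤ n, CBij A (U.T m) := by
  classical
  let Q : ℕ → Prop := fun m => ∃ g : Tree W → Tree W, Set.InjOn g A ∧ Set.MapsTo g A (U.T m) ∧
    Coded (graph g A)
  have hQ : Q n := by
    refine ⟨id, Function.injective_id.injOn, hA, ?_⟩
    obtain ⟨c, -, hcT, hc⟩ := hAc.code hA
    refine U.coded_sub (n := n) ?_ (fun e => Mem e.fst.fst e.snd ∧ e.fst = .node e.fst.fst e.fst.fst) c
      (U.rank_lam hcT) ?_
    · rintro _ ⟨a, ha, rfl⟩
      exact U.node_mem.2 ⟨hA ha, hA ha⟩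
    · intro x _
      simp only [fst_node, snd_node, hc]
      constructor
      · rintro ⟨a, ha, rfl⟩
        exact ⟨ha, rfl⟩
      · rintro ⟨h1, h2⟩
        exact ⟨x.fst, h1, h2⟩
  have hex : ∃ m, Q m := ⟨n, hQ⟩
  set m := Nat.find hex with hm
  obtain ⟨g, gi, gm, gc⟩ := Nat.find_spec hex
  rw [← hm] at gm
  have hmn : m ≤ n := Nat.find_min' hex hQ
  refine ⟨m, hmn, ?_⟩
  have hA'T : g '' A ⊆ U.T m := by rintro _ ⟨a, ha, rfl⟩; exact gm ha
  have hA'c := U.coded_image hA gm gc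
  obtain ⟨h, g1, g2, g3⟩ := exists_collapse (g '' A)
  have hc := U.coded_collapse hA'T hA'c g1 g2 g3
  have hi' : Set.InjOn h (g '' A) := by
    intro a ha b hb hab
    rcases lt_trichotomy a b with h' | h' | h'
    · exact absurd hab (g1 a ha b hb h').ne
    · exact h'
    · exact absurd hab (g1 b hb a ha h').ne'
  have hmt : Set.MapsTo h (g '' A) (U.T m) := by
    intro x hx
    rcases (g2 x hx).lt_or_eq with h' | h'
    · exact U.lt_mem h' (hA'T hx)
    · rw [h']; exact hA'T hx
  have hcomp : Coded (graph (h ∘ g) A) := U.coded_comp hA hA'T (Set.mapsTo_image g A) hmt gc hc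
  have hinj : Set.InjOn (h ∘ g) A := hi'.comp gi (Set.mapsTo_image g A)
  have hmaps : Set.MapsTo (h ∘ g) A (U.T m) := hmt.comp (Set.mapsTo_image g A)
  refine ⟨h ∘ g, ⟨hmaps, hinj, ?_⟩, hcomp⟩
  intro t ht
  by_contra hcon
  have hlt : ∀ a ∈ A, (h ∘ g) a < t := by
    intro a ha
    rcases lt_trichotomy ((h ∘ g) a) t with h' | h' | h'
    · exact h'
    · exact absurd ⟨a, ha, h'⟩ hcon
    · obtain ⟨_, ⟨b, hb, rfl⟩, -, hb'⟩ := g3 (g a) ⟨a, ha, rfl⟩ t h'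
      exact absurd ⟨b, hb, hb'⟩ hcon
  rcases Nat.eq_zero_or_pos m with hm0 | hmpos
  · rw [hm0] at ht
    apply hi
    exact Set.Finite.of_finite_image ((U.finite_below ht).subset (by
      rintro _ ⟨a, ha, rfl⟩; exact hlt a ha)) hinj
  · obtain ⟨k, hk⟩ : ∃ k, m = k + 1 := ⟨m - 1, by omega⟩
    rw [hk] at ht
    obtain ⟨s, hsf, hso⟩ := (U.next k).2 t.rank ht
    have hso' : ∀ a ∈ A, ∃ x, x ∈ U.T k ∧ Mem (node x ((h ∘ g) a)) s := by
      intro a ha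
      exact hso _ (rank_le_of_lt (hlt a ha))
    have hleast : ∀ y : Tree W, ∃ x, (∃ x, x ∈ U.T k ∧ Mem (node x y) s) →
        (x ∈ U.T k ∧ Mem (node x y) s ∧ ∀ z, z < x → ¬ Mem (node z y) s) := by
      intro y
      by_cases hy : ∃ x, x ∈ U.T k ∧ Mem (node x y) s
      · obtain ⟨x, hx, hx'⟩ := (wellFounded_lt (α := Tree W)).has_min {x | x ∈ U.T k ∧ Mem (node x y) s} hy
        exact ⟨x, fun _ => ⟨hx.1, hx.2, fun z hz hz' => hx' z ⟨U.lt_mem hz hx.1, hz'⟩ hz⟩⟩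
      · exact ⟨y, fun h => absurd h hy⟩
    choose r hr using hleast
    let B := (h ∘ g) '' A
    have hBT : B ⊆ U.T m := by rintro _ ⟨a, ha, rfl⟩; exact hmaps ha
    have hBc : Coded B := U.coded_image hA hmaps hcomp
    have hrB : ∀ y ∈ B, r y ∈ U.T k ∧ Mem (node (r y) y) s ∧ ∀ z, z < r y → ¬ Mem (node z y) s := by
      rintro _ ⟨a, ha, rfl⟩
      exact hr _ (hso' a ha)
    have hrc : Coded (graph r B) := by
      obtain ⟨b, -, hbT, hb⟩ := hBc.code hBT
      -- restrict the surjection to a small set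
      obtain ⟨ε, hε⟩ : ∃ ε, max s.rank U.lam < ε := by haveI := U.nomax; exact exists_gt _
      obtain ⟨hε1, hε2⟩ := max_lt_iff.1 hε
      obtain ⟨d, -, hd⟩ := exists_code (γ := ε) (fun e => Mem e.fst.fst e.snd.fst ∧
        e.fst = .node e.fst.fst e.fst.snd ∧ Mem (.node e.fst.snd e.fst.fst) e.snd.snd ∧
        AllT ε (fun z => z < e.fst.snd → ¬ Mem (.node z e.fst.fst) e.snd.snd)) (node b s)
        (rank_node_lt.2 ⟨(U.rank_lam hbT).trans hε2, hε1⟩)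
      refine ⟨d, fun x => ?_⟩
      rw [hd]
      simp only [fst_node, snd_node, hb]
      constructor
      · rintro ⟨hx, h1, h2, h3, h4⟩
        obtain ⟨r1, r2, r3⟩ := hrB _ h1
        refine ⟨x.fst, h1, ?_⟩
        have : x.snd = r x.fst := by
          rcases lt_trichotomy x.snd (r x.fst) with h' | h' | h'
          · exact absurd h3 (r3 _ h')
          · exact h'
          · exact absurd r2 (h4 _ ((U.rank_lam r1).trans hε2) h')
        rw [← this]; exact h2
      · rintro ⟨a, ha, rfl⟩
        obtain ⟨r1, r2, r3⟩ := hrB _ ha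
        refine ⟨rank_node_lt.2 ⟨(U.rank_lam (hBT ha)).trans hε2, (U.rank_lam r1).trans hε2⟩, ha, rfl,
          r2, fun z _ hz => r3 z hz⟩
    have hQk : Q k := by
      refine ⟨r ∘ (h ∘ g), ?_, ?_, ?_⟩
      · intro a ha a' ha' haa
        apply hinj ha ha'
        have h1 := (hrB _ ⟨a, ha, rfl⟩).2.1
        have h2 := (hrB _ ⟨a', ha', rfl⟩).2.1
        have haa' : r ((h ∘ g) a) = r ((h ∘ g) a') := haa
        rw [haa'] at h1
        exact hsf _ _ _ h1 h2
      · intro a ha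
        exact (hrB _ ⟨a, ha, rfl⟩).1
      · exact U.coded_comp hA hBT (Set.mapsTo_image _ A) (fun y hy => (hrB y hy).1) hcomp hrc
    have := Nat.find_min' hex hQk
    omega

end Setup
end Base
end NFUweak

namespace NFUweak
namespace Base
open Filter Function

/-! ## Iterated ultrapower filter -/

/-- index space -/
abbrev X := ℤ → ℕ

/-- iterate the hyperfilter on the coordinates `a, …, a+k-1` -/
noncomputable def itU : ℕ → ℤ → X → Ultrafilter X
  | 0, _, x => pure x
  | k + 1, a, x => (hyperfilter ℕ).bind (fun n => itU k (a + 1) (update x a n))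

/-- truth almost everywhere -/
def It (a : ℤ) (k : ℕ) (P : X → Prop) (x : X) : Prop := ∀ᶠ y in (itU k a x : Filter X), P y

theorem It_zero {a : ℤ} {P : X → Prop} {x : X} : It a 0 P x ↔ P x := by
  unfold It itU
  exact Filter.eventually_pure

theorem It_succ {a : ℤ} {k : ℕ} {P : X → Prop} {x : X} :
    It a (k + 1) P x ↔ ∀ᶠ n in (hyperfilter ℕ : Filter ℕ), It (a + 1) k P (update x a n) := by
  unfold It
  exact Filter.eventually_bind

theorem It_add {k : ℕ} : ∀ {a : ℤ} {l : ℕ} {P : X → Prop} {x : X},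
    It a (k + l) P x ↔ It a k (fun y => It (a + k) l P y) x := by
  induction k with
  | zero => intro a l P x; rw [It_zero]; simp
  | succ k ih =>
    intro a l P x
    rw [show k + 1 + l = (k + l) + 1 by omega, It_succ, It_succ]
    refine eventually_congr (Eventually.of_forall fun n => ?_)
    rw [ih]
    have : a + 1 + (k : ℤ) = a + ((k + 1 : ℕ) : ℤ) := by push_cast; ring
    rw [this]

/-- dependence on a set of coordinates -/
def DepOn {α : Sort*} (I : Set ℤ) (f : X → α) : Prop := ∀ x y, (∀ i ∈ I, x i = y i) → f x = f y

theorem It_congr {I : Set ℤ} {P : X → Prop} (h : DepOn I P) {k : ℕ} : ∀ {a : ℤ} {x y : X},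
    (∀ i ∈ I, ¬ (a ≤ i ∧ i < a + k) → x i = y i) → (It a k P x ↔ It a k P y) := by
  induction k with
  | zero =>
    intro a x y hxy
    rw [It_zero, It_zero, h x y (fun i hi => hxy i hi (by simp))]
  | succ k ih =>
    intro a x y hxy
    rw [It_succ, It_succ]
    refine eventually_congr (Eventually.of_forall fun n => ih fun i hi hi' => ?_)
    by_cases hia : i = a
    · subst hia; simp
    · rw [update_of_ne hia, update_of_ne hia]
      apply hxy i hi
      push_cast; omega

theorem It_const {a : ℤ} {k : ℕ} {p : Prop} {x : X} : It a k (fun _ => p) x ↔ p := by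
  unfold It; simp

theorem It_free {I : Set ℤ} {P : X → Prop} (h : DepOn I P) {k : ℕ} {a : ℤ} {x : X}
    (hI : ∀ i ∈ I, ¬ (a ≤ i ∧ i < a + k)) : It a k P x ↔ P x := by
  induction k generalizing a x with
  | zero => exact It_zero
  | succ k ih =>
    rw [It_succ]
    have : ∀ n, It (a + 1) k P (update x a n) ↔ P x := by
      intro n
      rw [ih (fun i hi => by have := hI i hi; push_cast at this; omega)]
      rw [h (update x a n) x]
      intro i hi
      rw [update_of_ne]
      have := hI i hi
      push_cast at this
      omega
    simp [this]

/-- the value of `It` only depends on the support -/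
theorem It_supp {P : X → Prop} {a : ℤ} {k : ℕ} (h : DepOn (Set.Ico a (a + k)) P) {b : ℤ} {l : ℕ}
    (hb : b ≤ a) (hl : a + k ≤ b + l) (x y : X) : It b l P x ↔ It a k P y := by
  obtain ⟨p, rfl⟩ : ∃ p : ℕ, a = b + p := ⟨(a - b).toNat, by omega⟩
  obtain ⟨q, rfl⟩ : ∃ q : ℕ, l = p + (k + q) := ⟨l - (p + k), by omega⟩
  rw [It_add]
  have h1 : ∀ z, It (b + p) (k + q) P z ↔ It (b + p) k P y := by
    intro z
    rw [It_add]
    have h2 : ∀ z, It (b + p + k) q P z ↔ P z := fun z =>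
      It_free h (fun i hi => by have := hi.2; omega)
    simp only [h2]
    exact It_congr h (fun i hi hi' => absurd hi hi')
  simp only [h1, It_const]

theorem It_outside {a : ℤ} {k : ℕ} {x : X} : It a k (fun y => ∀ i, ¬ (a ≤ i ∧ i < a + k) → y i = x i) x := by
  induction k generalizing a x with
  | zero => rw [It_zero]; intros; rfl
  | succ k ih =>
    rw [It_succ]
    refine Eventually.of_forall fun n => ?_
    refine (ih (a := a + 1) (x := update x a n)).mono ?_
    intro y hy i hi
    rw [hy i (by push_cast at hi; omega), update_of_ne]
    push_cast at hi; omega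

/-- shift -/
def sh (k : ℤ) (x : X) : X := fun i => x (i + k)

@[simp] theorem sh_apply (k : ℤ) (x : X) (i : ℤ) : sh k x i = x (i + k) := rfl
@[simp] theorem sh_sh (k l : ℤ) (x : X) : sh k (sh l x) = sh (k + l) x := by
  ext i; simp [add_assoc]
@[simp] theorem sh_zero (x : X) : sh 0 x = x := by ext i; simp

theorem It_sh {a s : ℤ} {k : ℕ} {P : X → Prop} {x : X} :
    It a k (fun y => P (sh s y)) x ↔ It (a - s) k P (sh s x) := by
  induction k generalizing a x with
  | zero => rw [It_zero, It_zero]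
  | succ k ih =>
    rw [It_succ, It_succ]
    refine eventually_congr (Eventually.of_forall fun n => ?_)
    rw [ih]
    have : sh s (update x a n) = update (sh s x) (a - s) n := by
      ext i
      simp only [sh_apply, update_apply]
      congr 1
      apply propext
      constructor <;> intro h <;> omega
    rw [this, show a + 1 - s = a - s + 1 by ring]

/-- the filter -/
noncomputable def D : Ultrafilter X :=
  (hyperfilter ℕ).bind (fun k => itU (2 * k + 1) (-(k : ℤ)) 0)

theorem D_iff {P : X → Prop} {a : ℤ} {k : ℕ} (h : DepOn (Set.Ico a (a + k)) P) (y : X) :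
    (∀ᶠ x in (D : Filter X), P x) ↔ It a k P y := by
  have h1 : (∀ᶠ x in (D : Filter X), P x) ↔ ∀ᶠ l : ℕ in (hyperfilter ℕ : Filter ℕ), It (-(l : ℤ)) (2 * l + 1) P 0 :=
    Filter.eventually_bind
  rw [h1]
  have h2 : ∀ᶠ l : ℕ in (hyperfilter ℕ : Filter ℕ), (It (-(l : ℤ)) (2 * l + 1) P 0 ↔ It a k P y) := by
    have := Nat.hyperfilter_le_atTop (eventually_ge_atTop (a.natAbs + k))
    filter_upwards [this] with l hl
    have hl : a.natAbs + k ≤ l := hl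
    exact It_supp h (by omega) (by push_cast; omega) _ _
  rw [eventually_congr h2]
  simp

/-- finite support -/
def FS {α : Sort*} (f : X → α) : Prop := ∃ a : ℕ, DepOn (Set.Icc (-(a : ℤ)) a) f

theorem FS.const {α : Sort*} (c : α) : FS (fun _ => c) := ⟨0, fun _ _ _ => rfl⟩

theorem FS.comp {α β : Sort*} {f : X → α} (h : FS f) (F : α → β) : FS (fun x => F (f x)) := by
  obtain ⟨a, ha⟩ := h
  exact ⟨a, fun x y hxy => congrArg F (ha x y hxy)⟩

theorem DepOn.mono {α : Sort*} {I J : Set ℤ} {f : X → α} (h : DepOn I f) (hIJ : I ⊆ J) : DepOn J f :=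
  fun x y hxy => h x y fun i hi => hxy i (hIJ hi)

theorem FS.comp2 {α β δ : Sort*} {f : X → α} {g : X → β} (h : FS f) (h' : FS g) (F : α → β → δ) :
    FS (fun x => F (f x) (g x)) := by
  obtain ⟨a, ha⟩ := h
  obtain ⟨b, hb⟩ := h'
  refine ⟨max a b, fun x y hxy => ?_⟩
  have h1 := ha.mono (J := Set.Icc (-((max a b : ℕ) : ℤ)) ((max a b : ℕ) : ℤ)) (Set.Icc_subset_Icc (by simp) (by simp)) x y hxy
  have h2 := hb.mono (J := Set.Icc (-((max a b : ℕ) : ℤ)) ((max a b : ℕ) : ℤ)) (Set.Icc_subset_Icc (by simp) (by simp)) x y hxy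
  show F (f x) (g x) = F (f y) (g y)
  rw [h1, h2]

theorem FS.comp3 {α β γ δ : Type*} {f : X → α} {g : X → β} {k : X → γ} (h : FS f) (h' : FS g) (h'' : FS k)
    (F : α → β → γ → δ) : FS (fun x => F (f x) (g x) (k x)) :=
  (h.comp2 h' Prod.mk).comp2 h'' (fun p c => F p.1 p.2 c)

theorem FS.shift {α : Sort*} {f : X → α} (h : FS f) (k : ℤ) : FS (fun x => f (sh k x)) := by
  obtain ⟨a, ha⟩ := h
  refine ⟨a + k.natAbs, fun x y hxy => ha _ _ fun i hi => hxy _ ?_⟩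
  simp only [Set.mem_Icc, Nat.cast_add] at hi ⊢
  omega

theorem FS.coord (i : ℤ) : FS (fun x : X => x i) :=
  ⟨i.natAbs, fun x y hxy => hxy i (by simp only [Set.mem_Icc]; omega)⟩

theorem FS.dep {α : Sort*} {f : X → α} (h : FS f) : ∃ (a : ℤ) (k : ℕ), DepOn (Set.Ico a (a + k)) f := by
  obtain ⟨a, ha⟩ := h
  refine ⟨-a, 2 * a + 1, ha.mono ?_⟩
  intro i hi
  simp only [Set.mem_Icc, Set.mem_Ico] at hi ⊢
  push_cast; omega

theorem D_sh {P : X → Prop} (h : FS P) (s : ℤ) :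
    (∀ᶠ x in (D : Filter X), P (sh s x)) ↔ ∀ᶠ x in (D : Filter X), P x := by
  obtain ⟨a, k, ha⟩ := h.dep
  have h' : DepOn (Set.Ico (a + s) (a + s + k)) (fun x => P (sh s x)) := by
    intro x y hxy
    apply ha
    intro i hi
    apply hxy
    simp only [Set.mem_Ico] at hi ⊢
    omega
  rw [D_iff ha (sh s 0), D_iff h' 0, It_sh]
  simp

theorem D_lt (i : ℤ) : ∀ᶠ x in (D : Filter X), x i < x (i + 1) := by
  have h : DepOn (Set.Ico i (i + (2 : ℕ))) (fun x : X => x i < x (i + 1)) := by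
    intro x y hxy
    show (x i < x (i + 1)) = (y i < y (i + 1))
    rw [hxy i (by simp), hxy (i + 1) (by simp)]
  rw [D_iff h 0, It_succ]
  refine Eventually.of_forall fun n => ?_
  rw [It_succ]
  have := Nat.hyperfilter_le_atTop (eventually_gt_atTop n)
  filter_upwards [this] with m hm
  rw [It_zero]
  simpa using hm

/-- Descent lemma. -/
theorem D_descent {f : X → ℕ} (hf : FS f) : ∀ᶠ x in (D : Filter X), f x ≤ f (sh 1 x) := by
  by_contra hcon
  rw [← Ultrafilter.eventually_not] at hcon
  obtain ⟨b, N, hN⟩ := hf.dep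
  let R : ℕ → X → Prop := fun i x => f (sh (i + 1) x) < f (sh i x)
  have hRFS : FS (fun x => f (sh 1 x) < f x) := (hf.shift 1).comp2 hf (· < ·)
  have hRD : ∀ i, ∀ᶠ x in (D : Filter X), R i x := by
    intro i
    have := (D_sh hRFS i).2 (hcon.mono fun x hx => not_le.1 hx)
    refine this.mono fun x hx => ?_
    simpa [R, add_comm] using hx
  have hRdep : ∀ i : ℕ, DepOn (Set.Ico (b + i) (b + i + (N + 1 : ℕ))) (R i) := by
    intro i x y hxy
    show (_ < _) = (_ < _)
    rw [hN (sh (i + 1) x) (sh (i + 1) y), hN (sh i x) (sh i y)]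
    · intro j hj
      apply hxy
      simp only [Set.mem_Ico] at hj ⊢
      push_cast; omega
    · intro j hj
      apply hxy
      simp only [Set.mem_Ico] at hj ⊢
      push_cast; omega
  have hRdep' : ∀ i ≤ N, DepOn (Set.Ico b (b + (N + (N + 1) : ℕ))) (R i) := by
    intro i hi
    refine (hRdep i).mono ?_
    intro j hj
    simp only [Set.mem_Ico] at hj ⊢
    push_cast at *; omega
  have h1 : It b N (fun x => ∀ i ∈ Finset.range (N + 1), It (b + N) (N + 1) (R i) x) 0 := by
    unfold It
    rw [Filter.eventually_all_finset]
    intro i hi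
    have h2 := (D_iff (hRdep' i (by simp at hi; omega)) 0).1 (hRD i)
    rw [It_add] at h2
    exact h2
  obtain ⟨x, hx⟩ := Filter.Eventually.exists h1
  have hall : ∀ K, N + 1 ≤ K → ∀ i, i + 1 ≤ K → It (b + N) K (R i) x := by
    intro K hK i hi
    obtain ⟨q, rfl⟩ : ∃ q, K = N + 1 + q := ⟨K - (N + 1), by omega⟩
    by_cases hiN : i ≤ N
    · rw [It_add]
      have h3 : ∀ z, It (b + N + (N + 1 : ℕ)) q (R i) z ↔ R i z := fun z =>
        It_free (hRdep' i hiN) (fun j hj => by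
          have := hj.2
          push_cast at *; omega)
      simp only [h3]
      exact hx i (by simp; omega)
    · have h4 := (D_iff (hRdep i) x).1 (hRD i)
      exact (It_supp (hRdep i) (by omega) (by push_cast; omega) x x).2 h4
  set v := f x with hv
  have h5 : It (b + N) (N + 1 + v + 1) (fun y => (∀ i ∈ Finset.range (v + 2), R i y) ∧ f y = v) x := by
    unfold It
    refine Filter.Eventually.and ?_ ?_
    · rw [Filter.eventually_all_finset]
      intro i hi
      simp only [Finset.mem_range] at hi
      by_cases hN0 : i + 1 ≤ N + 1 + v + 1
      · exact hall _ (by omega) i hN0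
      · omega
    · refine (It_outside (a := b + N) (k := N + 1 + v + 1) (x := x)).mono fun y hy => ?_
      rw [hv]
      apply hN
      intro i hi
      apply hy
      have := hi.2
      omega
  obtain ⟨y, hy, hyv⟩ := Filter.Eventually.exists h5
  have : ∀ i : ℕ, i ≤ v + 1 → f (sh i y) + i ≤ v := by
    intro i
    induction i with
    | zero => intro _; simp [hyv]
    | succ i ih =>
      intro hi
      have h6 := hy i (by simp; omega)
      have h7 := ih (by omega)
      simp only [R] at h6
      push_cast
      omega
  have := this (v + 1) le_rfl
  omega

end Base
end NFUweak

namespace NFUweak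
namespace Base
open Filter Function Tree

variable {W : Type} [LinearOrder W] [WellFoundedLT W]

/-- almost everywhere -/
def AE (P : X → Prop) : Prop := ∀ᶠ x in (D : Filter X), P x

theorem AE.mono {P Q : X → Prop} (h : AE P) (hPQ : ∀ x, P x → Q x) : AE Q := Filter.Eventually.mono h hPQ
theorem AE.of {P : X → Prop} (h : ∀ x, P x) : AE P := Filter.Eventually.of_forall h
theorem AE.and {P Q : X → Prop} (h : AE P) (h' : AE Q) : AE (fun x => P x ∧ Q x) := Filter.Eventually.and h h'
theorem AE.mp {P Q : X → Prop} (h : AE P) (h' : AE (fun x => P x → Q x)) : AE Q := Filter.Eventually.mp h h'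
theorem AE.exists {P : X → Prop} (h : AE P) : ∃ x, P x := Filter.Eventually.exists h
theorem AE.congr {P Q : X → Prop} (h : AE (fun x => P x ↔ Q x)) : AE P ↔ AE Q := Filter.eventually_congr h
theorem AE.mp2 {P Q R : X → Prop} (h : AE P) (h' : AE Q) (hR : ∀ x, P x → Q x → R x) : AE R :=
  (h.and h').mono fun x hx => hR x hx.1 hx.2
theorem AE_not {P : X → Prop} : AE (fun x => ¬ P x) ↔ ¬ AE P := Ultrafilter.eventually_not
theorem AE_imp {P Q : X → Prop} : AE (fun x => P x → Q x) ↔ (AE P → AE Q) := Ultrafilter.eventually_imp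
theorem AE_and {P Q : X → Prop} : AE (fun x => P x ∧ Q x) ↔ (AE P ∧ AE Q) := Filter.eventually_and
theorem AE_sh {P : X → Prop} (h : FS P) (s : ℤ) : AE (fun x => P (sh s x)) ↔ AE P := D_sh h s
theorem AE_iff {P Q : X → Prop} : AE (fun x => P x ↔ Q x) ↔ (AE P ↔ AE Q) := by
  have : AE (fun x => P x ↔ Q x) ↔ AE (fun x => (P x → Q x) ∧ (Q x → P x)) :=
    AE.congr (AE.of fun x => by tauto)
  rw [this, AE_and, AE_imp, AE_imp]
  tauto

/-- representatives -/
structure Rep (U : Setup W) where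
  f : X → Tree W
  fs : FS f
  mem : ∀ x, f x ∈ U.T (x 0)

/-- almost everywhere equality -/
def repSetoid (U : Setup W) : Setoid (Rep U) where
  r a b := AE (fun x => a.f x = b.f x)
  iseqv := ⟨fun a => AE.of fun _ => rfl, fun h => h.mono fun _ h => h.symm,
    fun h h' => h.mp2 h' fun _ a b => a.trans b⟩

/-- the model -/
def Mod (U : Setup W) : Type := Quotient (repSetoid U)

variable {U : Setup W}

namespace Mod

/-- the representing function -/
noncomputable def r (a : Mod U) : X → Tree W := (Quotient.out a).f

theorem fs (a : Mod U) : FS a.r := (Quotient.out a).fs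
theorem mem (a : Mod U) (x : X) : a.r x ∈ U.T (x 0) := (Quotient.out a).mem x

theorem mem_sh (a : Mod U) (k : ℤ) (x : X) : a.r (sh k x) ∈ U.T (x k) := by
  have := a.mem (sh k x)
  simpa using this

/-- constructor -/
def mk (f : X → Tree W) (hf : FS f) (hm : ∀ x, f x ∈ U.T (x 0)) : Mod U :=
  Quotient.mk (repSetoid U) ⟨f, hf, hm⟩

theorem r_mk {f : X → Tree W} {hf : FS f} {hm : ∀ x, f x ∈ U.T (x 0)} :
    AE (fun x => (mk f hf hm).r x = f x) := by
  have : (repSetoid U).r _ _ := Quotient.mk_out (s := repSetoid U) (⟨f, hf, hm⟩ : Rep U)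
  exact this

theorem r_mk_sh {f : X → Tree W} {hf : FS f} {hm : ∀ x, f x ∈ U.T (x 0)} (k : ℤ) :
    AE (fun x => (mk f hf hm).r (sh k x) = f (sh k x)) :=
  (AE_sh ((fs _).comp2 hf (· = ·)) k).2 r_mk

theorem exists_mk (f : X → Tree W) (hf : FS f) (hm : ∀ x, f x ∈ U.T (x 0)) :
    ∃ a : Mod U, (AE fun x => a.r x = f x) ∧ ∀ k, AE (fun x => a.r (sh k x) = f (sh k x)) :=
  ⟨mk f hf hm, r_mk, r_mk_sh⟩

theorem eq_iff {a b : Mod U} : a = b ↔ AE (fun x => a.r x = b.r x) := by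
  constructor
  · rintro rfl; exact AE.of fun _ => rfl
  · intro h
    rw [← Quotient.out_eq (s := repSetoid U) a, ← Quotient.out_eq (s := repSetoid U) b]
    exact Quotient.sound (s := repSetoid U) h

theorem eq_iff_sh (k : ℤ) {a b : Mod U} : a = b ↔ AE (fun x => a.r (sh k x) = b.r (sh k x)) := by
  rw [eq_iff]
  exact (AE_sh (a.fs.comp2 b.fs (· = ·)) k).symm

end Mod

/-- `y` codes a subset of level `n`. -/
def SetN (U : Setup W) (n : ℕ) (y : Tree W) : Prop := Canon y ∧ ∀ x, Mem x y → x ∈ U.T n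

/-- pointwise pair -/
noncomputable def Mod.pr (a b : Mod U) : Mod U :=
  Mod.mk (fun x => node (a.r x) (b.r x)) (a.fs.comp2 b.fs node) (fun x => U.node_mem.2 ⟨a.mem x, b.mem x⟩)

noncomputable instance modStr (U : Setup W) : LNFU.Structure (Mod U) where
  funMap := fun {n} f => match n, f with
    | _, NFUFunc.pair => fun v => (v 0).pr (v 1)
  RelMap := fun {n} R => match n, R with
    | _, NFURel.mem => fun v => AE (fun x => SetN U (x (-1)) ((v 1).r x) ∧ Mem ((v 0).r (sh (-1) x)) ((v 1).r x))
    | _, NFURel.isSet => fun v => AE (fun x => SetN U (x (-1)) ((v 0).r x))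

theorem smem_iff {a b : Mod U} : smem a b ↔
    AE (fun x => SetN U (x (-1)) (b.r x) ∧ Mem (a.r (sh (-1) x)) (b.r x)) := Iff.rfl
theorem sset_iff {a : Mod U} : sset a ↔ AE (fun x => SetN U (x (-1)) (a.r x)) := Iff.rfl
theorem spair_r (a b : Mod U) : AE (fun x => (spair a b).r x = node (a.r x) (b.r x)) := Mod.r_mk
theorem spair_r_sh (k : ℤ) (a b : Mod U) :
    AE (fun x => (spair a b).r (sh k x) = node (a.r (sh k x)) (b.r (sh k x))) := Mod.r_mk_sh k

theorem smem_iff_sh (k : ℤ) {a b : Mod U} : smem a b ↔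
    AE (fun x => SetN U (x k) (b.r (sh (k + 1) x)) ∧ Mem (a.r (sh k x)) (b.r (sh (k + 1) x))) := by
  rw [smem_iff, ← AE_sh _ (k + 1)]
  · refine AE.congr (AE.of fun x => ?_)
    simp
  · exact ((FS.coord (-1)).comp2 b.fs (SetN U)).comp2 (((a.fs.shift (-1))).comp2 b.fs Mem) And

theorem sset_iff_sh (k : ℤ) {a : Mod U} : sset a ↔
    AE (fun x => SetN U (x k) (a.r (sh (k + 1) x))) := by
  rw [sset_iff, ← AE_sh _ (k + 1)]
  · refine AE.congr (AE.of fun x => ?_)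
    simp
  · exact ((FS.coord (-1)).comp2 a.fs (SetN U))

theorem smem_sset {a b : Mod U} (h : smem a b) : sset b := h.mono fun x hx => hx.1

/-- existence of internal sets -/
theorem exists_set (A : X → Set (Tree W)) (hA : FS A) (hT : ∀ x, A x ⊆ U.T (x (-1)))
    (hc : ∀ x, Coded (A x)) : ∃ a : Mod U, sset a ∧ (AE fun x => ∀ t, Mem t (a.r x) ↔ t ∈ A x) ∧
      ∀ b, smem b a ↔ AE (fun x => b.r (sh (-1) x) ∈ A x) := by
  have h1 : ∀ B : Set (Tree W), ∃ c, Coded B → Canon c ∧ ∀ x, Mem x c ↔ x ∈ B := by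
    intro B
    by_cases hB : Coded B
    · obtain ⟨c, hc⟩ := hB
      obtain ⟨y, hy, hy'⟩ := (wellFounded_lt (α := Tree W)).has_min {y | ∀ x, Mem x y ↔ x ∈ B} ⟨c, hc⟩
      exact ⟨y, fun _ => ⟨fun z hz h => hy' z (fun x => (h x).trans (hy x)) hz, hy⟩⟩
    · exact ⟨leaf U.bot, fun h => absurd h hB⟩
  choose F hF using h1
  have h2 : ∀ y : Tree W, ∀ n : ℕ, ∃ z, z ∈ U.T n ∧ (y ∈ U.T n → z = y) := by
    intro y n
    by_cases h : y ∈ U.T n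
    · exact ⟨y, h, fun _ => rfl⟩
    · exact ⟨leaf U.bot, U.leaf_bot_mem n, fun h' => absurd h' h⟩
  choose G hG hG' using h2
  obtain ⟨a, ha1, ha2⟩ := Mod.exists_mk (U := U) (fun x => G (F (A x)) (x 0)) ((hA.comp F).comp2 (FS.coord 0) G) (fun x => hG _ _)
  have ha : AE (fun x => SetN U (x (-1)) (a.r x) ∧ ∀ t, Mem t (a.r x) ↔ t ∈ A x) := by
    refine AE.mp2 ha1 (D_lt (-1)) fun x hx hlt => ?_
    obtain ⟨h3, h4⟩ := hF (A x) (hc x)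
    have h5 : F (A x) ∈ U.T (x (-1) + 1) := U.canon_mem h3 (fun t ht => hT x ((h4 t).1 ht))
    have h6 : F (A x) ∈ U.T (x 0) := U.T_mono (by simpa using hlt) h5
    rw [hx, hG' _ _ h6]
    exact ⟨⟨h3, fun t ht => hT x ((h4 t).1 ht)⟩, h4⟩
  refine ⟨a, ha.mono fun x hx => hx.1, ha.mono fun x hx => hx.2, fun b => ?_⟩
  rw [smem_iff]
  refine AE.congr (ha.mono fun x hx => ?_)
  rw [hx.2]
  exact and_iff_right hx.1

/-- weak extensionality -/
theorem sset_ext {a b : Mod U} (ha : sset a) (hb : sset b) (h : ∀ z, smem z a ↔ smem z b) : a = b := by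
  by_contra hne
  rw [Mod.eq_iff, ← AE_not] at hne
  have h1 : ∀ (p : Tree W × Tree W) (n : ℕ), ∃ z, z ∈ U.T n ∧
      ((∃ z, z ∈ U.T n ∧ ¬ (Mem z p.1 ↔ Mem z p.2)) → ¬ (Mem z p.1 ↔ Mem z p.2)) := by
    intro p n
    by_cases h : ∃ z, z ∈ U.T n ∧ ¬ (Mem z p.1 ↔ Mem z p.2)
    · obtain ⟨z, hz, hz'⟩ := h
      exact ⟨z, hz, fun _ => hz'⟩
    · exact ⟨leaf U.bot, U.leaf_bot_mem n, fun h' => absurd h' h⟩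
  choose F hF hF' using h1
  obtain ⟨z, hz1, hz2⟩ := Mod.exists_mk (U := U) (fun x => F (a.r (sh 1 x), b.r (sh 1 x)) (x 0))
    (((a.fs.shift 1).comp2 (b.fs.shift 1) Prod.mk).comp2 (FS.coord 0) F) (fun x => hF _ _)
  have hz := h z
  rw [smem_iff, smem_iff, ← AE_iff] at hz
  have hzr : AE (fun x => z.r (sh (-1) x) = F (a.r x, b.r x) (x (-1))) := by
    refine (hz2 (-1)).mono fun x hx => ?_
    rw [hx]; simp
  obtain ⟨x, ⟨hx1, hx2⟩, ⟨hx3, hx4⟩, hx5⟩ := ((ha.and hb).and ((hz.and hzr).and hne)).exists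
  rw [hx4] at hx3
  have h6 : Mem (F (a.r x, b.r x) (x (-1))) (a.r x) ↔ Mem (F (a.r x, b.r x) (x (-1))) (b.r x) := by
    tauto
  have h7 := hF' (a.r x, b.r x) (x (-1))
  by_cases h8 : ∃ z, z ∈ U.T (x (-1)) ∧ ¬ (Mem z (a.r x) ↔ Mem z (b.r x))
  · exact h7 h8 h6
  · push Not at h8
    refine hx5 (hx1.1.unique hx2.1 fun t => ?_)
    by_cases ht : t ∈ U.T (x (-1))
    · exact h8 t ht
    · exact ⟨fun h => absurd (hx1.2 t h) ht, fun h => absurd (hx2.2 t h) ht⟩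

theorem spair_inj {a b c d : Mod U} (h : spair a b = spair c d) : a = c ∧ b = d := by
  rw [Mod.eq_iff] at h
  rw [Mod.eq_iff, Mod.eq_iff, ← AE_and]
  refine (h.mp2 ((spair_r a b).and (spair_r c d)) fun x h1 h2 => ?_)
  rw [h2.1, h2.2] at h1
  simpa using h1

/-! ## Stratified Łoś theorem -/

/-- encoding of finite tuples -/
def envV (b : Tree W) : (n : ℕ) → (Fin n → Tree W) → Tree W
  | 0, _ => b
  | n + 1, w => node (w (Fin.last n)) (envV b n (fun i => w i.castSucc))

theorem exists_proj (b : Tree W) (n : ℕ) (i : Fin n) : ∃ g : Tree W → Tree W, IsTm g ∧ ∀ w, g (envV b n w) = w i := by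
  induction n with
  | zero => exact i.elim0
  | succ n ih =>
    induction i using Fin.lastCases with
    | last => exact ⟨Tree.fst, inferInstance, fun w => rfl⟩
    | cast i =>
      obtain ⟨g, hg, hg'⟩ := ih i
      obtain ⟨t, ht⟩ := hg.out
      exact ⟨fun e => g e.snd, ⟨t.subst (.snd .env), fun e => by rw [ht, Tm.eval_subst]; rfl⟩,
        fun w => hg' _⟩

theorem envV_mem {n : ℕ} {b : Tree W} (hb : b.rank < U.lam) {w : Fin n → Tree W} (hw : ∀ i, (w i).rank < U.lam) :
    (envV b n w).rank < U.lam := by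
  induction n with
  | zero => exact hb
  | succ n ih => exact rank_node_lt.2 ⟨hw _, ih fun i => hw _⟩

/-- the values -/
noncomputable def vals {n : ℕ} (σ : Fin n → ℕ) (v : Fin n → Mod U) (x : X) : Tree W :=
  envV (leaf U.bot) n (fun i => (v i).r (sh (σ i + 1) x))

/-- the parameters -/
def pars (U : Setup W) (K : ℕ) (x : X) : Tree W :=
  envV (leaf U.bot) K (fun i => leaf (U.kap (x (i : ℕ))))

/-- the environment -/
noncomputable def envE (K : ℕ) {n : ℕ} (σ : Fin n → ℕ) (v : Fin n → Mod U) (x : X) : Tree W :=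
  node (vals σ v x) (pars U K x)

theorem FS.tuple {n : ℕ} {α : Type*} {f : Fin n → X → α} (h : ∀ i, FS (f i)) : FS (fun x => fun i => f i x) := by
  choose a ha using h
  refine ⟨Finset.univ.sup a, fun x y hxy => funext fun i => ha i x y fun j hj => hxy j ?_⟩
  have : a i ≤ Finset.univ.sup a := Finset.le_sup (Finset.mem_univ i)
  simp only [Set.mem_Icc] at hj ⊢
  omega

theorem vals_fs {n : ℕ} (σ : Fin n → ℕ) (v : Fin n → Mod U) : FS (vals σ v) :=
  (FS.tuple (f := fun i x => (v i).r (sh (σ i + 1) x)) fun i => (v i).fs.shift _).comp (envV (leaf U.bot) n)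

theorem pars_fs (K : ℕ) : FS (pars U K) :=
  (FS.tuple (n := K) (f := fun i x => (leaf (U.kap (x (i : ℕ))) : Tree W)) fun i => (FS.coord _).comp (fun k => leaf (U.kap k))).comp
    (envV (leaf U.bot) K)

theorem envE_fs (K : ℕ) {n : ℕ} (σ : Fin n → ℕ) (v : Fin n → Mod U) : FS (envE K σ v) :=
  (vals_fs σ v).comp2 (pars_fs K) node

theorem leaf_bot_lam : (leaf U.bot : Tree W).rank < U.lam := U.rank_lam (U.leaf_bot_mem 0)

theorem pars_rank (K : ℕ) (x : X) : (pars U K x).rank < U.lam :=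
  envV_mem leaf_bot_lam fun i => U.lt_lam _

theorem envE_rank (K : ℕ) {n : ℕ} (σ : Fin n → ℕ) (v : Fin n → Mod U) (x : X) : (envE K σ v x).rank < U.lam :=
  rank_node_lt.2 ⟨envV_mem leaf_bot_lam fun i => U.rank_lam ((v i).mem_sh _ x), pars_rank K x⟩

theorem vals_snoc {n : ℕ} (σ : Fin n → ℕ) (v : Fin n → Mod U) (k : ℕ) (a : Mod U) (x : X) :
    vals (Fin.snoc σ k : Fin (n + 1) → ℕ) (Fin.snoc v a : Fin (n + 1) → Mod U) x = node (a.r (sh (k + 1) x)) (vals σ v x) := by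
  simp [vals, envV]

theorem exists_par {k K : ℕ} (h : k < K) : ∃ g : Tree W → Tree W, IsTm g ∧
    ∀ x, g (pars U K x) = leaf (U.kap (x k)) := by
  obtain ⟨g, hg, hg'⟩ := exists_proj (leaf U.bot) K ⟨k, h⟩
  exact ⟨g, hg, fun x => hg' _⟩

theorem IsTm.comp {g g' : Tree W → Tree W} (h : IsTm g) (h' : IsTm g') : IsTm (fun e => g (g' e)) := by
  obtain ⟨t, ht⟩ := h.out
  obtain ⟨t', ht'⟩ := h'.out
  exact ⟨t.subst t', fun e => by rw [ht, Tm.eval_subst, ht']⟩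

theorem los_term {n : ℕ} (σ : (Empty ⊕ Fin n) → ℕ) (t : LNFU.Term (Empty ⊕ Fin n)) (k : ℕ)
    (ht : termLevel σ t k) : ∃ g : Tree W → Tree W, IsTm g ∧ ∀ v : Fin n → Mod U,
      AE (fun x => (t.realize (Sum.elim default v)).r (sh (k + 1) x) = g (vals (fun i => σ (Sum.inr i)) v x)) := by
  induction t with
  | var i =>
    rcases i with i | i
    · exact i.elim
    · obtain ⟨g, hg, hg'⟩ := exists_proj (leaf U.bot) n i
      refine ⟨g, hg, fun v => AE.of fun x => ?_⟩
      have : σ (Sum.inr i) = k := ht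
      subst this
      rw [vals, hg']
      rfl
  | @func l f ts ih =>
    match l, f, ts, ih, ht with
    | _, NFUFunc.pair, ts, ih, ht =>
      obtain ⟨g0, hg0, hv0⟩ := ih 0 (ht 0)
      obtain ⟨g1, hg1, hv1⟩ := ih 1 (ht 1)
      refine ⟨fun e => .node (g0 e) (g1 e), inferInstance, fun v => ?_⟩
      refine (hv0 v).mp2 ((hv1 v).and (spair_r_sh (k + 1) ((ts 0).realize (Sum.elim default v))
        ((ts 1).realize (Sum.elim default v)))) fun x h1 h2 => ?_
      show (spair ((ts 0).realize (Sum.elim default v)) ((ts 1).realize (Sum.elim default v))).r _ = node (g0 _) (g1 _)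
      rw [← h1, ← h2.1, h2.2]

instance dfn_canon' (g : Tree W → Tree W) [hg : IsTm g] : Dfn U.lam (fun e => Canon (g e)) :=
  (Setup.dfn_canon U).comp g

/-- definable version of `SetN` -/
theorem setN_iff {n : ℕ} {y : Tree W} (hy : y.rank < U.lam) : SetN U n y ↔
    Canon y ∧ AllT U.lam (fun x => Mem x y → x < leaf (U.kap n)) := by
  unfold SetN
  refine and_congr_right fun _ => ⟨fun h x _ hx => U.mem_T_iff.1 (h x hx), fun h x hx => ?_⟩
  exact U.mem_T_iff.2 (h x (hx.rank_lt.trans hy) hx)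

theorem dfn_setN (g g' : Tree W → Tree W) [hg : IsTm g] [hg' : IsTm g'] :
    Dfn U.lam (fun e => Canon (g e) ∧ AllT U.lam (fun x => Mem x (g e) → x < g' e)) := by
  have := hg.comp (g' := Tree.snd) inferInstance
  have := hg'.comp (g' := Tree.snd) inferInstance
  infer_instance

theorem los {n : ℕ} (φ : LNFU.BoundedFormula Empty n) : ∀ (σ : (Empty ⊕ Fin n) → ℕ), stratifiedFrom σ φ →
    ∃ K0 : ℕ, ∀ K ≥ K0, ∃ P : Tree W → Prop, Dfn U.lam P ∧ ∀ v : Fin n → Mod U,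
      (φ.Realize default v ↔ AE (fun x => P (envE K (fun i => σ (Sum.inr i)) v x))) := by
  induction φ with
  | falsum =>
    intro σ _
    refine ⟨0, fun K _ => ⟨fun _ => False, inferInstance, fun v => ?_⟩⟩
    exact ⟨fun h => h.elim, fun h => h.exists.elim fun _ h => h⟩
  | equal t s =>
    rintro σ ⟨k, ht, hs⟩
    obtain ⟨g, hg, hv⟩ := los_term (U := U) σ t k ht
    obtain ⟨g', hg', hv'⟩ := los_term (U := U) σ s k hs
    have := hg.comp (g' := Tree.fst) inferInstance
    have := hg'.comp (g' := Tree.fst) inferInstance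
    refine ⟨0, fun K _ => ⟨fun e => g e.fst = g' e.fst, inferInstance, fun v => ?_⟩⟩
    rw [BoundedFormula.Realize, Mod.eq_iff_sh (k + 1)]
    refine AE.congr ((hv v).mp2 (hv' v) fun x h1 h2 => ?_)
    rw [h1, h2]
    rfl
  | @rel n l R ts =>
    intro σ hR
    match l, R, ts, hR with
    | _, NFURel.mem, ts, ⟨k, ht, hs⟩ =>
      obtain ⟨g, hg, hv⟩ := los_term (U := U) σ (ts 0) k ht
      obtain ⟨g', hg', hv'⟩ := los_term (U := U) σ (ts 1) (k + 1) hs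
      have := hg.comp (g' := Tree.fst) inferInstance
      have := hg'.comp (g' := Tree.fst) inferInstance
      refine ⟨k + 2, fun K hK => ?_⟩
      obtain ⟨p, hp, hpx⟩ := exists_par (U := U) (k := k + 1) (K := K) (by omega)
      have := hp.comp (g' := Tree.snd) inferInstance
      refine ⟨fun e => (Canon (g' e.fst) ∧ AllT U.lam (fun x => Mem x (g' e.fst) → x < p e.snd)) ∧
        Mem (g e.fst) (g' e.fst), ?_, fun v => ?_⟩
      · have := dfn_setN (U := U) (fun e => g' e.fst) (fun e => p e.snd)
        infer_instance
      have h0 : BoundedFormula.Realize (BoundedFormula.rel (NFURel.mem : LNFU.Relations 2) ts) default v ↔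
          smem ((ts 0).realize (Sum.elim default v)) ((ts 1).realize (Sum.elim default v)) := Iff.rfl
      refine h0.trans ?_
      rw [smem_iff_sh (k + 1)]
      refine AE.congr ((hv v).mp2 (hv' v) fun x h1 h2 => ?_)
      have h3 : ((k + 1 : ℕ) : ℤ) + 1 = (k : ℤ) + 1 + 1 := by push_cast; ring
      rw [h3] at h2
      have h4 : (g' (vals (fun i => σ (Sum.inr i)) v x)).rank < U.lam := by
        rw [← h2]; exact U.rank_lam (Mod.mem_sh _ _ _)
      simp only [envE, fst_node, snd_node, hpx]
      rw [h1, h2, setN_iff h4]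
      push_cast
      rfl
    | _, NFURel.isSet, ts, ⟨k, ht⟩ =>
      obtain ⟨g, hg, hv⟩ := los_term (U := U) σ (ts 0) k ht
      have := hg.comp (g' := Tree.fst) inferInstance
      refine ⟨k + 2, fun K hK => ?_⟩
      obtain ⟨p, hp, hpx⟩ := exists_par (U := U) (k := k) (K := K) (by omega)
      have := hp.comp (g' := Tree.snd) inferInstance
      refine ⟨fun e => (Canon (g e.fst) ∧ AllT U.lam (fun x => Mem x (g e.fst) → x < p e.snd)), ?_, fun v => ?_⟩
      · exact dfn_setN (U := U) (fun e => g e.fst) (fun e => p e.snd)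
      have h0 : BoundedFormula.Realize (BoundedFormula.rel (NFURel.isSet : LNFU.Relations 1) ts) default v ↔
          sset ((ts 0).realize (Sum.elim default v)) := Iff.rfl
      refine h0.trans ?_
      rw [sset_iff_sh k]
      refine AE.congr ((hv v).mono fun x h2 => ?_)
      have h4 : (g (vals (fun i => σ (Sum.inr i)) v x)).rank < U.lam := by
        rw [← h2]; exact U.rank_lam (Mod.mem_sh _ _ _)
      simp only [envE, fst_node, snd_node, hpx]
      rw [h2, setN_iff h4]
  | imp f g ih1 ih2 =>
    rintro σ ⟨h1, h2⟩
    obtain ⟨K1, hK1⟩ := ih1 σ h1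
    obtain ⟨K2, hK2⟩ := ih2 σ h2
    refine ⟨max K1 K2, fun K hK => ?_⟩
    obtain ⟨P, hP, hPv⟩ := hK1 K (by omega)
    obtain ⟨Q, hQ, hQv⟩ := hK2 K (by omega)
    refine ⟨fun e => P e → Q e, inferInstance, fun v => ?_⟩
    rw [AE_imp, ← hPv, ← hQv]
    rfl
  | @all n f ih =>
    rintro σ ⟨k, hk⟩
    obtain ⟨K1, hK1⟩ := ih _ hk
    refine ⟨max K1 (k + 2), fun K hK => ?_⟩
    obtain ⟨P, hP, hPv⟩ := hK1 K (by omega)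
    obtain ⟨p, hp, hpx⟩ := exists_par (U := U) (k := k + 1) (K := K) (by omega)
    have hPv : ∀ (v : Fin n → Mod U) (a : Mod U), (f.Realize default (Fin.snoc v a) ↔
        AE (fun x => P (node (node (a.r (sh (k + 1) x)) (vals (fun i => σ (Sum.inr i)) v x)) (pars U K x)))) := by
      intro v a
      rw [hPv]
      have : ∀ x, envE K (Fin.snoc (fun i => σ (Sum.inr i)) k) (Fin.snoc v a) x =
        node (node (a.r (sh (k + 1) x)) (vals (fun i => σ (Sum.inr i)) v x)) (pars U K x) := by
        intro x; rw [envE, vals_snoc]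
      simp only [Sum.elim_inr]
      simp only [this]
    have hD : Dfn U.lam (fun e => AllT U.lam (fun y => y < p e.snd → P (.node (.node y e.fst) e.snd))) := by
      have := hP.comp (fun e => .node (.node e.fst e.snd.fst) e.snd.snd)
      have := hp.comp (g' := fun e => e.snd.snd) inferInstance
      infer_instance
    refine ⟨_, hD, fun v => ?_⟩
    rw [BoundedFormula.Realize]
    simp only [hPv, envE, fst_node, snd_node, hpx, Nat.cast_add, Nat.cast_one]
    constructor
    · intro h
      by_contra hcon
      rw [← AE_not] at hcon
      have h1 : ∀ (e : Tree W × Tree W) (m : ℕ), ∃ y, y ∈ U.T m ∧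
          ((∃ y, y ∈ U.T m ∧ ¬ P (node (node y e.1) e.2)) → ¬ P (node (node y e.1) e.2)) := by
        intro e m
        by_cases h : ∃ y, y ∈ U.T m ∧ ¬ P (node (node y e.1) e.2)
        · obtain ⟨y, hy, hy'⟩ := h
          exact ⟨y, hy, fun _ => hy'⟩
        · exact ⟨leaf U.bot, U.leaf_bot_mem m, fun h' => absurd h' h⟩
      choose F hF hF' using h1
      obtain ⟨a, ha1, ha2⟩ := Mod.exists_mk (U := U) (fun x => F (vals (fun i => σ (Sum.inr i)) v (sh (-(k + 1)) x), pars U K (sh (-(k + 1)) x)) (x 0))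
        ((((vals_fs _ v).shift _).comp2 ((pars_fs K).shift _) Prod.mk).comp2 (FS.coord 0) F) (fun x => hF _ _)
      have ha : AE (fun x => a.r (sh (k + 1) x) = F (vals (fun i => σ (Sum.inr i)) v x, pars U K x) (x (k + 1))) := by
        refine (ha2 (k + 1)).mono fun x hx => ?_
        rw [hx]; simp
      obtain ⟨x, hx1, hx2, hx3⟩ := ((h a).and (ha.and hcon)).exists
      rw [hx2] at hx1
      apply hx3
      intro y hy hy'
      by_contra hn
      exact hF' (vals (fun i => σ (Sum.inr i)) v x, pars U K x) (x (k + 1)) ⟨y, U.mem_T_iff.2 hy', hn⟩ hx1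
    · intro h a
      refine h.mono fun x hx => ?_
      have := a.mem_sh (k + 1) x
      exact hx _ (U.rank_lam this) (U.mem_T_iff.1 this)

/-- comprehension -/
theorem compr {m : ℕ} (φ : LNFU.BoundedFormula Empty (m + 1)) (σ : (Empty ⊕ Fin (m + 1)) → ℕ)
    (hσ : stratifiedFrom σ φ) (v : Fin m → Mod U) :
    ∃ y : Mod U, sset y ∧ ∀ a, smem a y ↔ φ.Realize default (Fin.snoc v a : Fin (m + 1) → Mod U) := by
  obtain ⟨K, hK⟩ := los (U := U) φ σ hσ
  obtain ⟨P, hP, hPv⟩ := hK K le_rfl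
  set σ' : Fin m → ℕ := fun i => σ (Sum.inr i.castSucc) with hσ'
  set s : ℕ := σ (Sum.inr (Fin.last m)) with hs
  have henv : ∀ a x, envE K (fun i => σ (Sum.inr i)) (Fin.snoc v a : Fin (m + 1) → Mod U) x =
      node (node (a.r (sh (s + 1) x)) (vals σ' v x)) (pars U K x) := by
    intro a x
    rw [envE, ← vals_snoc]
    congr 2
    funext i
    induction i using Fin.lastCases with
    | last => simp [hs]
    | cast i => simp [hσ']
  let A : X → Set (Tree W) := fun x => {t | t ∈ U.T (x (-1)) ∧
    P (node (node t (vals σ' v (sh (-(s + 2)) x))) (pars U K (sh (-(s + 2)) x)))}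
  obtain ⟨y, hy, -, hy'⟩ := exists_set (U := U) A
    ((FS.coord (-1)).comp3 ((vals_fs σ' v).shift (-(s + 2))) ((pars_fs K).shift (-(s + 2)))
      (fun n a b => {t | t ∈ U.T n ∧ P (node (node t a) b)}))
    (fun x t ht => ht.1) (fun x => by
      have hD := hP.comp (fun e => .node (.node e.fst e.snd.fst) e.snd.snd)
      refine U.coded_sub (n := x (-1)) (fun t ht => ht.1) _ (hP := hD)
        (node (vals σ' v (sh (-(s + 2)) x)) (pars U K (sh (-(s + 2)) x))) ?_ ?_
      · exact rank_node_lt.2 ⟨envV_mem leaf_bot_lam fun i => U.rank_lam ((v i).mem_sh _ _), pars_rank K _⟩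
      · intro t ht
        exact and_iff_right ht)
  refine ⟨y, hy, fun a => ?_⟩
  rw [hy', hPv]
  have hFS : FS (fun x => P (envE K (fun i => σ (Sum.inr i)) (Fin.snoc v a : Fin (m + 1) → Mod U) x)) :=
    (envE_fs _ _ _).comp P
  rw [← AE_sh hFS (-(s + 2))]
  refine AE.congr (AE.of fun x => ?_)
  have h1 : a.r (sh (-1) x) ∈ U.T (x (-1)) := a.mem_sh _ _
  rw [henv, sh_sh, show (s : ℤ) + 1 + -(s + 2) = -1 by ring]
  exact and_iff_right h1

end Base
end NFUweak

namespace NFUweak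
namespace Base
open Filter Function Tree

variable {W : Type} [LinearOrder W] [WellFoundedLT W] {U : Setup W}

section
variable {M : Type} [LNFU.Structure M]

theorem realize_mem {n : ℕ} (t s : LNFU.Term (Empty ⊕ Fin n)) (v : Fin n → M) :
    (memR.boundedFormula₂ t s).Realize default v ↔
      smem (t.realize (Sum.elim default v)) (s.realize (Sum.elim default v)) := by
  rw [BoundedFormula.realize_rel₂]; rfl

theorem realize_set {n : ℕ} (t : LNFU.Term (Empty ⊕ Fin n)) (v : Fin n → M) :
    (setR.boundedFormula₁ t).Realize default v ↔ sset (t.realize (Sum.elim default v)) := by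
  rw [BoundedFormula.realize_rel₁]; rfl

theorem realize_pair {n : ℕ} (t s : LNFU.Term (Empty ⊕ Fin n)) (v : Fin n → M) :
    (pairF.apply₂ t s).realize (Sum.elim default v) =
      spair (t.realize (Sum.elim default v)) (s.realize (Sum.elim default v)) := by
  rw [Term.realize_functions_apply₂]; rfl
end

theorem mod_model : (Mod U) ⊨ NFUmAC := by
  rw [Theory.model_iff]
  rintro φ ((rfl | rfl) | ⟨m, φ, ⟨σ, hσ⟩, rfl⟩)
  · unfold weakExtAx
    simp only [Sentence.Realize, Formula.Realize, BoundedFormula.realize_all, BoundedFormula.realize_imp,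
      BoundedFormula.realize_inf, BoundedFormula.realize_iff, BoundedFormula.realize_bdEqual]
    intro a b
    simp only [realize_mem, realize_set]
    rintro ⟨ha, hb⟩
    exact ⟨fun h z => by
      have h : a = b := h
      subst h; exact Iff.rfl, fun h => sset_ext ha hb h⟩
  · unfold pairingAx
    simp only [Sentence.Realize, Formula.Realize, BoundedFormula.realize_all, BoundedFormula.realize_imp,
      BoundedFormula.realize_inf, BoundedFormula.realize_iff, BoundedFormula.realize_bdEqual]
    intro a b c d
    simp only [realize_pair]
    intro h
    exact spair_inj h
  · unfold comprehensionAx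
    rw [Sentence.Realize, BoundedFormula.realize_alls]
    intro v
    obtain ⟨y, hy, hy'⟩ := compr φ σ hσ v
    rw [BoundedFormula.realize_ex]
    refine ⟨y, ?_⟩
    rw [BoundedFormula.realize_inf, BoundedFormula.realize_all]
    simp only [BoundedFormula.realize_iff, realize_mem, realize_set]
    have e1 : ∀ (w : Fin (m + 1) → Mod U), Term.realize (Sum.elim default w)
      (Term.var (Sum.inr ⟨m, by omega⟩) : LNFU.Term (Empty ⊕ Fin (m + 1))) = w (Fin.last m) := fun w => rfl
    refine ⟨?_, fun a => ?_⟩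
    · rw [e1]; simpa using hy
    · rw [BoundedFormula.realize_liftAt_one (by omega)]
      have h1 : (Fin.snoc (Fin.snoc v y : Fin (m + 1) → Mod U) a : Fin (m + 2) → Mod U) ∘
          (fun i : Fin (m + 1) => if (i : ℕ) < m then Fin.castSucc i else i.succ) = (Fin.snoc v a : Fin (m + 1) → Mod U) := by
        funext i
        induction i using Fin.lastCases with
        | last => simp [Fin.succ_last]
        | cast i =>
          simp
      rw [h1, ← hy' a]
      have e2 : Term.realize (Sum.elim default (Fin.snoc (Fin.snoc v y : Fin (m + 1) → Mod U) a : Fin (m + 2) → Mod U))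
        (Term.var (Sum.inr ⟨m + 1, by omega⟩) : LNFU.Term (Empty ⊕ Fin (m + 2))) = a := by
        have : (⟨m + 1, by omega⟩ : Fin (m + 2)) = Fin.last (m + 1) := rfl
        simp [this]
      have e3 : Term.realize (Sum.elim default (Fin.snoc (Fin.snoc v y : Fin (m + 1) → Mod U) a : Fin (m + 2) → Mod U))
        (Term.var (Sum.inr ⟨m, by omega⟩) : LNFU.Term (Empty ⊕ Fin (m + 2))) = y := by
        have : (⟨m, by omega⟩ : Fin (m + 2)) = (Fin.last m).castSucc := rfl
        simp [this]
      rw [e2, e3]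

/-! ## Named formulas -/

/-- terms with named variables carrying a level -/
inductive NT : Type
  | v (k i : ℕ)
  | p (a b : NT)

/-- formulas with named variables -/
inductive NFm : Type
  | mem (s t : NT)
  | st (s : NT)
  | eq (s t : NT)
  | not (f : NFm)
  | imp (f g : NFm)
  | and (f g : NFm)
  | iff (f g : NFm)
  | all (k i : ℕ) (f : NFm)
  | ex (k i : ℕ) (f : NFm)

/-- level of a term -/
def NT.lv : NT → ℕ → Bool
  | .v k _, n => k == n
  | .p a b, n => a.lv n && b.lv n

/-- leftmost level -/
def NT.l0 : NT → ℕ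
  | .v k _ => k
  | .p a _ => a.l0

/-- stratification check -/
def NFm.ok : NFm → Bool
  | .mem s t => s.lv s.l0 && t.lv (s.l0 + 1)
  | .st s => s.lv s.l0
  | .eq s t => s.lv s.l0 && t.lv s.l0
  | .not f => f.ok
  | .imp f g => f.ok && g.ok
  | .and f g => f.ok && g.ok
  | .iff f g => f.ok && g.ok
  | .all _ _ f => f.ok
  | .ex _ _ f => f.ok

/-- update of a valuation -/
def upd {M : Type} (ρ : ℕ → ℕ → M) (k i : ℕ) (a : M) : ℕ → ℕ → M :=
  fun k' i' => bif (k' == k && i' == i) then a else ρ k' i'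

section
variable {M : Type} [LNFU.Structure M]

/-- value of a term -/
def NT.val (ρ : ℕ → ℕ → M) : NT → M
  | .v k i => ρ k i
  | .p a b => spair (a.val ρ) (b.val ρ)

/-- truth of a formula -/
def NFm.tr : (ℕ → ℕ → M) → NFm → Prop
  | ρ, .mem s t => smem (s.val ρ) (t.val ρ)
  | ρ, .st s => sset (s.val ρ)
  | ρ, .eq s t => s.val ρ = t.val ρ
  | ρ, .not f => ¬ f.tr ρ
  | ρ, .imp f g => f.tr ρ → g.tr ρ
  | ρ, .and f g => f.tr ρ ∧ g.tr ρ
  | ρ, .iff f g => f.tr ρ ↔ g.tr ρ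
  | ρ, .all k i f => ∀ a, f.tr (upd ρ k i a)
  | ρ, .ex k i f => ∃ a, f.tr (upd ρ k i a)
end

/-- bound for variable names -/
def NT.bd : NT → ℕ → Prop
  | .v k i, N => k < N ∧ i < N
  | .p a b, N => a.bd N ∧ b.bd N

/-- bound for variable names -/
def NFm.bd : NFm → ℕ → Prop
  | .mem s t, N => s.bd N ∧ t.bd N
  | .st s, N => s.bd N
  | .eq s t, N => s.bd N ∧ t.bd N
  | .not f, N => f.bd N
  | .imp f g, N => f.bd N ∧ g.bd N
  | .and f g, N => f.bd N ∧ g.bd N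
  | .iff f g, N => f.bd N ∧ g.bd N
  | .all _ _ f, N => f.bd N
  | .ex _ _ f, N => f.bd N

theorem NT.bd_mono {N N' : ℕ} (h : N ≤ N') : ∀ {t : NT}, t.bd N → t.bd N'
  | .v k i, ht => ⟨ht.1.trans_le h, ht.2.trans_le h⟩
  | .p a b, ht => ⟨NT.bd_mono h ht.1, NT.bd_mono h ht.2⟩

theorem NFm.bd_mono {N N' : ℕ} (h : N ≤ N') {f : NFm} (hf : f.bd N) : f.bd N' := by
  induction f with
  | mem s t => exact ⟨NT.bd_mono h hf.1, NT.bd_mono h hf.2⟩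
  | st s => exact NT.bd_mono (t := s) h hf
  | eq s t => exact ⟨NT.bd_mono h hf.1, NT.bd_mono h hf.2⟩
  | not f ih => exact ih hf
  | imp f g ih1 ih2 => exact ⟨ih1 hf.1, ih2 hf.2⟩
  | and f g ih1 ih2 => exact ⟨ih1 hf.1, ih2 hf.2⟩
  | iff f g ih1 ih2 => exact ⟨ih1 hf.1, ih2 hf.2⟩
  | all k i f ih => exact ih hf
  | ex k i f ih => exact ih hf

theorem NT.exists_bd : ∀ t : NT, ∃ N, t.bd N
  | .v k i => ⟨max k i + 1, by constructor <;> omega⟩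
  | .p a b => by
    obtain ⟨N, h⟩ := NT.exists_bd a
    obtain ⟨N', h'⟩ := NT.exists_bd b
    exact ⟨max N N', NT.bd_mono (le_max_left _ _) h, NT.bd_mono (le_max_right _ _) h'⟩

theorem NFm.exists_bd (f : NFm) : ∃ N, f.bd N := by
  have two : ∀ {p q : ℕ → Prop}, (∀ {N N'}, N ≤ N' → p N → p N') → (∀ {N N'}, N ≤ N' → q N → q N') →
      (∃ N, p N) → (∃ N, q N) → ∃ N, p N ∧ q N := by
    rintro p q hp hq ⟨N, h⟩ ⟨N', h'⟩
    exact ⟨max N N', hp (le_max_left _ _) h, hq (le_max_right _ _) h'⟩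
  induction f with
  | mem s t => exact two (fun h => NT.bd_mono h) (fun h => NT.bd_mono h) s.exists_bd t.exists_bd
  | st s => exact s.exists_bd
  | eq s t => exact two (fun h => NT.bd_mono h) (fun h => NT.bd_mono h) s.exists_bd t.exists_bd
  | not f ih => exact ih
  | imp f g ih1 ih2 => exact two (fun h => NFm.bd_mono h) (fun h => NFm.bd_mono h) ih1 ih2
  | and f g ih1 ih2 => exact two (fun h => NFm.bd_mono h) (fun h => NFm.bd_mono h) ih1 ih2
  | iff f g ih1 ih2 => exact two (fun h => NFm.bd_mono h) (fun h => NFm.bd_mono h) ih1 ih2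
  | all k i f ih => exact ih
  | ex k i f ih => exact ih

/-- translation of terms -/
def NT.tm {n : ℕ} (c : ℕ → ℕ → Fin n) : NT → LNFU.Term (Empty ⊕ Fin n)
  | .v k i => Term.var (Sum.inr (c k i))
  | .p a b => pairF.apply₂ (a.tm c) (b.tm c)

/-- extended context -/
def cext {n : ℕ} (c : ℕ → ℕ → Fin n) (k i : ℕ) : ℕ → ℕ → Fin (n + 1) :=
  upd (fun k i => (c k i).castSucc) k i (Fin.last n)

/-- translation of formulas -/
def NFm.fm : NFm → {n : ℕ} → (c : ℕ → ℕ → Fin n) → LNFU.BoundedFormula Empty n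
  | .mem s t, _, c => memR.boundedFormula₂ (s.tm c) (t.tm c)
  | .st s, _, c => setR.boundedFormula₁ (s.tm c)
  | .eq s t, _, c => Term.bdEqual (s.tm c) (t.tm c)
  | .not f, _, c => ∼(f.fm c)
  | .imp f g, _, c => (f.fm c).imp (g.fm c)
  | .and f g, _, c => f.fm c ⊓ g.fm c
  | .iff f g, _, c => (f.fm c).iff (g.fm c)
  | .all k i f, _, c => ∀' (f.fm (cext c k i))
  | .ex k i f, _, c => ∃' (f.fm (cext c k i))

theorem NT.val_tm {M : Type} [LNFU.Structure M] {n : ℕ} (c : ℕ → ℕ → Fin n) (v : Fin n → M) : ∀ t : NT,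
    (t.tm c).realize (Sum.elim default v) = t.val (fun k i => v (c k i))
  | .v k i => rfl
  | .p a b => by
    rw [NT.tm, realize_pair, NT.val_tm c v a, NT.val_tm c v b]; rfl

theorem cext_snoc {M : Type} {n : ℕ} (c : ℕ → ℕ → Fin n) (k i : ℕ) (v : Fin n → M) (a : M) :
    (fun k' i' => (Fin.snoc v a : Fin (n + 1) → M) (cext c k i k' i')) = upd (fun k i => v (c k i)) k i a := by
  funext k' i'
  unfold cext upd
  cases (k' == k && i' == i) <;> simp

theorem NFm.tr_fm {M : Type} [LNFU.Structure M] (f : NFm) : ∀ {n : ℕ} (c : ℕ → ℕ → Fin n) (v : Fin n → M),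
    (f.fm c).Realize default v ↔ f.tr (fun k i => v (c k i)) := by
  induction f with
  | mem s t => intro n c v; rw [fm, realize_mem, NT.val_tm, NT.val_tm]; rfl
  | st s => intro n c v; rw [fm, realize_set, NT.val_tm]; rfl
  | eq s t => intro n c v; rw [fm, BoundedFormula.realize_bdEqual, NT.val_tm, NT.val_tm]; rfl
  | not f ih => intro n c v; rw [fm, BoundedFormula.realize_not, ih]; rfl
  | imp f g ih1 ih2 => intro n c v; rw [fm, BoundedFormula.realize_imp, ih1, ih2]; rfl
  | and f g ih1 ih2 => intro n c v; rw [fm, BoundedFormula.realize_inf, ih1, ih2]; rfl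
  | iff f g ih1 ih2 => intro n c v; rw [fm, BoundedFormula.realize_iff, ih1, ih2]; rfl
  | all k i f ih =>
    intro n c v
    rw [fm, BoundedFormula.realize_all]
    refine forall_congr' fun a => ?_
    rw [ih, cext_snoc]
  | ex k i f ih =>
    intro n c v
    rw [fm, BoundedFormula.realize_ex]
    refine exists_congr fun a => ?_
    rw [ih, cext_snoc]

theorem NT.lv_tm {n N : ℕ} (c : ℕ → ℕ → Fin n) (σ : (Empty ⊕ Fin n) → ℕ)
    (hc : ∀ k < N, ∀ i < N, σ (Sum.inr (c k i)) = k) : ∀ (t : NT), t.bd N → ∀ l, t.lv l = true → termLevel σ (t.tm c) l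
  | .v k i, hb, l, hl => by
    have : k = l := by simpa [NT.lv] using hl
    subst this
    exact hc k hb.1 i hb.2
  | .p a b, hb, l, hl => by
    simp only [NT.lv, Bool.and_eq_true] at hl
    intro i
    match i with
    | 0 => exact NT.lv_tm c σ hc a hb.1 l hl.1
    | 1 => exact NT.lv_tm c σ hc b hb.2 l hl.2

theorem cext_lev {n N : ℕ} {c : ℕ → ℕ → Fin n} {σ : (Empty ⊕ Fin n) → ℕ}
    (hc : ∀ k < N, ∀ i < N, σ (Sum.inr (c k i)) = k) (k i : ℕ) :
    ∀ k' < N, ∀ i' < N, (Sum.elim (fun e => σ (Sum.inl e)) (Fin.snoc (fun i => σ (Sum.inr i)) k) : (Empty ⊕ Fin (n + 1)) → ℕ)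
      (Sum.inr (cext c k i k' i')) = k' := by
  intro k' hk i' hi
  unfold cext upd
  cases h : (k' == k && i' == i)
  · simp [hc k' hk i' hi]
  · simp at h; simp [h.1]

theorem NFm.strat {N : ℕ} (f : NFm) (hb : f.bd N) (hok : f.ok = true) : ∀ {n : ℕ} (c : ℕ → ℕ → Fin n) (σ : (Empty ⊕ Fin n) → ℕ)
    (hc : ∀ k < N, ∀ i < N, σ (Sum.inr (c k i)) = k), stratifiedFrom σ (f.fm c) := by
  induction f with
  | mem s t =>
    intro n c σ hc
    simp only [ok, Bool.and_eq_true] at hok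
    exact ⟨s.l0, NT.lv_tm c σ hc s hb.1 _ hok.1, NT.lv_tm c σ hc t hb.2 _ hok.2⟩
  | st s =>
    intro n c σ hc
    exact ⟨s.l0, NT.lv_tm c σ hc s hb _ hok⟩
  | eq s t =>
    intro n c σ hc
    simp only [ok, Bool.and_eq_true] at hok
    exact ⟨s.l0, NT.lv_tm c σ hc s hb.1 _ hok.1, NT.lv_tm c σ hc t hb.2 _ hok.2⟩
  | not f ih =>
    intro n c σ hc
    exact ⟨ih hb hok c σ hc, trivial⟩
  | imp f g ih1 ih2 =>
    intro n c σ hc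
    simp only [ok, Bool.and_eq_true] at hok
    exact ⟨ih1 hb.1 hok.1 c σ hc, ih2 hb.2 hok.2 c σ hc⟩
  | and f g ih1 ih2 =>
    intro n c σ hc
    simp only [ok, Bool.and_eq_true] at hok
    exact ⟨⟨ih1 hb.1 hok.1 c σ hc, ⟨ih2 hb.2 hok.2 c σ hc, trivial⟩⟩, trivial⟩
  | iff f g ih1 ih2 =>
    intro n c σ hc
    simp only [ok, Bool.and_eq_true] at hok
    have a1 := ih1 hb.1 hok.1 c σ hc
    have a2 := ih2 hb.2 hok.2 c σ hc
    exact ⟨⟨⟨a1, a2⟩, ⟨⟨a2, a1⟩, trivial⟩⟩, trivial⟩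
  | all k i f ih =>
    intro n c σ hc
    exact ⟨k, ih hb hok _ _ (cext_lev hc k i)⟩
  | ex k i f ih =>
    intro n c σ hc
    exact ⟨⟨k, ih hb hok _ _ (cext_lev hc k i), trivial⟩, trivial⟩

/-- Comprehension for named formulas. -/
theorem NFm.compr (f : NFm) (hok : f.ok = true) (k i : ℕ) (ρ : ℕ → ℕ → Mod U) :
    ∃ y : Mod U, sset y ∧ ∀ a, smem a y ↔ f.tr (upd ρ k i a) := by
  obtain ⟨N0, hN0⟩ := f.exists_bd
  set N := N0 + 1 with hN
  have hb : f.bd N := NFm.bd_mono (by omega) hN0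
  have hlt : ∀ k i, (k % N) * N + i % N < N * N := by
    intro k i
    have h1 : k % N < N := Nat.mod_lt _ (by omega)
    have h2 : i % N < N := Nat.mod_lt _ (by omega)
    nlinarith
  let c : ℕ → ℕ → Fin (N * N) := fun k i => ⟨(k % N) * N + i % N, hlt k i⟩
  let σ : (Empty ⊕ Fin (N * N)) → ℕ := Sum.elim (fun _ => 0) (fun j => j / N)
  have hc : ∀ k < N, ∀ i < N, σ (Sum.inr (c k i)) = k := by
    intro k hk i hi
    show ((k % N) * N + i % N) / N = k
    rw [Nat.mod_eq_of_lt hk, Nat.mod_eq_of_lt hi, mul_comm, Nat.mul_add_div (by omega), Nat.div_eq_of_lt hi]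
    rfl
  have hs := NFm.strat f hb hok (cext c k i) _ (cext_lev hc k i)
  let v : Fin (N * N) → Mod U := fun j => ρ (j / N) (j % N)
  obtain ⟨y, hy, hy'⟩ := Base.compr _ _ hs v
  refine ⟨y, hy, fun a => ?_⟩
  rw [hy', NFm.tr_fm, cext_snoc]
  have key : ∀ (f : NFm), f.bd N → ∀ ρ1 ρ2 : ℕ → ℕ → Mod U, (∀ k < N, ∀ i < N, ρ1 k i = ρ2 k i) → (f.tr ρ1 ↔ f.tr ρ2) := by
    have ht : ∀ t : NT, t.bd N → ∀ ρ1 ρ2 : ℕ → ℕ → Mod U, (∀ k < N, ∀ i < N, ρ1 k i = ρ2 k i) → t.val ρ1 = t.val ρ2 := by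
      intro t
      induction t with
      | v k i => intro hb ρ1 ρ2 h; exact h k hb.1 i hb.2
      | p a b ih1 ih2 => intro hb ρ1 ρ2 h; simp only [NT.val, ih1 hb.1 ρ1 ρ2 h, ih2 hb.2 ρ1 ρ2 h]
    have hu : ∀ (k i : ℕ) (a : Mod U) (ρ1 ρ2 : ℕ → ℕ → Mod U), (∀ k < N, ∀ i < N, ρ1 k i = ρ2 k i) →
        (∀ k' < N, ∀ i' < N, upd ρ1 k i a k' i' = upd ρ2 k i a k' i') := by
      intro k i a ρ1 ρ2 h k' hk' i' hi'
      unfold upd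
      cases (k' == k && i' == i)
      · exact h k' hk' i' hi'
      · rfl
    intro f
    induction f with
    | mem s t => intro hb ρ1 ρ2 h; simp only [tr, ht s hb.1 ρ1 ρ2 h, ht t hb.2 ρ1 ρ2 h]
    | st s => intro hb ρ1 ρ2 h; simp only [tr, ht s hb ρ1 ρ2 h]
    | eq s t => intro hb ρ1 ρ2 h; simp only [tr, ht s hb.1 ρ1 ρ2 h, ht t hb.2 ρ1 ρ2 h]
    | not f ih => intro hb ρ1 ρ2 h; simp only [tr, ih hb ρ1 ρ2 h]
    | imp f g ih1 ih2 => intro hb ρ1 ρ2 h; simp only [tr, ih1 hb.1 ρ1 ρ2 h, ih2 hb.2 ρ1 ρ2 h]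
    | and f g ih1 ih2 => intro hb ρ1 ρ2 h; simp only [tr, ih1 hb.1 ρ1 ρ2 h, ih2 hb.2 ρ1 ρ2 h]
    | iff f g ih1 ih2 => intro hb ρ1 ρ2 h; simp only [tr, ih1 hb.1 ρ1 ρ2 h, ih2 hb.2 ρ1 ρ2 h]
    | all k i f ih => intro hb ρ1 ρ2 h; exact forall_congr' fun a => ih hb _ _ (hu k i a _ _ h)
    | ex k i f ih => intro hb ρ1 ρ2 h; exact exists_congr fun a => ih hb _ _ (hu k i a _ _ h)
  refine key f hb _ _ ?_
  intro k' hk' i' hi'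
  have : v (c k' i') = ρ k' i' := by
    show ρ (((k' % N) * N + i' % N) / N) (((k' % N) * N + i' % N) % N) = ρ k' i'
    rw [Nat.mod_eq_of_lt hk', Nat.mod_eq_of_lt hi', mul_comm, Nat.mul_add_div (by omega), Nat.div_eq_of_lt hi',
      Nat.mul_add_mod, Nat.mod_eq_of_lt hi']
    rfl
  unfold upd
  cases (k' == k && i' == i)
  · exact this
  · rfl

end Base
end NFUweak

namespace NFUweak
namespace Base
open Filter Function Tree

variable {W : Type} [LinearOrder W] [WellFoundedLT W] {U : Setup W}

/-! ## Extensions of internal sets -/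

/-- extension of an object -/
def ext (a : Mod U) (x : X) : Set (Tree W) := {t | SetN U (x (-1)) (a.r x) ∧ Mem t (a.r x)}

theorem ext_fs (a : Mod U) : FS (ext a) :=
  (FS.coord (-1)).comp2 a.fs (fun n y => ({t | SetN U n y ∧ Mem t y} : Set (Tree W)))

theorem ext_sub (a : Mod U) (x : X) : ext a x ⊆ U.T (x (-1)) := fun t ht => ht.1.2 t ht.2

theorem ext_coded (a : Mod U) (x : X) : Coded (ext a x) := by
  by_cases h : SetN U (x (-1)) (a.r x)
  · exact ⟨a.r x, fun t => ⟨fun ht => ⟨h, ht⟩, fun ht => ht.2⟩⟩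
  · exact U.coded_finite (ext_sub a x) (by
      have : ext a x = ∅ := Set.eq_empty_of_forall_notMem fun t ht => h ht.1
      rw [this]; exact Set.finite_empty)

theorem smem_ext {a b : Mod U} : smem b a ↔ AE (fun x => b.r (sh (-1) x) ∈ ext a x) := Iff.rfl

theorem exists_elt (k : ℤ) {A : X → Set (Tree W)} (hA : FS A) (hT : AE fun x => A x ⊆ U.T (x k))
    (h : AE fun x => (A x).Nonempty) : ∃ w : Mod U, AE (fun x => w.r (sh k x) ∈ A x) := by
  have h1 : ∀ (B : Set (Tree W)) (n : ℕ), ∃ z ∈ U.T n, (B ∩ U.T n).Nonempty → z ∈ B := by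
    intro B n
    by_cases h : (B ∩ U.T n).Nonempty
    · obtain ⟨z, hz, hz'⟩ := h
      exact ⟨z, hz', fun _ => hz⟩
    · exact ⟨leaf U.bot, U.leaf_bot_mem n, fun h' => absurd h' h⟩
  choose F hF hF' using h1
  obtain ⟨w, -, hw⟩ := Mod.exists_mk (U := U) (fun x => F (A (sh (-k) x)) (x 0))
    ((hA.shift (-k)).comp2 (FS.coord 0) F) (fun x => hF _ _)
  refine ⟨w, (hw k).mp2 (hT.and h) fun x hx h2 => ?_⟩
  rw [hx]
  simp only [sh_sh, neg_add_cancel, sh_zero, sh_apply, zero_add]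
  exact hF' _ _ (by rw [Set.inter_eq_left.2 h2.1]; exact h2.2)

theorem forall_elt (k : ℤ) {A : X → Set (Tree W)} (hA : FS A) (hT : AE fun x => A x ⊆ U.T (x k))
    {Q : X → Tree W → Prop} (hQ : FS Q)
    (h : ∀ w : Mod U, AE (fun x => w.r (sh k x) ∈ A x) → AE (fun x => Q x (w.r (sh k x)))) :
    AE (fun x => ∀ t ∈ A x, Q x t) := by
  by_contra hne
  rw [← AE_not] at hne
  obtain ⟨w, hw⟩ := exists_elt (U := U) k (A := fun x => {t | t ∈ A x ∧ ¬ Q x t})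
    (hA.comp2 hQ (fun A Q => {t | t ∈ A ∧ ¬ Q t})) (hT.mono fun x hx t ht => hx ht.1)
    (hne.mono fun x hx => by push Not at hx; obtain ⟨t, ht, ht'⟩ := hx; exact ⟨t, ht, ht'⟩)
  obtain ⟨x, hx, hx'⟩ := ((h w (hw.mono fun x hx => hx.1)).and hw).exists
  exact hx'.2 hx

theorem exists_set' {A : X → Set (Tree W)} (hA : FS A) (hT : AE fun x => A x ⊆ U.T (x (-1)))
    (hc : AE fun x => Coded (A x)) : ∃ a : Mod U, sset a ∧ AE (fun x => ext a x = A x) ∧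
      ∀ b, smem b a ↔ AE (fun x => b.r (sh (-1) x) ∈ A x) := by
  obtain ⟨a, h1, h2, -⟩ := exists_set (U := U) (fun x => {t | t ∈ A x ∧ A x ⊆ U.T (x (-1)) ∧ Coded (A x)})
    (hA.comp2 (FS.coord (-1)) (fun A n => {t | t ∈ A ∧ A ⊆ U.T n ∧ Coded A})) (fun x t ht => ht.2.1 ht.1)
    (fun x => by
      by_cases h : A x ⊆ U.T (x (-1)) ∧ Coded (A x)
      · simpa [h] using h.2
      · exact U.coded_finite (n := 0) (by simp [h]) (by simp [h]))
  have h3 : AE (fun x => ext a x = A x) := by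
    refine (h1.and h2).mp2 (hT.and hc) fun x hx hx' => ?_
    ext t
    have := hx.2 t
    constructor
    · intro ht; exact (this.1 ht.2).1
    · intro ht; exact ⟨hx.1, this.2 ⟨ht, hx'⟩⟩
  refine ⟨a, h1, h3, fun b => ?_⟩
  rw [smem_ext]
  exact AE.congr (h3.mono fun x hx => by rw [hx])

theorem ext_eq_of {a : Mod U} {A : X → Set (Tree W)} (hA : FS A) (hT : AE fun x => A x ⊆ U.T (x (-1)))
    (hc : AE fun x => Coded (A x)) (ha : sset a) (h : ∀ b, smem b a ↔ AE (fun x => b.r (sh (-1) x) ∈ A x)) :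
    AE (fun x => ext a x = A x) := by
  obtain ⟨a', h1, h2, h3⟩ := exists_set' (U := U) hA hT hc
  have : a = a' := sset_ext ha h1 fun z => (h z).trans (h3 z).symm
  subst this
  exact h2

theorem AE_shift {P : X → Prop} (h : AE P) (hP : FS P) (k : ℤ) : AE (fun x => P (sh k x)) := (AE_sh hP k).2 h

/-- internal equipollence from pointwise coded bijections -/
theorem equip_of_cbij {a b : Mod U} (h : AE fun x => CBij (ext a x) (ext b x)) : equipollent a b := by
  have h1 : ∀ A B : Set (Tree W), ∃ G : Set (Tree W), CBij A B → Coded G ∧ ∃ g, Set.BijOn g A B ∧ G = graph g A := by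
    intro A B
    by_cases h : CBij A B
    · obtain ⟨g, hg, hg'⟩ := h
      exact ⟨graph g A, fun _ => ⟨hg', g, hg, rfl⟩⟩
    · exact ⟨∅, fun h' => absurd h' h⟩
  choose G hG using h1
  have hsub : AE (fun x => G (ext a x) (ext b x) ⊆ U.T (x (-1))) := h.mono fun x hx => by
    obtain ⟨-, g, hg, hg'⟩ := hG _ _ hx
    rw [hg']
    rintro t ⟨s, hs, rfl⟩
    exact U.node_mem.2 ⟨ext_sub a x hs, ext_sub b x (hg.mapsTo hs)⟩
  obtain ⟨f, hf1, hf2, hf3⟩ := exists_set' (U := U) (A := fun x => G (ext a x) (ext b x))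
    ((ext_fs a).comp2 (ext_fs b) G) hsub (h.mono fun x hx => (hG _ _ hx).1)
  have hp : ∀ c d : Mod U, smem (spair c d) f ↔ AE (fun x => node (c.r (sh (-1) x)) (d.r (sh (-1) x)) ∈ G (ext a x) (ext b x)) := by
    intro c d
    rw [hf3]
    exact AE.congr ((spair_r_sh (-1) c d).mono fun x hx => by rw [hx])
  have hGfs : FS (fun x => G (ext a x) (ext b x)) := (ext_fs a).comp2 (ext_fs b) G
  refine ⟨f, ⟨⟨hf1, ?_, ?_, ?_⟩, ?_⟩, ?_⟩
  · intro p hpf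
    rw [hf3] at hpf
    have hs : FS (fun x => p.r (sh (-1) x)) := p.fs.shift (-1)
    obtain ⟨c, hc⟩ := exists_elt (U := U) (-1) (A := fun x => {t | ∃ s, p.r (sh (-1) x) = node t s})
      (hs.comp (fun q => {t | ∃ s, q = node t s}))
      (AE.of fun x t ⟨s, hs⟩ => by
        have := p.mem_sh (-1) x
        rw [hs] at this
        exact (U.node_mem.1 this).1)
      (h.mp2 hpf fun x hx hx' => by
        obtain ⟨-, g, hg, hg'⟩ := hG _ _ hx
        rw [hg'] at hx'
        obtain ⟨s, hs, hs'⟩ := hx'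
        exact ⟨s, g s, hs'⟩)
    obtain ⟨d, hd⟩ := exists_elt (U := U) (-1) (A := fun x => {s | p.r (sh (-1) x) = node (c.r (sh (-1) x)) s})
      (hs.comp2 (c.fs.shift (-1)) (fun q c => {s | q = node c s}))
      (AE.of fun x s hs => by
        have := p.mem_sh (-1) x
        rw [Set.mem_setOf_eq] at hs
        rw [hs] at this
        exact (U.node_mem.1 this).2)
      hc
    have hpe : p = spair c d := by
      rw [Mod.eq_iff_sh (-1)]
      refine hd.mp2 (spair_r_sh (-1) c d) fun x h1 h2 => ?_
      rw [h2]; exact h1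
    refine ⟨c, d, hpe, ?_, ?_⟩
    · rw [smem_ext]
      refine (h.and hd).mp2 hpf fun x hx hx' => ?_
      obtain ⟨-, g, hg, hg'⟩ := hG _ _ hx.1
      rw [hg', hx.2] at hx'
      obtain ⟨s, hs, hs'⟩ := hx'
      simp only [Tree.node.injEq] at hs'
      rw [hs'.1]; exact hs
    · rw [smem_ext]
      refine (h.and hd).mp2 hpf fun x hx hx' => ?_
      obtain ⟨-, g, hg, hg'⟩ := hG _ _ hx.1
      rw [hg', hx.2] at hx'
      obtain ⟨s, hs, hs'⟩ := hx'
      simp only [Tree.node.injEq] at hs'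
      rw [hs'.2]; exact hg.mapsTo hs
  · intro c hc
    rw [smem_ext] at hc
    obtain ⟨d, hd⟩ := exists_elt (U := U) (-1) (A := fun x => {s | node (c.r (sh (-1) x)) s ∈ G (ext a x) (ext b x)})
      ((c.fs.shift (-1)).comp2 hGfs (fun c G => {s | node c s ∈ G}))
      (hsub.mono fun x hx s hs => (U.node_mem.1 (hx hs)).2)
      (h.mp2 hc fun x hx hx' => by
        obtain ⟨-, g, hg, hg'⟩ := hG _ _ hx
        refine ⟨g (c.r (sh (-1) x)), ?_⟩
        show _ ∈ G _ _
        rw [hg']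
        exact ⟨_, hx', rfl⟩)
    exact ⟨d, (hp c d).2 hd⟩
  · intro c d d' hd hd'
    rw [hp] at hd hd'
    rw [Mod.eq_iff_sh (-1)]
    refine h.mp2 (hd.and hd') fun x hx hx' => ?_
    obtain ⟨-, g, hg, hg'⟩ := hG _ _ hx
    rw [hg'] at hx'
    obtain ⟨⟨s, hs, e⟩, ⟨s', hs', e'⟩⟩ := hx'
    simp only [Tree.node.injEq] at e e'
    rw [e.2, e'.2, ← e.1, ← e'.1]
  · intro c c' d hd hd'
    rw [hp] at hd hd'
    rw [Mod.eq_iff_sh (-1)]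
    refine h.mp2 (hd.and hd') fun x hx hx' => ?_
    obtain ⟨-, g, hg, hg'⟩ := hG _ _ hx
    rw [hg'] at hx'
    obtain ⟨⟨s, hs, e⟩, ⟨s', hs', e'⟩⟩ := hx'
    simp only [Tree.node.injEq] at e e'
    rw [e.1, e'.1]
    exact hg.injOn hs hs' (by rw [← e.2, ← e'.2])
  · intro d hd
    rw [smem_ext] at hd
    obtain ⟨c, hc⟩ := exists_elt (U := U) (-1) (A := fun x => {s | node s (d.r (sh (-1) x)) ∈ G (ext a x) (ext b x)})
      ((d.fs.shift (-1)).comp2 hGfs (fun c G => {s | node s c ∈ G}))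
      (hsub.mono fun x hx s hs => (U.node_mem.1 (hx hs)).1)
      (h.mp2 hd fun x hx hx' => by
        obtain ⟨-, g, hg, hg'⟩ := hG _ _ hx
        obtain ⟨s, hs, hs'⟩ := hg.surjOn hx'
        refine ⟨s, ?_⟩
        show _ ∈ G _ _
        rw [hg']
        exact ⟨s, hs, by rw [hs']⟩)
    exact ⟨c, (hp c d).2 hc⟩

end Base
end NFUweak

namespace NFUweak
namespace Base
open Filter Function Tree

variable {W : Type} [LinearOrder W] [WellFoundedLT W] {U : Setup W}

/-! ## Internal combinatorics via comprehension -/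

open NFm NT in
theorem equip_of_same {a b : Mod U} (h : ∀ w, smem w a ↔ smem w b) : equipollent a b := by
  obtain ⟨f, hf, hf'⟩ : ∃ f : Mod U, sset f ∧ ∀ p, smem p f ↔ ∃ c, smem c a ∧ p = spair c c :=
    NFm.compr (.ex 0 1 (.and (.mem (v 0 1) (v 1 0)) (.eq (v 0 0) (p (v 0 1) (v 0 1))))) rfl 0 0
      (upd (fun _ _ => a) 1 0 a)
  have hp : ∀ c d, smem (spair c d) f ↔ smem c a ∧ c = d := by
    intro c d
    rw [hf']
    constructor
    · rintro ⟨e, he, he'⟩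
      obtain ⟨rfl, rfl⟩ := spair_inj he'
      exact ⟨he, rfl⟩
    · rintro ⟨hc, rfl⟩
      exact ⟨c, hc, rfl⟩
  refine ⟨f, ⟨⟨hf, ?_, ?_, ?_⟩, ?_⟩, ?_⟩
  · intro q hq
    obtain ⟨c, hc, rfl⟩ := (hf' q).1 hq
    exact ⟨c, c, rfl, hc, (h c).1 hc⟩
  · intro c hc
    exact ⟨c, (hp c c).2 ⟨hc, rfl⟩⟩
  · intro c d d' h1 h2
    exact ((hp _ _).1 h1).2.symm.trans ((hp _ _).1 h2).2
  · intro c c' d h1 h2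
    exact ((hp _ _).1 h1).2.trans ((hp _ _).1 h2).2.symm
  · intro c hc
    exact ⟨c, (hp c c).2 ⟨(h c).2 hc, rfl⟩⟩

theorem equip_refl (a : Mod U) : equipollent a a := equip_of_same fun _ => Iff.rfl

open NFm NT in
theorem equip_symm {a b : Mod U} (h : equipollent a b) : equipollent b a := by
  obtain ⟨g, ⟨⟨hg, g1, g2, g3⟩, g4⟩, g5⟩ := h
  obtain ⟨f, hf, hf'⟩ : ∃ f : Mod U, sset f ∧ ∀ p, smem p f ↔ ∃ c d, p = spair d c ∧ smem (spair c d) g :=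
    NFm.compr (.ex 0 1 (.ex 0 2 (.and (.eq (v 0 0) (p (v 0 2) (v 0 1))) (.mem (p (v 0 1) (v 0 2)) (v 1 0))))) rfl 0 0
      (upd (fun _ _ => a) 1 0 g)
  have hp : ∀ c d, smem (spair c d) f ↔ smem (spair d c) g := by
    intro c d
    rw [hf']
    constructor
    · rintro ⟨e, e', he, he'⟩
      obtain ⟨rfl, rfl⟩ := spair_inj he
      exact he'
    · intro hc
      exact ⟨d, c, rfl, hc⟩
  refine ⟨f, ⟨⟨hf, ?_, ?_, ?_⟩, ?_⟩, ?_⟩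
  · intro q hq
    obtain ⟨c, d, rfl, hc⟩ := (hf' q).1 hq
    obtain ⟨c', d', e, h1, h2⟩ := g1 _ hc
    obtain ⟨rfl, rfl⟩ := spair_inj e
    exact ⟨d, c, rfl, h2, h1⟩
  · intro c hc
    obtain ⟨d, hd⟩ := g5 c hc
    exact ⟨d, (hp c d).2 hd⟩
  · intro c d d' h1 h2
    exact g4 _ _ _ ((hp _ _).1 h1) ((hp _ _).1 h2)
  · intro c c' d h1 h2
    exact g3 _ _ _ ((hp _ _).1 h1) ((hp _ _).1 h2)
  · intro c hc
    obtain ⟨d, hd⟩ := g2 c hc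
    exact ⟨d, (hp d c).2 hd⟩

open NFm NT in
theorem equip_trans {a b c : Mod U} (h : equipollent a b) (h' : equipollent b c) : equipollent a c := by
  obtain ⟨g, ⟨⟨hg, g1, g2, g3⟩, g4⟩, g5⟩ := h
  obtain ⟨k, ⟨⟨hk, k1, k2, k3⟩, k4⟩, k5⟩ := h'
  obtain ⟨f, hf, hf'⟩ : ∃ f : Mod U, sset f ∧ ∀ p, smem p f ↔ ∃ c d e, p = spair c e ∧ smem (spair c d) g ∧ smem (spair d e) k :=
    NFm.compr (.ex 0 1 (.ex 0 2 (.ex 0 3 (.and (.eq (v 0 0) (p (v 0 1) (v 0 3))) (.and (.mem (p (v 0 1) (v 0 2)) (v 1 0))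
      (.mem (p (v 0 2) (v 0 3)) (v 1 1))))))) rfl 0 0
      (upd (upd (fun _ _ => a) 1 0 g) 1 1 k)
  have hp : ∀ c e, smem (spair c e) f ↔ ∃ d, smem (spair c d) g ∧ smem (spair d e) k := by
    intro c d
    rw [hf']
    constructor
    · rintro ⟨e, e', e'', he, he'⟩
      obtain ⟨rfl, rfl⟩ := spair_inj he
      exact ⟨_, he'⟩
    · rintro ⟨e, hc⟩
      exact ⟨c, e, d, rfl, hc⟩
  refine ⟨f, ⟨⟨hf, ?_, ?_, ?_⟩, ?_⟩, ?_⟩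
  · intro q hq
    obtain ⟨c, d, e, rfl, hc, hd⟩ := (hf' q).1 hq
    obtain ⟨c', d', e1, h1, h2⟩ := g1 _ hc
    obtain ⟨c'', d'', e2, h3, h4⟩ := k1 _ hd
    obtain ⟨rfl, rfl⟩ := spair_inj e1
    obtain ⟨rfl, rfl⟩ := spair_inj e2
    exact ⟨c, e, rfl, h1, h4⟩
  · intro c hc
    obtain ⟨d, hd⟩ := g2 c hc
    obtain ⟨_, _, e1, h1, h2⟩ := g1 _ hd
    obtain ⟨rfl, rfl⟩ := spair_inj e1
    obtain ⟨e, he⟩ := k2 d h2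
    exact ⟨e, (hp _ _).2 ⟨d, hd, he⟩⟩
  · intro c e e' h1 h2
    obtain ⟨d, h3, h4⟩ := (hp _ _).1 h1
    obtain ⟨d', h5, h6⟩ := (hp _ _).1 h2
    have := g3 _ _ _ h3 h5
    subst this
    exact k3 _ _ _ h4 h6
  · intro c e e' h1 h2
    obtain ⟨d, h3, h4⟩ := (hp _ _).1 h1
    obtain ⟨d', h5, h6⟩ := (hp _ _).1 h2
    have := k4 _ _ _ h4 h6
    subst this
    exact g4 _ _ _ h3 h5
  · intro e he
    obtain ⟨d, hd⟩ := k5 e he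
    obtain ⟨_, _, e1, h1, h2⟩ := k1 _ hd
    obtain ⟨rfl, rfl⟩ := spair_inj e1
    obtain ⟨c, hc⟩ := g5 d h1
    exact ⟨c, (hp _ _).2 ⟨d, hc, hd⟩⟩

open NFm NT in
/-- restriction of a bijection -/
theorem equip_restrict {y y' d d' z z' g : Mod U} (h : isBijFunc g y y') (hz : smem (spair z z') g)
    (hd : ∀ w, smem w d ↔ smem w y ∧ w ≠ z) (hd' : ∀ w, smem w d' ↔ smem w y' ∧ w ≠ z') : equipollent d d' := by
  obtain ⟨⟨⟨hg, g1, g2, g3⟩, g4⟩, g5⟩ := h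
  obtain ⟨f, hf, hp⟩ : ∃ f : Mod U, sset f ∧ ∀ p, smem p f ↔ smem p g ∧ ¬ p = spair z z' :=
    NFm.compr (.and (.mem (v 0 0) (v 1 0)) (.not (.eq (v 0 0) (p (v 0 1) (v 0 2))))) rfl 0 0
      (upd (upd (upd (fun _ _ => y) 1 0 g) 0 1 z) 0 2 z')
  refine ⟨f, ⟨⟨hf, ?_, ?_, ?_⟩, ?_⟩, ?_⟩
  · intro q hq
    obtain ⟨hq1, hq2⟩ := (hp q).1 hq
    obtain ⟨a, b, rfl, h1, h2⟩ := g1 _ hq1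
    refine ⟨a, b, rfl, (hd _).2 ⟨h1, ?_⟩, (hd' _).2 ⟨h2, ?_⟩⟩
    · rintro rfl
      exact hq2 (by rw [g3 _ _ _ hq1 hz])
    · rintro rfl
      exact hq2 (by rw [g4 _ _ _ hq1 hz])
  · intro a ha
    obtain ⟨h1, h2⟩ := (hd a).1 ha
    obtain ⟨b, hb⟩ := g2 a h1
    exact ⟨b, (hp _).2 ⟨hb, fun e => h2 (spair_inj e).1⟩⟩
  · intro a b b' h1 h2
    exact g3 _ _ _ ((hp _).1 h1).1 ((hp _).1 h2).1
  · intro a b b' h1 h2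
    exact g4 _ _ _ ((hp _).1 h1).1 ((hp _).1 h2).1
  · intro b hb
    obtain ⟨h1, h2⟩ := (hd' b).1 hb
    obtain ⟨a, ha⟩ := g5 b h1
    exact ⟨a, (hp _).2 ⟨ha, fun e => h2 (spair_inj e).2⟩⟩

open NFm NT in
/-- extension of a bijection -/
theorem equip_extend {y y' d d' z z' : Mod U} (h : equipollent d d') (hz : smem z y) (hz' : smem z' y')
    (hd : ∀ w, smem w d ↔ smem w y ∧ w ≠ z) (hd' : ∀ w, smem w d' ↔ smem w y' ∧ w ≠ z') : equipollent y y' := by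
  obtain ⟨g, ⟨⟨hg, g1, g2, g3⟩, g4⟩, g5⟩ := h
  obtain ⟨f, hf, hp⟩ : ∃ f : Mod U, sset f ∧ ∀ p, smem p f ↔ (¬ smem p g → p = spair z z') :=
    NFm.compr (.imp (.not (.mem (v 0 0) (v 1 0))) (.eq (v 0 0) (p (v 0 1) (v 0 2)))) rfl 0 0
      (upd (upd (upd (fun _ _ => y) 1 0 g) 0 1 z) 0 2 z')
  have hp : ∀ p, smem p f ↔ (smem p g ∨ p = spair z z') := by
    intro p; rw [hp]; tauto
  have hpp : ∀ a b, smem (spair a b) f ↔ (smem (spair a b) g ∨ (a = z ∧ b = z')) := by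
    intro a b
    rw [hp]
    refine or_congr_right ⟨fun h => spair_inj h, fun h => by rw [h.1, h.2]⟩
  have gz : ∀ a b, smem (spair a b) g → smem a y ∧ a ≠ z ∧ smem b y' ∧ b ≠ z' := by
    intro a b h
    obtain ⟨_, _, e1, h1, h2⟩ := g1 _ h
    obtain ⟨rfl, rfl⟩ := spair_inj e1
    exact ⟨((hd _).1 h1).1, ((hd _).1 h1).2, ((hd' _).1 h2).1, ((hd' _).1 h2).2⟩
  refine ⟨f, ⟨⟨hf, ?_, ?_, ?_⟩, ?_⟩, ?_⟩
  · intro q hq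
    rcases (hp q).1 hq with hq1 | rfl
    · obtain ⟨a, b, rfl, h1, h2⟩ := g1 _ hq1
      exact ⟨a, b, rfl, ((hd _).1 h1).1, ((hd' _).1 h2).1⟩
    · exact ⟨z, z', rfl, hz, hz'⟩
  · intro a ha
    by_cases h : a = z
    · exact ⟨z', (hpp _ _).2 (Or.inr ⟨h, rfl⟩)⟩
    · obtain ⟨b, hb⟩ := g2 a ((hd a).2 ⟨ha, h⟩)
      exact ⟨b, (hpp _ _).2 (Or.inl hb)⟩
  · intro a b b' h1 h2
    rcases (hpp _ _).1 h1 with h1 | h1 <;> rcases (hpp _ _).1 h2 with h2 | h2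
    · exact g3 _ _ _ h1 h2
    · exact absurd h2.1 (gz _ _ h1).2.1
    · exact absurd h1.1 (gz _ _ h2).2.1
    · exact h1.2.trans h2.2.symm
  · intro a b b' h1 h2
    rcases (hpp _ _).1 h1 with h1 | h1 <;> rcases (hpp _ _).1 h2 with h2 | h2
    · exact g4 _ _ _ h1 h2
    · exact absurd h2.2 (gz _ _ h1).2.2.2
    · exact absurd h1.2 (gz _ _ h2).2.2.2
    · exact h1.1.trans h2.1.symm
  · intro b hb
    by_cases h : b = z'
    · exact ⟨z, (hpp _ _).2 (Or.inr ⟨rfl, h⟩)⟩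
    · obtain ⟨a, ha⟩ := g5 b ((hd' b).2 ⟨hb, h⟩)
      exact ⟨a, (hpp _ _).2 (Or.inl ha)⟩

open NFm NT in
/-- the set of equipollent pairs -/
theorem exists_E (U : Setup W) : ∃ E : Mod U, ∀ a b, smem (spair a b) E ↔ equipollent a b := by
  obtain ⟨b0, -⟩ := Mod.exists_mk (U := U) (fun _ => leaf U.bot) (FS.const _) (fun x => U.leaf_bot_mem _)
  obtain ⟨E, -, hE⟩ : ∃ E : Mod U, sset E ∧ ∀ q, smem q E ↔ ∃ a b, q = spair a b ∧ ∃ f,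
      (((sset f ∧ (∀ p, smem p f → ∃ c d, p = spair c d ∧ smem c a ∧ smem d b) ∧
        (∀ c, smem c a → ∃ d, smem (spair c d) f) ∧
        (∀ c d d', smem (spair c d) f → smem (spair c d') f → d = d')) ∧
        (∀ c c' d, smem (spair c d) f → smem (spair c' d) f → c = c')) ∧
        (∀ d, smem d b → ∃ c, smem (spair c d) f)) :=
    NFm.compr (.ex 1 1 (.ex 1 2 (.and (.eq (v 1 0) (p (v 1 1) (v 1 2))) (.ex 1 3
      (.and (.and (.and (.st (v 1 3)) (.and
        (.all 0 0 (.imp (.mem (v 0 0) (v 1 3)) (.ex 0 1 (.ex 0 2 (.and (.eq (v 0 0) (p (v 0 1) (v 0 2)))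
          (.and (.mem (v 0 1) (v 1 1)) (.mem (v 0 2) (v 1 2))))))))
        (.and (.all 0 1 (.imp (.mem (v 0 1) (v 1 1)) (.ex 0 2 (.mem (p (v 0 1) (v 0 2)) (v 1 3)))))
          (.all 0 1 (.all 0 2 (.all 0 3 (.imp (.mem (p (v 0 1) (v 0 2)) (v 1 3))
            (.imp (.mem (p (v 0 1) (v 0 3)) (v 1 3)) (.eq (v 0 2) (v 0 3))))))))))
        (.all 0 1 (.all 0 2 (.all 0 3 (.imp (.mem (p (v 0 1) (v 0 3)) (v 1 3))
            (.imp (.mem (p (v 0 2) (v 0 3)) (v 1 3)) (.eq (v 0 1) (v 0 2))))))))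
        (.all 0 2 (.imp (.mem (v 0 2) (v 1 2)) (.ex 0 1 (.mem (p (v 0 1) (v 0 2)) (v 1 3))))))))))
      rfl 1 0 (fun _ _ => b0)
  refine ⟨E, fun a b => ?_⟩
  rw [hE]
  constructor
  · rintro ⟨a', b', e, h⟩
    obtain ⟨rfl, rfl⟩ := spair_inj e
    exact h
  · intro h
    exact ⟨a, b, rfl, h⟩

open NFm NT in
/-- the set of natural numbers -/
theorem exists_N (U : Setup W) : ∃ N : Mod U, ∀ n, smem n N ↔ isNat n := by
  obtain ⟨b0, -⟩ := Mod.exists_mk (U := U) (fun _ => leaf U.bot) (FS.const _) (fun x => U.leaf_bot_mem _)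
  obtain ⟨N, -, hN⟩ : ∃ N : Mod U, sset N ∧ ∀ n, smem n N ↔ ∀ I, (sset I ∧
      (∀ z, (sset z ∧ ∀ y, smem y z ↔ ∀ w, ¬ smem w y) → smem z I) ∧
      ∀ a b, smem a I → (sset b ∧ ∀ y, smem y b ↔ ∃ z, smem z y ∧ ∃ d, sset d ∧
        (∀ w, smem w d ↔ (smem w y ∧ ¬ w = z)) ∧ smem d a) → smem b I) → smem n I :=
    NFm.compr (.all 3 0 (.imp (.and (.st (v 3 0)) (.and
      (.all 2 1 (.imp (.and (.st (v 2 1)) (.all 1 0 (.iff (.mem (v 1 0) (v 2 1)) (.all 0 0 (.not (.mem (v 0 0) (v 1 0)))))))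
        (.mem (v 2 1) (v 3 0))))
      (.all 2 1 (.all 2 2 (.imp (.mem (v 2 1) (v 3 0)) (.imp (.and (.st (v 2 2)) (.all 1 0 (.iff (.mem (v 1 0) (v 2 2))
        (.ex 0 0 (.and (.mem (v 0 0) (v 1 0)) (.ex 1 1 (.and (.st (v 1 1)) (.and
          (.all 0 1 (.iff (.mem (v 0 1) (v 1 1)) (.and (.mem (v 0 1) (v 1 0)) (.not (.eq (v 0 1) (v 0 0))))))
          (.mem (v 1 1) (v 2 1))))))))))
        (.mem (v 2 2) (v 3 0))))))))
      (.mem (v 2 0) (v 3 0)))) rfl 2 0 (fun _ _ => b0)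
  exact ⟨N, hN⟩

open NFm NT in
theorem exists_card (X : Mod U) : ∃ c : Mod U, isCardOf c X := by
  obtain ⟨E, hE⟩ := exists_E U
  obtain ⟨c, hc, hc'⟩ : ∃ c : Mod U, sset c ∧ ∀ y, smem y c ↔ smem (spair y X) E :=
    NFm.compr (.mem (p (v 1 0) (v 1 1)) (v 2 0)) rfl 1 0 (upd (upd (fun _ _ => X) 1 1 X) 2 0 E)
  exact ⟨c, hc, fun y => (hc' y).trans (hE _ _)⟩

theorem isCardOf_unique {c c' X : Mod U} (h : isCardOf c X) (h' : isCardOf c' X) : c = c' :=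
  sset_ext h.1 h'.1 fun z => (h.2 z).trans (h'.2 z).symm

/-- closed under adjunction -/
def AdjClosed (J : Mod U) : Prop := (∀ y, (∀ w, ¬ smem w y) → smem y J) ∧
  ∀ Y Y' z, sset Y → sset Y' → smem z Y' → (∀ w, smem w Y ↔ smem w Y' ∧ w ≠ z) → smem Y J → smem Y' J

open NFm NT in
theorem nat_adj {J n X : Mod U} (hJ : AdjClosed J) (hn : isNat n) (hX : smem X n) : smem X J := by
  obtain ⟨I, hI, hI'⟩ : ∃ I : Mod U, sset I ∧ ∀ c, smem c I ↔ ∀ X, smem X c → smem X J :=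
    NFm.compr (.all 1 0 (.imp (.mem (v 1 0) (v 2 0)) (.mem (v 1 0) (v 2 1)))) rfl 2 0 (upd (fun _ _ => J) 2 1 J)
  refine (hI' n).1 (hn I ⟨hI, ?_, ?_⟩) X hX
  · intro z hz
    exact (hI' z).2 fun X hX => hJ.1 X ((hz.2 X).1 hX)
  · intro a b ha hb
    refine (hI' b).2 fun X hX => ?_
    obtain ⟨z, hz, d, hd, hd', hda⟩ := (hb.2 X).1 hX
    exact hJ.2 d X z hd (smem_sset hz) hz hd' ((hI' a).1 ha d hda)

open NFm NT in
theorem nat_equip {n X Y : Mod U} (hn : isNat n) (hX : smem X n) (hXY : equipollent X Y) : smem Y n := by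
  obtain ⟨E, hE⟩ := exists_E U
  obtain ⟨I, hI, hI'⟩ : ∃ I : Mod U, sset I ∧ ∀ c, smem c I ↔ ∀ y y', smem y c → smem (spair y y') E → smem y' c :=
    NFm.compr (.all 1 0 (.all 1 1 (.imp (.mem (v 1 0) (v 2 0)) (.imp (.mem (p (v 1 0) (v 1 1)) (v 2 1))
      (.mem (v 1 1) (v 2 0)))))) rfl 2 0 (upd (fun _ _ => E) 2 1 E)
  refine (hI' n).1 (hn I ⟨hI, ?_, ?_⟩) X Y hX ((hE _ _).2 hXY)
  · intro z hz
    refine (hI' z).2 fun y y' hy hyy' => ?_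
    rw [hE] at hyy'
    obtain ⟨g, ⟨⟨hg, g1, g2, g3⟩, g4⟩, g5⟩ := hyy'
    rw [hz.2] at hy ⊢
    intro w hw
    obtain ⟨w', hw'⟩ := g5 w hw
    obtain ⟨_, _, e1, h1, h2⟩ := g1 _ hw'
    obtain ⟨rfl, rfl⟩ := spair_inj e1
    exact hy _ h1
  · intro a b ha hb
    refine (hI' b).2 fun y y' hy hyy' => ?_
    rw [hE] at hyy'
    obtain ⟨g, hg⟩ := hyy'
    obtain ⟨z, hz, d, hd, hd', hda⟩ := (hb.2 y).1 hy
    obtain ⟨z', hz'⟩ := hg.1.1.2.2.1 z hz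
    obtain ⟨_, _, e1, h1, h2⟩ := hg.1.1.2.1 _ hz'
    obtain ⟨rfl, rfl⟩ := spair_inj e1
    obtain ⟨e, he, he'⟩ : ∃ e : Mod U, sset e ∧ ∀ w, smem w e ↔ smem w y' ∧ ¬ w = z' :=
      NFm.compr (.and (.mem (v 0 0) (v 1 0)) (.not (.eq (v 0 0) (v 0 1)))) rfl 0 0
        (upd (upd (fun _ _ => y) 1 0 y') 0 1 z')
    refine (hb.2 y').2 ⟨z', h2, e, he, he', ?_⟩
    exact (hI' a).1 ha d e hda ((hE _ _).2 (equip_restrict hg hz' hd' he'))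

theorem succ_card {Y Y' z c c' : Mod U} (hz : smem z Y') (h : ∀ w, smem w Y ↔ smem w Y' ∧ w ≠ z)
    (hc : isCardOf c Y) (hc' : isCardOf c' Y') : isSuccOf c' c := by
  refine ⟨hc'.1, fun y => ?_⟩
  rw [hc'.2]
  constructor
  · rintro ⟨g, hg⟩
    obtain ⟨z', hz'⟩ := hg.2 z hz
    obtain ⟨_, _, e1, h1, h2⟩ := hg.1.1.2.1 _ hz'
    obtain ⟨rfl, rfl⟩ := spair_inj e1
    obtain ⟨e, he, he'⟩ : ∃ e : Mod U, sset e ∧ ∀ w, smem w e ↔ smem w y ∧ ¬ w = z' :=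
      NFm.compr (.and (.mem (.v 0 0) (.v 1 0)) (.not (.eq (.v 0 0) (.v 0 1)))) rfl 0 0
        (upd (upd (fun _ _ => y) 1 0 y) 0 1 z')
    refine ⟨z', h1, e, he, he', ?_⟩
    rw [hc.2]
    exact equip_restrict hg hz' he' h
  · rintro ⟨z', hz', d, hd, hd', hdc⟩
    rw [hc.2] at hdc
    exact equip_extend hdc hz' hz hd' h

open NFm NT in
theorem isNat_of_adj {X c : Mod U} (h : ∀ J, AdjClosed J → smem X J) (hc : isCardOf c X) : isNat c := by
  intro I hI
  obtain ⟨E, hE⟩ := exists_E U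
  obtain ⟨J, hJ, hJ'⟩ : ∃ J : Mod U, sset J ∧ ∀ X, smem X J ↔ ∃ c, smem c I ∧ sset c ∧ ∀ y, smem y c ↔ smem (spair y X) E :=
    NFm.compr (.ex 2 0 (.and (.mem (v 2 0) (v 3 0)) (.and (.st (v 2 0)) (.all 1 1 (.iff (.mem (v 1 1) (v 2 0))
      (.mem (p (v 1 1) (v 1 0)) (v 2 1))))))) rfl 1 0 (upd (upd (fun _ _ => E) 2 1 E) 3 0 I)
  have hJ'' : ∀ X, smem X J ↔ ∃ c, smem c I ∧ isCardOf c X := by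
    intro X
    rw [hJ']
    refine exists_congr fun c => and_congr_right fun _ => and_congr_right fun _ => forall_congr' fun y => ?_
    rw [hE]
  suffices hadj : AdjClosed J by
    obtain ⟨c', h1, h2⟩ := (hJ'' X).1 (h J hadj)
    rw [isCardOf_unique hc h2]; exact h1
  refine ⟨fun y hy => ?_, fun Y Y' z hY hY' hz hw hYJ => ?_⟩
  · obtain ⟨c, hc⟩ := exists_card y
    refine (hJ'' y).2 ⟨c, hI.2.1 c ⟨hc.1, fun y' => ?_⟩, hc⟩
    rw [hc.2]
    constructor
    · rintro ⟨g, ⟨⟨hg, g1, g2, g3⟩, g4⟩, g5⟩ w hw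
      obtain ⟨w', hw'⟩ := g2 w hw
      obtain ⟨_, _, e1, h1, h2⟩ := g1 _ hw'
      obtain ⟨rfl, rfl⟩ := spair_inj e1
      exact hy _ h2
    · intro hy'
      exact equip_of_same fun w => ⟨fun h => absurd h (hy' w), fun h => absurd h (hy w)⟩
  · obtain ⟨c, hc, hc'⟩ := (hJ'' Y).1 hYJ
    obtain ⟨d, hd⟩ := exists_card Y'
    exact (hJ'' Y').2 ⟨d, hI.2.2 c d hc (succ_card hz hw hc' hd), hd⟩

end Base
end NFUweak

namespace NFUweak
namespace Base
open Filter Function Tree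

variable {W : Type} [LinearOrder W] [WellFoundedLT W] {U : Setup W}

/-! ## Finiteness, choice -/

/-- pointwise finiteness -/
def Fi (a : Mod U) : Prop := AE (fun x => (ext a x).Finite)

theorem ext_code {a : Mod U} {x : X} (h : SetN U (x (-1)) (a.r x)) {c : Tree W} (hc : Canon c)
    (h' : ∀ t, Mem t c ↔ t ∈ ext a x) : a.r x = c :=
  h.1.unique hc fun t => ⟨fun ht => (h' t).2 ⟨h, ht⟩, fun ht => ((h' t).1 ht).2⟩

theorem exists_step {α : Type*} {A : Set α} (hA : A.Finite) {H : Set α → Prop} (h0 : H ∅) (hn : ¬ H A) :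
    ∃ p : Set α × α, p.1 ⊆ A ∧ p.2 ∈ A ∧ p.2 ∉ p.1 ∧ H p.1 ∧ ¬ H (insert p.2 p.1) := by
  by_contra hne
  push Not at hne
  refine hn (Set.Finite.induction_on_subset A hA h0 ?_)
  intro a t ha ht hat hH
  exact hne (t, a) ht ha hat hH

theorem fi_adj {J Y : Mod U} (hJ : AdjClosed J) (hY : sset Y) (hf : Fi Y) : smem Y J := by
  by_contra hne
  -- membership of the code in `J`
  let H : X → Set (Tree W) → Prop := fun x B => ∃ c, Canon c ∧ (∀ t, Mem t c ↔ t ∈ B) ∧ c ∈ ext J (sh 1 x)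
  have hH : FS H := ((ext_fs J).shift 1).comp (fun J B => ∃ c, Canon c ∧ (∀ t, Mem t c ↔ t ∈ B) ∧ c ∈ J)
  have key : ∀ Z : Mod U, sset Z → (smem Z J ↔ AE (fun x => H x (ext Z x))) := by
    intro Z hZ
    rw [smem_ext, ← AE_sh (((Z.fs.shift (-1))).comp2 (ext_fs J) (· ∈ ·)) 1]
    refine AE.congr ((sset_iff.1 hZ).mono fun x hx => ?_)
    simp only [sh_sh, neg_add_cancel, sh_zero]
    constructor
    · intro h
      exact ⟨Z.r x, hx.1, fun t => ⟨fun ht => ⟨hx, ht⟩, fun ht => ht.2⟩, h⟩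
    · rintro ⟨c, hc, hc', hcJ⟩
      rw [ext_code hx hc hc']; exact hcJ
  rw [key Y hY, ← AE_not] at hne
  have h0 : AE (fun x => H x ∅) := by
    obtain ⟨e, he, he', he''⟩ := exists_set' (U := U) (A := fun _ => ∅) (FS.const _) (AE.of fun x => by simp)
      (AE.of fun x => U.coded_finite (n := 0) (by simp) (by simp))
    have : smem e J := hJ.1 e fun w hw => by
      rw [he''] at hw
      exact hw.exists.elim fun x hx => hx
    rw [key e he] at this
    exact this.mp2 he' fun x h1 h2 => by rw [← h2]; exact h1
  have h1 : ∀ (A : Set (Tree W)) (H : Set (Tree W) → Prop), ∃ p : Set (Tree W) × Tree W,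
      A.Finite → H ∅ → ¬ H A → p.1 ⊆ A ∧ p.2 ∈ A ∧ p.2 ∉ p.1 ∧ H p.1 ∧ ¬ H (insert p.2 p.1) := by
    intro A H
    by_cases h : A.Finite ∧ H ∅ ∧ ¬ H A
    · obtain ⟨p, hp⟩ := exists_step h.1 h.2.1 h.2.2
      exact ⟨p, fun _ _ _ => hp⟩
    · exact ⟨(∅, leaf U.bot), fun a b c => absurd ⟨a, b, c⟩ h⟩
  choose G hG using h1
  let g : X → Set (Tree W) × Tree W := fun x => G (ext Y x) (H x)
  have hg : FS g := (ext_fs Y).comp2 hH G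
  have hg' : AE (fun x => (g x).1 ⊆ ext Y x ∧ (g x).2 ∈ ext Y x ∧ (g x).2 ∉ (g x).1 ∧ H x (g x).1 ∧
      ¬ H x (insert (g x).2 (g x).1)) := (hf.and h0).mp2 hne fun x h h' => hG _ _ h.1 h.2 h'
  obtain ⟨Z, hZ, hZe, hZm⟩ := exists_set' (U := U) (A := fun x => (g x).1) (hg.comp Prod.fst)
    (hg'.mono fun x hx => hx.1.trans (ext_sub Y x))
    (hg'.mp2 hf fun x hx hx' => U.coded_finite (hx.1.trans (ext_sub Y x)) (hx'.subset hx.1))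
  obtain ⟨Z', hZ', hZe', hZm'⟩ := exists_set' (U := U) (A := fun x => insert (g x).2 (g x).1)
    (hg.comp (fun p => insert p.2 p.1))
    (hg'.mono fun x hx => Set.insert_subset (ext_sub Y x hx.2.1) (hx.1.trans (ext_sub Y x)))
    (hg'.mp2 hf fun x hx hx' => U.coded_finite (Set.insert_subset (ext_sub Y x hx.2.1) (hx.1.trans (ext_sub Y x)))
      ((hx'.subset hx.1).insert _))
  obtain ⟨z, hz⟩ := exists_elt (U := U) (-1) (A := fun x => {(g x).2}) (hg.comp (fun p => {p.2}))
    (hg'.mono fun x hx => by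
      rintro t rfl
      exact ext_sub Y x hx.2.1) (AE.of fun x => Set.singleton_nonempty _)
  have hZJ : smem Z J := (key Z hZ).2 (hg'.mp2 hZe fun x h h' => by rw [h']; exact h.2.2.2.1)
  have hZJ' : ¬ smem Z' J := by
    rw [key Z' hZ', ← AE_not]
    exact hg'.mp2 hZe' fun x h h' => by rw [h']; exact h.2.2.2.2
  refine hZJ' (hJ.2 Z Z' z hZ hZ' ?_ ?_ hZJ)
  · rw [hZm']
    exact hz.mono fun x hx => Or.inl hx
  · intro w
    rw [hZm, hZm', Ne, Mod.eq_iff_sh (-1), ← AE_not, ← AE_and]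
    refine AE.congr (hg'.mp2 hz fun x hx hx' => ?_)
    have hx' : z.r (sh (-1) x) = (g x).2 := hx'
    rw [hx', Set.mem_insert_iff]
    constructor
    · intro h
      exact ⟨Or.inr h, fun e => hx.2.2.1 (e ▸ h)⟩
    · rintro ⟨h | h, h'⟩
      · exact absurd h h'
      · exact h

theorem fi_nat {Y c : Mod U} (hY : sset Y) (hf : Fi Y) (hc : isCardOf c Y) : isNat c :=
  isNat_of_adj (fun J hJ => fi_adj hJ hY hf) hc

/-- the internal well-order -/
theorem exists_L (U : Setup W) : ∃ L : Mod U, ∀ a b, smem (spair a b) L ↔ AE (fun x => a.r (sh (-1) x) < b.r (sh (-1) x)) := by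
  obtain ⟨L, hL, hL', hL''⟩ := exists_set' (U := U) (A := fun x => {t | t ∈ U.T (x (-1)) ∧ ∃ a b, t = node a b ∧ a < b})
    ((FS.coord (-1)).comp (fun n => {t | t ∈ U.T n ∧ ∃ a b, t = node a b ∧ a < b})) (AE.of fun x t ht => ht.1)
    (AE.of fun x => U.coded_sub (n := x (-1)) (fun t ht => ht.1)
      (fun e => e.fst = node e.fst.fst e.fst.snd ∧ e.fst.fst < e.fst.snd) (leaf U.bot) leaf_bot_lam
      (fun t ht => by
        simp only [fst_node]
        constructor
        · rintro ⟨-, a, b, rfl, h⟩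
          exact ⟨rfl, h⟩
        · rintro ⟨h1, h2⟩
          exact ⟨ht, _, _, h1, h2⟩))
  refine ⟨L, fun a b => ?_⟩
  rw [hL'']
  refine AE.congr ((spair_r_sh (-1) a b).mono fun x hx => ?_)
  rw [hx]
  constructor
  · rintro ⟨-, c, d, e, h⟩
    simp only [Tree.node.injEq] at e
    rw [e.1, e.2]; exact h
  · intro h
    exact ⟨U.node_mem.2 ⟨a.mem_sh _ _, b.mem_sh _ _⟩, _, _, rfl, h⟩

theorem L_tri {L : Mod U} (hL : ∀ a b, smem (spair a b) L ↔ AE (fun x => a.r (sh (-1) x) < b.r (sh (-1) x))) {a b : Mod U}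
    (h1 : ¬ smem (spair a b) L) (h2 : ¬ smem (spair b a) L) : a = b := by
  rw [hL, ← AE_not] at h1 h2
  rw [Mod.eq_iff_sh (-1)]
  exact h1.mp2 h2 fun x h h' => le_antisymm (not_lt.1 h') (not_lt.1 h)

open NFm NT in
theorem mod_ac : acHolds (Mod U) := by
  intro Y hY h1 h2
  obtain ⟨L, hL⟩ := exists_L U
  obtain ⟨t, ht, ht'⟩ : ∃ t : Mod U, sset t ∧ ∀ z, smem z t ↔ ∃ y, smem y Y ∧ smem z y ∧ ∀ w, smem w y → ¬ smem (spair w z) L :=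
    NFm.compr (.ex 1 0 (.and (.mem (v 1 0) (v 2 0)) (.and (.mem (v 0 0) (v 1 0)) (.all 0 1 (.imp (.mem (v 0 1) (v 1 0))
      (.not (.mem (p (v 0 1) (v 0 0)) (v 1 1)))))))) rfl 0 0 (upd (upd (fun _ _ => Y) 2 0 Y) 1 1 L)
  refine ⟨t, ht, fun y hy => ?_⟩
  obtain ⟨-, z0, hz0⟩ := h1 y hy
  obtain ⟨z, hz⟩ := exists_elt (U := U) (-1) (A := fun x => {t | t ∈ ext y x ∧ ∀ s ∈ ext y x, ¬ s < t})
    ((ext_fs y).comp (fun y => {t | t ∈ y ∧ ∀ s ∈ y, ¬ s < t})) (AE.of fun x t ht => ext_sub y x ht.1)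
    ((smem_ext.1 hz0).mono fun x hx => (wellFounded_lt (α := Tree W)).has_min (ext y x) ⟨_, hx⟩)
  have hzy : smem z y := smem_ext.2 (hz.mono fun x hx => hx.1)
  have hzm : ∀ w, smem w y → ¬ smem (spair w z) L := by
    intro w hw
    rw [hL, ← AE_not]
    exact hz.mp2 (smem_ext.1 hw) fun x h h' => h.2 _ h'
  refine ⟨z, ⟨hzy, (ht' z).2 ⟨y, hy, hzy, hzm⟩⟩, ?_⟩
  rintro z' ⟨hzy1, hzt1⟩
  obtain ⟨y', hy', hzy2, hm⟩ := (ht' z').1 hzt1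
  have : y = y' := by
    by_contra hne
    exact h2 y y' hy hy' hne z' ⟨hzy1, hzy2⟩
  subst this
  exact L_tri hL (hzm z' hzy1) (hm z hzy)

open NFm NT in
theorem nat_fi {n Y : Mod U} (hn : isNat n) (hY : smem Y n) : Fi Y := by
  by_contra hne
  unfold Fi at hne
  rw [← AE_not] at hne
  have h1 : ∀ A : Set (Tree W), ∃ B : Set (Tree W), (∃ n, A ⊆ U.T n) → Coded A → A.Infinite →
      B ⊆ A ∧ B.Nonempty ∧ Coded B ∧ ∀ b ∈ B, ∃ b' ∈ B, b < b' := by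
    intro A
    by_cases h : (∃ n, A ⊆ U.T n) ∧ Coded A ∧ A.Infinite
    · obtain ⟨B, hB⟩ := U.exists_nomax h.1.choose_spec h.2.1 h.2.2
      exact ⟨B, fun _ _ _ => hB⟩
    · exact ⟨∅, fun a b c => absurd ⟨a, b, c⟩ h⟩
  choose G hG using h1
  have hG' : AE (fun x => G (ext Y x) ⊆ ext Y x ∧ (G (ext Y x)).Nonempty ∧ Coded (G (ext Y x)) ∧
      ∀ b ∈ G (ext Y x), ∃ b' ∈ G (ext Y x), b < b') :=
    hne.mono fun x hx => hG _ ⟨_, ext_sub Y x⟩ (ext_coded Y x) hx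
  have hGfs : FS (fun x => G (ext Y x)) := (ext_fs Y).comp G
  have hGT : AE (fun x => G (ext Y x) ⊆ U.T (x (-1))) := hG'.mono fun x hx => hx.1.trans (ext_sub Y x)
  obtain ⟨B, hB, -, hBm⟩ := exists_set' (U := U) (A := fun x => G (ext Y x)) hGfs hGT (hG'.mono fun x hx => hx.2.2.1)
  obtain ⟨L, hL⟩ := exists_L U
  obtain ⟨J, hJ, hJ'⟩ : ∃ J : Mod U, sset J ∧ ∀ Y, smem Y J ↔ ∃ b, smem b B ∧ ∀ w, smem w Y → smem w B → smem (spair w b) L :=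
    NFm.compr (.ex 0 0 (.and (.mem (v 0 0) (v 1 1)) (.all 0 1 (.imp (.mem (v 0 1) (v 1 0)) (.imp (.mem (v 0 1) (v 1 1))
      (.mem (p (v 0 1) (v 0 0)) (v 1 2))))))) rfl 1 0 (upd (upd (fun _ _ => Y) 1 1 B) 1 2 L)
  have hup : ∀ b, smem b B → ∃ b', smem b' B ∧ smem (spair b b') L := by
    intro b hb
    rw [hBm] at hb
    obtain ⟨b', hb'⟩ := exists_elt (U := U) (-1) (A := fun x => {t | t ∈ G (ext Y x) ∧ b.r (sh (-1) x) < t})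
      (hGfs.comp2 (b.fs.shift (-1)) (fun G b => {t | t ∈ G ∧ b < t})) (hGT.mono fun x hx t ht => hx ht.1)
      (hG'.mp2 hb fun x hx hx' => by
        obtain ⟨b', h1, h2⟩ := hx.2.2.2 _ hx'
        exact ⟨b', h1, h2⟩)
    exact ⟨b', (hBm _).2 (hb'.mono fun x hx => hx.1), (hL _ _).2 (hb'.mono fun x hx => hx.2)⟩
  have htr : ∀ a b c, smem (spair a b) L → smem (spair b c) L → smem (spair a c) L := by
    intro a b c h h'
    rw [hL] at *
    exact h.mp2 h' fun x h h' => h.trans h'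
  have hadj : AdjClosed J := by
    refine ⟨fun y hy => ?_, fun Z Z' z hZ hZ' hz hw hZJ => ?_⟩
    · obtain ⟨b, hb⟩ := exists_elt (U := U) (-1) hGfs hGT (hG'.mono fun x hx => hx.2.1)
      exact (hJ' y).2 ⟨b, (hBm b).2 hb, fun w hw => absurd hw (hy w)⟩
    · obtain ⟨b, hb, hb'⟩ := (hJ' Z).1 hZJ
      obtain ⟨b1, hb1, hbb1⟩ : ∃ b1, smem b1 B ∧ (smem (spair b b1) L ∨ b = b1) ∧ (smem z B → smem (spair z b1) L) := by
        by_cases hzB : smem z B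
        · by_cases hzb : smem (spair z b) L
          · exact ⟨b, hb, Or.inr rfl, fun _ => hzb⟩
          · obtain ⟨z', hz', hzz'⟩ := hup z hzB
            refine ⟨z', hz', Or.inl ?_, fun _ => hzz'⟩
            by_cases hbz : smem (spair b z) L
            · exact htr _ _ _ hbz hzz'
            · rw [L_tri hL hbz hzb]; exact hzz'
        · exact ⟨b, hb, Or.inr rfl, fun h => absurd h hzB⟩
      refine (hJ' Z').2 ⟨b1, hb1, fun w hwZ hwB => ?_⟩
      by_cases hwz : w = z
      · subst hwz; exact hbb1.2 hwB
      · have := hb' w ((hw w).2 ⟨hwZ, hwz⟩) hwB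
        rcases hbb1.1 with h | h
        · exact htr _ _ _ this h
        · rw [← h]; exact this
  obtain ⟨b, hb, hb'⟩ := (hJ' Y).1 (nat_adj hadj hn hY)
  have hbY : smem b Y := by
    rw [smem_ext]
    exact hG'.mp2 ((hBm b).1 hb) fun x hx hx' => hx.1 hx'
  have := hb' b hbY hb
  rw [hL] at this
  exact this.exists.elim fun x hx => lt_irrefl _ hx

end Base
end NFUweak

namespace NFUweak
namespace Base
open Filter Function Tree

variable {W : Type} [LinearOrder W] [WellFoundedLT W] {U : Setup W}

/-! ## The axiom of counting and the infinite cardinals -/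

theorem cbij_finite {n : ℕ} {A B : Set (Tree W)} (hA : A ⊆ U.T n) (hB : B ⊆ U.T n) (hAf : A.Finite) (hBf : B.Finite)
    (h : A.ncard = B.ncard) : CBij A B := by
  obtain ⟨g, hg⟩ : ∃ g : Tree W → Tree W, Set.BijOn g A B := by
    haveI : Nonempty (Tree W) := ⟨leaf U.bot⟩
    obtain ⟨g, hg⟩ := hAf.exists_bijOn_of_encard_eq (t := B) (by
      rw [← hAf.cast_ncard_eq, ← hBf.cast_ncard_eq, h])
    exact ⟨g, hg⟩
  refine ⟨g, hg, U.coded_finite (n := n) ?_ ?_⟩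
  · rintro t ⟨a, ha, rfl⟩
    exact U.node_mem.2 ⟨hA ha, hB (hg.mapsTo ha)⟩
  · refine (hAf.image fun a => node a (g a)).subset ?_
    rintro t ⟨a, ha, rfl⟩
    exact ⟨a, ha, rfl⟩

theorem singleton_ext {s u : Mod U} (h : isSingletonOf s u) : AE (fun x => ext s x = {u.r (sh (-1) x)}) := by
  refine ext_eq_of ((u.fs.shift (-1)).comp (fun t => ({t} : Set (Tree W)))) (AE.of fun x => ?_) (AE.of fun x => ?_) h.1 fun b => ?_
  · rintro t rfl; exact u.mem_sh _ _
  · exact U.coded_finite (n := x (-1)) (by rintro t rfl; exact u.mem_sh _ _) (Set.finite_singleton _)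
  · rw [h.2, Mod.eq_iff_sh (-1)]
    rfl

theorem mod_axCount : axCountGeqHolds (Mod U) := by
  rintro n hn t ⟨A, B, hA, hB, ht⟩
  have hfA : Fi A := nat_fi hn hA
  -- pointwise comparison
  have h1 : AE (fun x => ∀ s ∈ ext B x, ∃ u ∈ ext A (sh (-1) x), Canon s ∧ ∀ t, Mem t s ↔ t = u) := by
    refine forall_elt (-1) (ext_fs B) (AE.of fun x => ext_sub B x)
      (Q := fun x s => ∃ u ∈ ext A (sh (-1) x), Canon s ∧ ∀ t, Mem t s ↔ t = u)
      (((ext_fs A).shift (-1)).comp (fun A s => ∃ u ∈ A, Canon s ∧ ∀ t, Mem t s ↔ t = u)) ?_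
    intro w hw
    obtain ⟨u, hu, hwu⟩ := (hB.2 w).1 hw
    have h2 := AE_shift (singleton_ext hwu) ((ext_fs w).comp2 (u.fs.shift (-1)) (fun a b => a = {b})) (-1)
    have h3 := AE_shift (smem_ext.1 hu) ((u.fs.shift (-1)).comp2 (ext_fs A) (fun a b => a ∈ b)) (-1)
    have h4 := AE_shift (sset_iff.1 hwu.1) ((FS.coord (-1)).comp2 w.fs (SetN U)) (-1)
    refine (h2.and h3).mp2 h4 fun x hx hx' => ⟨_, hx.2, hx'.1, fun t => ?_⟩
    have : t ∈ ext w (sh (-1) x) ↔ t = u.r (sh (-1) (sh (-1) x)) := by rw [hx.1]; rfl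
    rw [← this]
    exact ⟨fun h => ⟨hx', h⟩, fun h => h.2⟩
  have hfA' : AE (fun x => (ext A (sh (-1) x)).Finite) := AE_shift hfA ((ext_fs A).comp Set.Finite) (-1)
  have h5 : AE (fun x => (ext B x).Finite ∧ (ext B x).ncard ≤ (ext A (sh (-1) x)).ncard) := by
    refine h1.mp2 hfA' fun x hx hx' => ?_
    choose! F hF hF' hF'' using hx
    have hinj : Set.InjOn F (ext B x) := by
      intro s hs s' hs' e
      refine (hF' s hs).unique (hF' s' hs') fun t => ?_
      rw [hF'' s hs, hF'' s' hs', e]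
    exact ⟨Set.Finite.of_finite_image (hx'.subset (Set.image_subset_iff.2 hF)) hinj,
      Set.ncard_le_ncard_of_injOn F hF hinj hx'⟩
  have h6 : AE (fun x => (ext A (sh (-1) x)).ncard ≤ (ext A x).ncard) := by
    have hfs : FS (fun x => (ext A x).ncard) := (ext_fs A).comp Set.ncard
    have h7 : AE (fun x => (ext A x).ncard ≤ (ext A (sh 1 x)).ncard) := D_descent hfs
    refine (AE_shift h7 (hfs.comp2 (hfs.shift 1) (· ≤ ·)) (-1)).mono fun x hx => ?_
    simpa using hx
  -- choose a subset
  have h8 : ∀ A B : Set (Tree W), ∃ C : Set (Tree W), A.Finite → B.ncard ≤ A.ncard → C ⊆ A ∧ C.ncard = B.ncard := by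
    intro A B
    by_cases h : A.Finite ∧ B.ncard ≤ A.ncard
    · obtain ⟨C, hC⟩ := Set.exists_subset_card_eq h.2
      exact ⟨C, fun _ _ => hC⟩
    · exact ⟨∅, fun a b => absurd ⟨a, b⟩ h⟩
  choose G hG using h8
  let g : X → Set (Tree W) := fun x => G (ext A x) (ext B x)
  have hg : FS g := (ext_fs A).comp2 (ext_fs B) G
  have hg' : AE (fun x => g x ⊆ ext A x ∧ (g x).ncard = (ext B x).ncard) :=
    (hfA.and h5).mp2 h6 fun x h h' => hG _ _ h.1 (h.2.2.trans h')
  obtain ⟨x0, hx0, hx0e, hx0m⟩ := exists_set' (U := U) hg (hg'.mono fun x hx => hx.1.trans (ext_sub A x))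
    (hg'.mp2 hfA fun x hx hx' => U.coded_finite (hx.1.trans (ext_sub A x)) (hx'.subset hx.1))
  obtain ⟨y0, hy0, hy0e, hy0m⟩ := exists_set' (U := U) (A := fun x => ext A x \ g x) ((ext_fs A).comp2 hg (· \ ·))
    (AE.of fun x => Set.diff_subset.trans (ext_sub A x))
    (hfA.mono fun x hx => U.coded_finite (Set.diff_subset.trans (ext_sub A x)) (hx.subset Set.diff_subset))
  obtain ⟨u, hu, hue, hum⟩ := exists_set' (U := U) (ext_fs A) (AE.of fun x => ext_sub A x) (AE.of fun x => ext_coded A x)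
  obtain ⟨k, hk⟩ := exists_card y0
  have hy0f : Fi y0 := hy0e.mp2 hfA fun x h h' => by rw [h]; exact h'.subset Set.diff_subset
  refine ⟨k, fi_nat hy0 hy0f hk, x0, y0, u, ?_, ?_, ?_, hu, ?_, ?_⟩
  · rw [ht.2]
    refine equip_of_cbij ((hx0e.and hg').mp2 (hfA.and h5) fun x h h' => ?_)
    rw [h.1]
    exact cbij_finite (h.2.1.trans (ext_sub A x)) (ext_sub B x) (h'.1.subset h.2.1) h'.2.1 h.2.2
  · rw [hk.2]; exact equip_refl _
  · rintro w ⟨h, h'⟩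
    rw [hx0m] at h
    rw [hy0m] at h'
    obtain ⟨x, h1, h2⟩ := (h.and h').exists
    exact h2.2 h1
  · intro w
    rw [hum, hx0m, hy0m, or_iff_not_imp_left, ← AE_not, ← AE_imp]
    refine AE.congr (hg'.mono fun x hx => ?_)
    constructor
    · intro h h'
      exact ⟨h, h'⟩
    · intro h
      by_cases h' : w.r (sh (-1) x) ∈ g x
      · exact hx.1 h'
      · exact (h h').1
  · exact nat_equip hn hA (equip_of_same fun w => by rw [hum, smem_ext])

/-- representatives of infinite cardinals -/
def ZZ (U : Setup W) (n : ℕ) : Set (Tree W) := {u | Canon u ∧ ∃ m ≤ n, ∀ t, Mem t u ↔ t ∈ U.T m}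

theorem ZZ_finite (n : ℕ) : (ZZ U n).Finite := by
  have h1 : ∀ m : ℕ, ∃ c : Tree W, Canon c ∧ ∀ t, Mem t c ↔ t ∈ U.T m := by
    intro m
    obtain ⟨c, h1, h2, h3⟩ := (U.coded_T m).code (U := U) (n := m) subset_rfl
    exact ⟨c, h1, h3⟩
  choose c hc hc' using h1
  refine ((Set.finite_Iic n).image c).subset ?_
  rintro u ⟨hu, m, hm, h⟩
  exact ⟨m, hm, (hc m).unique hu fun t => by rw [hc', h]⟩

theorem exists_rep {A : Mod U} (h : ¬ Fi A) : ∃ Y : Mod U, equipollent Y A ∧ AE (fun x => Y.r x ∈ ZZ U (x (-1))) := by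
  unfold Fi at h
  rw [← AE_not] at h
  have h1 : ∀ (A : Set (Tree W)) (n : ℕ), ∃ m : ℕ, A ⊆ U.T n → Coded A → A.Infinite → m ≤ n ∧ CBij A (U.T m) := by
    intro A n
    by_cases h : A ⊆ U.T n ∧ Coded A ∧ A.Infinite
    · obtain ⟨m, hm⟩ := U.exists_cbij h.1 h.2.1 h.2.2
      exact ⟨m, fun _ _ _ => hm⟩
    · exact ⟨0, fun a b c => absurd ⟨a, b, c⟩ h⟩
  choose G hG using h1
  have hG' : AE (fun x => G (ext A x) (x (-1)) ≤ x (-1) ∧ CBij (ext A x) (U.T (G (ext A x) (x (-1))))) :=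
    h.mono fun x hx => hG _ _ (ext_sub A x) (ext_coded A x) hx
  obtain ⟨Y, hY, hYe, -⟩ := exists_set' (U := U) (A := fun x => U.T (G (ext A x) (x (-1))))
    (((ext_fs A).comp2 (FS.coord (-1)) G).comp U.T) (hG'.mono fun x hx => U.T_mono hx.1)
    (AE.of fun x => U.coded_T _)
  refine ⟨Y, equip_symm (equip_of_cbij (hG'.mp2 hYe fun x h h' => by rw [h']; exact h.2)), ?_⟩
  refine (hG'.and hYe).mp2 (sset_iff.1 hY) fun x hx hx' => ⟨hx'.1, _, hx.1.1, fun t => ?_⟩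
  rw [← hx.2]
  exact ⟨fun h => ⟨hx', h⟩, fun h => h.2⟩

open NFm NT in
theorem mod_nci : NCIFinite (Mod U) := by
  obtain ⟨E, hE⟩ := exists_E U
  obtain ⟨N, hN⟩ := exists_N U
  obtain ⟨S, hS, hS'⟩ : ∃ S : Mod U, sset S ∧ ∀ c, smem c S ↔
      ((∃ A, sset A ∧ sset c ∧ ∀ y, smem y c ↔ smem (spair y A) E) ∧ ¬ smem c N) :=
    NFm.compr (.and (.ex 1 0 (.and (.st (v 1 0)) (.and (.st (v 2 0)) (.all 1 1 (.iff (.mem (v 1 1) (v 2 0))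
      (.mem (p (v 1 1) (v 1 0)) (v 2 1))))))) (.not (.mem (v 2 0) (v 3 0)))) rfl 2 0
      (upd (upd (fun _ _ => E) 2 1 E) 3 0 N)
  have hS'' : ∀ c, smem c S ↔ (isCardinal c ∧ ¬ isNat c) := by
    intro c
    rw [hS', hN]
    refine and_congr_left fun _ => exists_congr fun A => and_congr_right fun _ => and_congr_right fun _ =>
      forall_congr' fun y => ?_
    rw [hE]
  obtain ⟨c, hc⟩ := exists_card S
  refine ⟨S, c, hS, hS'', hc, fi_nat hS ?_ hc⟩
  have h1 : AE (fun x => ∀ c ∈ ext S x, ∃ u ∈ ZZ U (x (-3)), Mem u c) := by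
    refine forall_elt (-1) (ext_fs S) (AE.of fun x => ext_sub S x) (Q := fun x c => ∃ u ∈ ZZ U (x (-3)), Mem u c)
      ((FS.coord (-3)).comp (fun n c => ∃ u ∈ ZZ U n, Mem u c)) ?_
    intro c hc
    obtain ⟨⟨A, hA, hcA⟩, hcn⟩ := (hS'' c).1 hc
    have hnf : ¬ Fi A := fun h => hcn (fi_nat hA h hcA)
    obtain ⟨Y, hYA, hY⟩ := exists_rep hnf
    have hYc : smem Y c := (hcA.2 Y).2 hYA
    have h2 := AE_shift hY (Y.fs.comp2 ((FS.coord (-1)).comp (ZZ U)) (· ∈ ·)) (-2)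
    refine ((smem_iff_sh (-2)).1 hYc).mp2 h2 fun x h h' => ?_
    exact ⟨_, h', h.2⟩
  have h2 : AE (fun x => ∀ c ∈ ext S x, ∀ c' ∈ ext S x, ∀ u ∈ U.T (x (-2)), Mem u c → Mem u c' → c = c') := by
    refine forall_elt (-1) (ext_fs S) (AE.of fun x => ext_sub S x)
      (Q := fun x c => ∀ c' ∈ ext S x, ∀ u ∈ U.T (x (-2)), Mem u c → Mem u c' → c = c')
      ((ext_fs S).comp2 (FS.coord (-2)) (fun S n c => ∀ c' ∈ S, ∀ u ∈ U.T n, Mem u c → Mem u c' → c = c')) ?_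
    intro c hc
    refine forall_elt (-1) (ext_fs S) (AE.of fun x => ext_sub S x)
      (Q := fun x c' => ∀ u ∈ U.T (x (-2)), Mem u (c.r (sh (-1) x)) → Mem u c' → c.r (sh (-1) x) = c')
      ((c.fs.shift (-1)).comp2 (FS.coord (-2)) (fun c n c' => ∀ u ∈ U.T n, Mem u c → Mem u c' → c = c')) ?_
    intro c' hc'
    refine forall_elt (-2) ((FS.coord (-2)).comp U.T) (AE.of fun x => subset_rfl)
      (Q := fun x u => Mem u (c.r (sh (-1) x)) → Mem u (c'.r (sh (-1) x)) → c.r (sh (-1) x) = c'.r (sh (-1) x))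
      ((c.fs.shift (-1)).comp2 (c'.fs.shift (-1)) (fun c c' u => Mem u c → Mem u c' → c = c')) ?_
    intro u _
    obtain ⟨⟨A, hA, hcA⟩, hcn⟩ := (hS'' c).1 hc
    obtain ⟨⟨A', hA', hcA'⟩, hcn'⟩ := (hS'' c').1 hc'
    rw [AE_imp, AE_imp, ← Mod.eq_iff_sh (-1)]
    intro h3 h4
    have h5 : smem u c := (smem_iff_sh (-2)).2 (((sset_iff_sh (-2)).1 hcA.1).mp2 h3 fun x h h' => ⟨h, h'⟩)
    have h6 : smem u c' := (smem_iff_sh (-2)).2 (((sset_iff_sh (-2)).1 hcA'.1).mp2 h4 fun x h h' => ⟨h, h'⟩)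
    rw [hcA.2] at h5
    rw [hcA'.2] at h6
    refine sset_ext hcA.1 hcA'.1 fun z => ?_
    rw [hcA.2, hcA'.2]
    exact ⟨fun h => equip_trans h (equip_trans (equip_symm h5) h6),
      fun h => equip_trans h (equip_trans (equip_symm h6) h5)⟩
  have h3 : AE (fun x => ∀ c ∈ ext S x, ∀ u, Mem u c → u ∈ U.T (x (-2))) := by
    refine forall_elt (-1) (ext_fs S) (AE.of fun x => ext_sub S x) (Q := fun x c => ∀ u, Mem u c → u ∈ U.T (x (-2)))
      ((FS.coord (-2)).comp (fun n c => ∀ u, Mem u c → u ∈ U.T n)) ?_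
    intro c hc
    obtain ⟨⟨A, hA, hcA⟩, hcn⟩ := (hS'' c).1 hc
    refine ((sset_iff_sh (-2)).1 hcA.1).mono fun x hx => ?_
    have h := hx.2
    rwa [show (-2 + 1 : ℤ) = -1 from rfl] at h
  refine (h1.and h2).mp2 h3 fun x hx hx' => ?_
  obtain ⟨h4, h5⟩ := hx
  choose! F hF hF' using h4
  refine Set.Finite.of_finite_image ((ZZ_finite (U := U) (x (-3))).subset (Set.image_subset_iff.2 hF)) ?_
  intro c hc c' hc' e
  exact h5 c hc c' hc' (F c) (hx' c hc _ (hF' c hc)) (hF' c hc) (by rw [e]; exact hF' c' hc')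

end Base

theorem stmt4 :
    ∃ (M : Type) (S : LNFU.Structure M), Nonempty M ∧ @Theory.Model LNFU M S NFUmAC ∧
      @acHolds M S ∧ @axCountGeqHolds M S ∧ @NCIFinite M S := by
  obtain ⟨W, _, _, ⟨U⟩⟩ := Base.exists_setup
  obtain ⟨b0, -⟩ := Base.Mod.exists_mk (U := U) (fun _ => Base.Tree.leaf U.bot) (Base.FS.const _) (fun x => U.leaf_bot_mem _)
  exact ⟨Base.Mod U, Base.modStr U, ⟨b0⟩, Base.mod_model, Base.mod_ac, Base.mod_axCount, Base.mod_nci⟩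

end NFUweak
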